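/- arXiv:2412.14595 — 11 statements merged into one kernel-verified Lean document; each statement's English description precedes it below -/
import Mathlib

section
/- There exists a constant C > 0 such that for every even positive integer n and every (x,y) in the square Q = [-1,1]^2, the Lebesgue function of the Morrow–Patterson points satisfies λ_n(x,y) ≤ C·n². Consequently the Lebesgue constant Λ_n^{MP} = max_{(x,y)∈Q} λ_n(x,y) grows at most like O(n²). -/
open Real Finset

/-- Chebyshev polynomial of the second kind, evaluated at a real number. -/
noncomputable def chebU (j : ℕ) (x : ℝ) : ℝ := (Polynomial.Chebyshev.U ℝ (j : ℤ)).eval x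

/-- Angles `w_m = mπ/(n+2)` of the Morrow–Patterson points. -/
noncomputable def mpW (n m : ℕ) : ℝ := m * π / (n + 2)

/-- Angles `v_k` of the Morrow–Patterson points (depending on the parity of `m`). -/
noncomputable def mpV (n m k : ℕ) : ℝ :=
  if Odd m then 2 * k * π / (n + 3) else (2 * k - 1) * π / (n + 3)

/-- The Lebesgue function of the Morrow–Patterson points `MP_n`. -/
noncomputable def lambdaMP (n : ℕ) (x y : ℝ) : ℝ :=
  (8 / ((n + 2) * (n + 3))) *
    ∑ m ∈ Finset.Icc 1 (n + 1), ∑ k ∈ Finset.Icc 1 (n / 2 + 1),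
      (1 - Real.cos (mpW n m) ^ 2) * (1 - Real.cos (mpV n m k) ^ 2) *
        |∑ i ∈ Finset.range (n + 1), ∑ j ∈ Finset.range (n - i + 1),
            chebU i (Real.cos (mpW n m)) * chebU j (Real.cos (mpV n m k)) *
              chebU i x * chebU j y|


lemma aux_parseval (L : ℕ) (ω : ℂ) (hω : IsPrimitiveRoot ω L) (hL : 0 < L) (y : ℂ) (hy : ‖y‖ = 1)
    (c : ℕ → ℂ) (K : ℕ) (hK : K ≤ L) :
    ∑ l ∈ range L, ‖∑ a ∈ range K, c a * (y * ω ^ l) ^ a‖ ^ 2 = L * ∑ a ∈ range K, ‖c a‖ ^ 2 := by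
  have hω1 : ‖ω‖ = 1 := hω.norm'_eq_one hL.ne'
  have hω0 : ω ≠ 0 := fun h => by simp [h] at hω1
  have hconj : (starRingEnd ℂ) ω = ω⁻¹ := (Complex.inv_eq_conj hω1).symm
  have hyc : y * (starRingEnd ℂ) y = 1 := by rw [Complex.mul_conj']; simp [hy]
  have key : ∀ a ∈ range K, ∀ b ∈ range K,
      ∑ l ∈ range L, (ω ^ a * (ω⁻¹) ^ b) ^ l = if a = b then (L : ℂ) else 0 := by
    intro a ha b hb
    rw [mem_range] at ha hb
    split_ifs with h
    · subst h
      have : ω ^ a * (ω⁻¹) ^ a = 1 := by rw [← mul_pow, mul_inv_cancel₀ hω0, one_pow]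
      simp only [this]
      simp
    · have hne : ω ^ a * (ω⁻¹) ^ b ≠ 1 := by
        intro h1
        apply h
        apply hω.pow_inj (by omega) (by omega)
        have : ω ^ b ≠ 0 := pow_ne_zero _ hω0
        rw [inv_pow] at h1
        field_simp at h1
        exact h1
      have hone : (ω ^ a * (ω⁻¹) ^ b) ^ L = 1 := by
        rw [mul_pow, ← pow_mul, ← pow_mul, mul_comm a, mul_comm b, pow_mul, pow_mul, inv_pow,
          hω.pow_eq_one]; simp
      have := geom_sum_mul (ω ^ a * (ω⁻¹) ^ b) L
      rw [hone, sub_self] at this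
      exact (mul_eq_zero.mp this).resolve_right (sub_ne_zero.mpr hne)
  apply Complex.ofReal_injective
  push_cast
  have h1 : ∀ l ∈ range L, ((‖∑ a ∈ range K, c a * (y * ω ^ l) ^ a‖ : ℂ)) ^ 2 =
      ∑ a ∈ range K, ∑ b ∈ range K, (c a * y ^ a * ((starRingEnd ℂ) (c b) * ((starRingEnd ℂ) y) ^ b)) *
        (ω ^ a * (ω⁻¹) ^ b) ^ l := by
    intro l _
    rw [← Complex.mul_conj', map_sum, Finset.sum_mul_sum]
    refine sum_congr rfl fun a _ => sum_congr rfl fun b _ => ?_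
    simp only [map_mul, map_pow, hconj]
    ring
  rw [sum_congr rfl h1, sum_comm, mul_sum]
  refine sum_congr rfl fun a ha => ?_
  rw [sum_comm]
  have h2 : ∀ b ∈ range K, ∑ l ∈ range L, (c a * y ^ a * ((starRingEnd ℂ) (c b) * ((starRingEnd ℂ) y) ^ b)) *
        (ω ^ a * (ω⁻¹) ^ b) ^ l = if a = b then
          (c a * y ^ a * ((starRingEnd ℂ) (c b) * ((starRingEnd ℂ) y) ^ b)) * (L : ℂ) else 0 := by
    intro b hb
    rw [← mul_sum, key a ha b hb]
    split_ifs <;> simp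
  rw [sum_congr rfl h2, Finset.sum_ite_eq, if_pos ha, ← Complex.mul_conj']
  have : y ^ a * ((starRingEnd ℂ) y) ^ a = 1 := by rw [← mul_pow, hyc, one_pow]
  linear_combination (c a * (starRingEnd ℂ) (c a) * L) * this

/-- admissible coefficient sequences -/
structure Adm (p : ℕ → ℝ) : Prop where
  zero : p 0 = 0
  one : |p 1| ≤ 1
  diff : ∀ a, |p (a + 2) - p a| ≤ 2

lemma Adm.le {p : ℕ → ℝ} (h : Adm p) : ∀ a : ℕ, |p a| ≤ a
  | 0 => by simp [h.zero]
  | 1 => by simpa using h.one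
  | a + 2 => by
    have h1 := h.diff a
    have h2 := h.le a
    have : p (a + 2) = (p (a + 2) - p a) + p a := by ring
    rw [this]
    refine (abs_add_le _ _).trans ?_
    push_cast; linarith

lemma adm_cheb (x : ℝ) (hx : x ∈ Set.Icc (-1 : ℝ) 1) :
    Adm (fun a : ℕ => (Polynomial.Chebyshev.U ℝ ((a : ℤ) - 1)).eval x) where
  zero := by simp
  one := by simp
  diff a := by
    have h := Polynomial.Chebyshev.two_mul_T_eq_U_sub_U ℝ ((a : ℤ) - 1)
    have h2 := Polynomial.Chebyshev.abs_eval_T_real_le_one ((a : ℤ) - 1 + 2) (abs_le.mpr hx)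
    have h3 := congrArg (Polynomial.eval x) h
    simp only [Polynomial.eval_mul, Polynomial.eval_sub, Polynomial.eval_ofNat] at h3
    have e : (((a + 2 : ℕ) : ℤ) - 1) = (a : ℤ) - 1 + 2 := by push_cast; ring
    simp only [e]
    rw [← h3, abs_mul, abs_two]
    linarith

noncomputable def diagD (p q : ℕ → ℝ) (z ζ : ℂ) (s : ℕ) : ℂ :=
  ∑ k ∈ range (s + 1), ((p k : ℂ) * z ^ k) * ((q (s - k) : ℂ) * ζ ^ (s - k))

def dif (p : ℕ → ℝ) : ℕ → ℝ
  | 0 => p 0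
  | 1 => p 1
  | a + 2 => p (a + 2) - p a

lemma Adm.dif_le {p : ℕ → ℝ} (h : Adm p) : ∀ a : ℕ, |dif p a| ≤ 2
  | 0 => by simp [dif, h.zero]
  | 1 => by simp only [dif]; linarith [h.one]
  | a + 2 => h.diff a

lemma diagD_coeff (p q : ℕ → ℝ) (z ζ : ℂ) (s : ℕ) :
    diagD p q z ζ s = PowerSeries.coeff s
      (PowerSeries.mk (fun a => (p a : ℂ) * z ^ a) * PowerSeries.mk (fun a => (q a : ℂ) * ζ ^ a)) := by
  rw [PowerSeries.coeff_mul, Finset.Nat.sum_antidiagonal_eq_sum_range_succ_mk]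
  simp [diagD]

lemma mk_dif (p : ℕ → ℝ) (z : ℂ) :
    PowerSeries.mk (fun a => (dif p a : ℂ) * z ^ a) =
      (1 - PowerSeries.C (z ^ 2) * PowerSeries.X ^ 2) * PowerSeries.mk (fun a => (p a : ℂ) * z ^ a) := by
  ext a
  rw [sub_mul, one_mul, map_sub, mul_assoc, PowerSeries.coeff_C_mul]
  match a with
  | 0 => simp [PowerSeries.coeff_X_pow_mul', dif]
  | 1 => simp [PowerSeries.coeff_X_pow_mul', dif]
  | a + 2 =>
    rw [PowerSeries.coeff_X_pow_mul]
    simp [dif]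
    ring

lemma dif_series (p q : ℕ → ℝ) (z ζ : ℂ) (s : ℕ) :
    diagD (dif p) (dif q) z ζ (s + 4) = diagD p q z ζ (s + 4) - (z ^ 2 + ζ ^ 2) * diagD p q z ζ (s + 2)
      + z ^ 2 * ζ ^ 2 * diagD p q z ζ s := by
  simp only [diagD_coeff, mk_dif]
  generalize PowerSeries.mk (fun a => (p a : ℂ) * z ^ a) = P
  generalize PowerSeries.mk (fun a => (q a : ℂ) * ζ ^ a) = Q
  have : (1 - PowerSeries.C (z ^ 2) * PowerSeries.X ^ 2) * P * ((1 - PowerSeries.C (ζ ^ 2) * PowerSeries.X ^ 2) * Q)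
    = P * Q - PowerSeries.C (z ^ 2 + ζ ^ 2) * (PowerSeries.X ^ 2 * (P * Q))
      + PowerSeries.C (z ^ 2 * ζ ^ 2) * (PowerSeries.X ^ 4 * (P * Q)) := by
    rw [map_add, map_mul]; ring
  rw [this, map_add, map_sub, PowerSeries.coeff_C_mul, PowerSeries.coeff_C_mul,
    PowerSeries.coeff_X_pow_mul, show s + 4 = (s + 2) + 2 from rfl, PowerSeries.coeff_X_pow_mul]

lemma diagD_dif_le {p q : ℕ → ℝ} (hp : Adm p) (hq : Adm q) (z ζ : ℂ) (hz : ‖z‖ = 1) (hζ : ‖ζ‖ = 1)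
    (s : ℕ) : ‖diagD (dif p) (dif q) z ζ s‖ ≤ 4 * (s + 1) := by
  refine (norm_sum_le _ _).trans ?_
  have : ∀ k ∈ range (s + 1), ‖((dif p k : ℂ) * z ^ k) * ((dif q (s - k) : ℂ) * ζ ^ (s - k))‖ ≤ 4 := by
    intro k _
    simp only [norm_mul, norm_pow, hz, hζ, one_pow, mul_one, Complex.norm_real, Real.norm_eq_abs]
    have := mul_le_mul (hp.dif_le k) (hq.dif_le (s - k)) (abs_nonneg _) (by norm_num)
    linarith
  refine (sum_le_sum this).trans ?_
  simp; linarith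

lemma main_ident {p q : ℕ → ℝ} (hp : Adm p) (hq : Adm q) (z ζ : ℂ) (N : ℕ) :
    (z ^ 2 - 1) * (ζ ^ 2 - 1) * ∑ s ∈ range (N + 5), diagD p q z ζ s =
      ∑ s ∈ range (N + 5), diagD (dif p) (dif q) z ζ s
      + (z ^ 2 * ζ ^ 2 - z ^ 2 - ζ ^ 2) * (diagD p q z ζ (N + 3) + diagD p q z ζ (N + 4))
      + z ^ 2 * ζ ^ 2 * (diagD p q z ζ (N + 1) + diagD p q z ζ (N + 2)) := by
  induction N with
  | zero =>
    have h := dif_series p q z ζ 0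
    simp only [zero_add] at h
    simp only [sum_range_succ, sum_range_zero, zero_add, h]
    simp [diagD, sum_range_succ, dif, hp.zero, hq.zero]
    ring
  | succ N ih =>
    rw [sum_range_succ, sum_range_succ (n := N + 5)]
    have h := dif_series p q z ζ (N + 1)
    simp only [show N + 1 + 4 = N + 5 by ring, show N + 1 + 2 = N + 3 by ring,
      show N + 1 + 3 = N + 4 by ring, show N + 1 + 1 = N + 2 by ring] at *
    linear_combination ih - h

lemma diagD_eq (p q : ℕ → ℝ) (z ζ : ℂ) (hz : z ≠ 0) (s : ℕ) :
    diagD p q z ζ s = z ^ s * ∑ b ∈ range (s + 1), ((p (s - b) * q b : ℝ) : ℂ) * (z⁻¹ * ζ) ^ b := by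
  rw [diagD, ← sum_range_reflect, mul_sum]
  refine sum_congr rfl fun j hj => ?_
  have hj' : j ≤ s := by have := mem_range.mp hj; omega
  have h1 : s + 1 - 1 - j = s - j := by omega
  have h2 : s - (s - j) = j := by omega
  rw [h1, h2]
  have h3 : z ^ s = z ^ (s - j) * z ^ j := by rw [← pow_add]; congr 1; omega
  rw [h3, mul_pow, inv_pow]
  have : z ^ j ≠ 0 := pow_ne_zero _ hz
  push_cast
  field_simp

def twist (ρ : ℝ) (r : ℕ → ℝ) : ℕ → ℝ
  | 0 => r 0
  | 1 => r 1
  | b + 2 => r (b + 2) - ρ * r b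

lemma twist_sum (ρ : ℝ) (r : ℕ → ℝ) (s : ℕ) (h1 : r (s + 1) = 0) (h2 : r (s + 2) = 0) (u : ℂ) :
    ∑ b ∈ range (s + 3), (twist ρ r b : ℂ) * u ^ b =
      (1 - ρ * u ^ 2) * ∑ b ∈ range (s + 1), (r b : ℂ) * u ^ b := by
  have e1 : ∑ b ∈ range (s + 1), (r b : ℂ) * u ^ b = ∑ b ∈ range (s + 3), (r b : ℂ) * u ^ b := by
    rw [sum_range_succ _ (s + 2), sum_range_succ _ (s + 1), h1, h2]; simp
  rw [sub_mul, one_mul]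
  nth_rewrite 1 [e1]
  rw [sum_range_succ', sum_range_succ', sum_range_succ' _ (s + 2), sum_range_succ' _ (s + 1)]
  simp only [twist]
  have : ∑ k ∈ range (s + 1), ((r (k + 1 + 1) - ρ * r k : ℝ) : ℂ) * u ^ (k + 1 + 1) =
    ∑ k ∈ range (s + 1), (r (k + 1 + 1) : ℂ) * u ^ (k + 1 + 1) -
      ρ * u ^ 2 * ∑ k ∈ range (s + 1), (r k : ℂ) * u ^ k := by
    rw [mul_sum, ← sum_sub_distrib]
    refine sum_congr rfl fun k _ => ?_
    push_cast; ring
  rw [this]; ring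

lemma Adm.diff_trunc {p : ℕ → ℝ} (h : Adm p) (s b : ℕ) : |p (s - (b + 2)) - p (s - b)| ≤ 2 := by
  rcases Nat.lt_or_ge s (b + 2) with hs | hs
  · have h0 : s - (b + 2) = 0 := by omega
    rw [h0, h.zero, zero_sub, abs_neg]
    have h2 := h.le (s - b)
    have : ((s - b : ℕ) : ℝ) ≤ 1 := by
      have : s - b ≤ 1 := by omega
      exact_mod_cast this
    linarith
  · have h0 : s - b = s - (b + 2) + 2 := by omega
    rw [h0, abs_sub_comm]
    exact h.diff _

lemma twist_le {p q : ℕ → ℝ} (hp : Adm p) (hq : Adm q) (M s b : ℕ) (hM : 1 ≤ M) (hs : s + 1 ≤ M)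
    (hb : b < s + 3) : |twist (1 - 1 / (M : ℝ)) (fun b => p (s - b) * q b) b| ≤ 7 * M := by
  have hMr : (1 : ℝ) ≤ M := by exact_mod_cast hM
  have hsr : (s : ℝ) + 1 ≤ M := by exact_mod_cast hs
  have hs0 : (0 : ℝ) ≤ s := by positivity
  match b with
  | 0 => simp [twist, hq.zero]
  | 1 =>
    simp only [twist]
    rw [abs_mul]
    have h1 := hp.le (s - 1)
    have h2 : ((s - 1 : ℕ) : ℝ) ≤ s := by exact_mod_cast Nat.sub_le _ _
    have := mul_le_mul (h1.trans h2) hq.one (abs_nonneg _) hs0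
    linarith
  | b + 2 =>
    simp only [twist]
    have hbs : (b : ℝ) ≤ s := by exact_mod_cast (by omega : b ≤ s)
    have hsb : ((s - b : ℕ) : ℝ) ≤ s := by exact_mod_cast Nat.sub_le _ _
    have e : p (s - (b + 2)) * q (b + 2) - (1 - 1 / (M : ℝ)) * (p (s - b) * q b) =
      (p (s - (b + 2)) - p (s - b)) * q (b + 2) + p (s - b) * (q (b + 2) - q b)
        + 1 / (M : ℝ) * (p (s - b) * q b) := by ring
    rw [e]
    have a1 : |(p (s - (b + 2)) - p (s - b)) * q (b + 2)| ≤ 2 * (s + 2) := by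
      rw [abs_mul]
      have h := hq.le (b + 2)
      push_cast at h
      exact mul_le_mul (hp.diff_trunc s b) (by linarith) (abs_nonneg _) (by norm_num)
    have a2 : |p (s - b) * (q (b + 2) - q b)| ≤ s * 2 := by
      rw [abs_mul]
      exact mul_le_mul ((hp.le _).trans hsb) (hq.diff b) (abs_nonneg _) hs0
    have a3 : |1 / (M : ℝ) * (p (s - b) * q b)| ≤ M := by
      rw [abs_mul, abs_mul, abs_of_pos (by positivity : 0 < 1 / (M : ℝ))]
      have := mul_le_mul ((hp.le _).trans hsb) ((hq.le b).trans hbs) (abs_nonneg _) hs0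
      rw [one_div, inv_mul_le_iff₀ (by linarith)]
      nlinarith
    have t1 := abs_add_le ((p (s - (b + 2)) - p (s - b)) * q (b + 2) + p (s - b) * (q (b + 2) - q b))
        (1 / (M : ℝ) * (p (s - b) * q b))
    have t2 := abs_add_le ((p (s - (b + 2)) - p (s - b)) * q (b + 2)) (p (s - b) * (q (b + 2) - q b))
    linarith

lemma rho_pow (M : ℕ) (hM : 1 ≤ M) : (1 - 1 / (M : ℝ)) ^ M ≤ 1 / 2 := by
  have h := Real.one_sub_div_pow_le_exp_neg (n := M) (t := 1) (by exact_mod_cast hM)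
  refine h.trans ?_
  rw [Real.exp_neg, one_div]
  have : (2 : ℝ) ≤ rexp 1 := by linarith [Real.add_one_le_exp (1 : ℝ)]
  exact inv_anti₀ (by norm_num) this

lemma weight_sum (M : ℕ) (hM : 1 ≤ M) (ω : ℂ) (hω : IsPrimitiveRoot ω (2 * M)) (y : ℂ) (hy : ‖y‖ = 1) :
    ∑ l ∈ range (2 * M), (‖1 - ((1 - 1 / (M : ℝ) : ℝ) : ℂ) * (y * ω ^ l) ^ 2‖⁻¹) ^ 2 ≤ 8 * (M : ℝ) ^ 2 := by
  have hMr : (1 : ℝ) ≤ M := by exact_mod_cast hM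
  set ρ : ℝ := 1 - 1 / (M : ℝ) with hρ
  have hρ1 : ρ < 1 := by rw [hρ]; have : 0 < 1 / (M : ℝ) := by positivity
                         linarith
  have hρ0 : 0 ≤ ρ := by
    rw [hρ, sub_nonneg, div_le_one (by linarith)]; exact hMr
  have hρM : ρ ^ M ≤ 1 / 2 := rho_pow M hM
  have hω1 : ‖ω‖ = 1 := hω.norm'_eq_one (by omega)
  set c : ℕ → ℂ := fun a => if Even a then ((ρ ^ (a / 2) : ℝ) : ℂ) else 0 with hc
  have hsum : ∀ u : ℂ, ∑ a ∈ range (2 * M), c a * u ^ a = ∑ k ∈ range M, ((ρ : ℂ) * u ^ 2) ^ k := by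
    intro u
    have : ∀ K : ℕ, ∑ a ∈ range (2 * K), c a * u ^ a = ∑ k ∈ range K, ((ρ : ℂ) * u ^ 2) ^ k := by
      intro K
      induction K with
      | zero => simp
      | succ K ih =>
        rw [show 2 * (K + 1) = 2 * K + 1 + 1 by ring, sum_range_succ, sum_range_succ, ih,
          sum_range_succ]
        simp [hc, mul_pow, pow_mul]
    exact this M
  have hpar := aux_parseval (2 * M) ω hω (by omega) y hy c (2 * M) le_rfl
  have hcle : ∑ a ∈ range (2 * M), ‖c a‖ ^ 2 ≤ M := by
    have : ∀ K : ℕ, ∑ a ∈ range (2 * K), ‖c a‖ ^ 2 ≤ K := by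
      intro K
      induction K with
      | zero => simp
      | succ K ih =>
        rw [show 2 * (K + 1) = 2 * K + 1 + 1 by ring, sum_range_succ, sum_range_succ]
        have h1 : ‖c (2 * K + 1)‖ = 0 := by simp [hc]
        have h2 : ‖c (2 * K)‖ ≤ 1 := by
          simp only [hc, even_two, Even.mul_right, if_true, Complex.norm_real, Real.norm_eq_abs]
          rw [abs_of_nonneg (by positivity)]
          exact pow_le_one₀ hρ0 hρ1.le
        have h3 : ‖c (2 * K)‖ ^ 2 ≤ 1 := pow_le_one₀ (norm_nonneg _) h2
        rw [h1]
        push_cast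
        linarith
    exact this M
  have hpt : ∀ l ∈ range (2 * M), (‖1 - (ρ : ℂ) * (y * ω ^ l) ^ 2‖⁻¹) ^ 2 ≤
      4 * ‖∑ a ∈ range (2 * M), c a * (y * ω ^ l) ^ a‖ ^ 2 := by
    intro l _
    have hu : ‖y * ω ^ l‖ = 1 := by simp [hy, hω1]
    rw [hsum]
    set v : ℂ := (ρ : ℂ) * (y * ω ^ l) ^ 2 with hv
    have hvn : ‖v‖ = ρ := by
      rw [hv, norm_mul, norm_pow, hu]; simp [abs_of_nonneg hρ0]
    have hg := mul_neg_geom_sum v M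
    have h1 : 1 / 2 ≤ ‖1 - v ^ M‖ := by
      have := norm_sub_norm_le (1 : ℂ) (v ^ M)
      rw [norm_pow, hvn, norm_one] at this
      linarith
    rw [← hg, norm_mul] at h1
    have h2 : 0 < ‖1 - v‖ := by
      have := norm_sub_norm_le (1 : ℂ) v
      rw [hvn, norm_one] at this
      linarith
    have h3 : ‖1 - v‖⁻¹ ≤ 2 * ‖∑ k ∈ range M, v ^ k‖ := by
      rw [inv_le_iff_one_le_mul₀ h2]; linarith
    have := pow_le_pow_left₀ (by positivity) h3 2
    linarith
  refine (sum_le_sum hpt).trans ?_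
  rw [← mul_sum, hpar]
  push_cast
  nlinarith

lemma sumD_le {p q : ℕ → ℝ} (hp : Adm p) (hq : Adm q) (M s : ℕ) (hM : 2 ≤ M) (hs : s + 1 ≤ M)
    (ω : ℂ) (hω : IsPrimitiveRoot ω (2 * M)) (z : ℂ) (hz : ‖z‖ = 1) :
    ∑ l ∈ range (2 * M), ‖diagD p q z (ω ^ l) s‖ ≤ 40 * (M : ℝ) ^ 3 := by
  have hMr : (2 : ℝ) ≤ M := by exact_mod_cast hM
  have hz0 : z ≠ 0 := fun h => by simp [h] at hz
  have hy : ‖z⁻¹‖ = 1 := by simp [hz]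
  have hω1 : ‖ω‖ = 1 := hω.norm'_eq_one (by omega)
  set ρ : ℝ := 1 - 1 / (M : ℝ) with hρ
  have hρ1 : ρ < 1 := by rw [hρ]; have : 0 < 1 / (M : ℝ) := by positivity
                         linarith
  have hρ0 : 0 ≤ ρ := by
    rw [hρ, sub_nonneg, div_le_one (by linarith)]; linarith
  set r : ℕ → ℝ := fun b => p (s - b) * q b with hr
  have r1 : r (s + 1) = 0 := by simp [hr, hp.zero]
  have r2 : r (s + 2) = 0 := by simp [hr, hp.zero]
  have hA := weight_sum M (by omega) ω hω z⁻¹ hy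
  have hB := aux_parseval (2 * M) ω hω (by omega) z⁻¹ hy (fun b => (twist ρ r b : ℂ)) (s + 3) (by omega)
  have hBle : ∑ a ∈ range (s + 3), ‖(twist ρ r a : ℂ)‖ ^ 2 ≤ 2 * M * (7 * M) ^ 2 := by
    have : ∀ a ∈ range (s + 3), ‖(twist ρ r a : ℂ)‖ ^ 2 ≤ (7 * (M : ℝ)) ^ 2 := by
      intro a ha
      rw [Complex.norm_real, Real.norm_eq_abs]
      exact pow_le_pow_left₀ (abs_nonneg _)
        (twist_le hp hq M s a (by omega) hs (mem_range.mp ha)) 2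
    refine (sum_le_sum this).trans ?_
    rw [sum_const, card_range, nsmul_eq_mul]
    have : ((s + 3 : ℕ) : ℝ) ≤ 2 * M := by exact_mod_cast (by omega : s + 3 ≤ 2 * M)
    exact mul_le_mul_of_nonneg_right this (by positivity)
  have hpt : ∀ l ∈ range (2 * M), ‖diagD p q z (ω ^ l) s‖ =
      ‖1 - (ρ : ℂ) * (z⁻¹ * ω ^ l) ^ 2‖⁻¹ *
        ‖∑ a ∈ range (s + 3), (twist ρ r a : ℂ) * (z⁻¹ * ω ^ l) ^ a‖ := by
    intro l _
    have hu : ‖z⁻¹ * ω ^ l‖ = 1 := by simp [hz, hω1]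
    rw [diagD_eq p q z _ hz0, twist_sum ρ r s r1 r2, norm_mul, norm_mul, norm_pow, hz, one_pow, one_mul]
    have h2 : 0 < ‖1 - (ρ : ℂ) * (z⁻¹ * ω ^ l) ^ 2‖ := by
      have := norm_sub_norm_le (1 : ℂ) ((ρ : ℂ) * (z⁻¹ * ω ^ l) ^ 2)
      rw [norm_mul, norm_pow, hu, norm_one, one_pow, mul_one, Complex.norm_real, Real.norm_eq_abs,
        abs_of_nonneg hρ0] at this
      linarith
    rw [inv_mul_cancel_left₀ h2.ne']
  rw [sum_congr rfl hpt]
  refine abs_le_of_sq_le_sq' ?_ (by positivity) |>.2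
  refine (sum_mul_sq_le_sq_mul_sq _ _ _).trans ?_
  rw [hB]
  have h4 : ((2 * M : ℕ) : ℝ) * ∑ a ∈ range (s + 3), ‖(twist ρ r a : ℂ)‖ ^ 2 ≤
      2 * M * (2 * M * (7 * M) ^ 2) := by
    push_cast
    exact mul_le_mul_of_nonneg_left hBle (by positivity)
  refine (mul_le_mul hA h4 (by positivity) (by positivity)).trans ?_
  have : (0 : ℝ) ≤ (M : ℝ) ^ 6 := by positivity
  nlinarith

lemma sumH_le {p q : ℕ → ℝ} (hp : Adm p) (hq : Adm q) (N : ℕ)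
    (ω : ℂ) (hω : IsPrimitiveRoot ω (2 * (N + 5))) (z : ℂ) (hz : ‖z‖ = 1) :
    ∑ l ∈ range (2 * (N + 5)), ‖(z ^ 2 - 1) * ((ω ^ l) ^ 2 - 1) *
      ∑ s ∈ range (N + 5), diagD p q z (ω ^ l) s‖ ≤ 328 * ((N + 5 : ℕ) : ℝ) ^ 3 := by
  have hω1 : ‖ω‖ = 1 := hω.norm'_eq_one (by omega)
  set M := N + 5 with hMdef
  have b1 := sumD_le hp hq M (N + 1) (by omega) (by omega) ω hω z hz
  have b2 := sumD_le hp hq M (N + 2) (by omega) (by omega) ω hω z hz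
  have b3 := sumD_le hp hq M (N + 3) (by omega) (by omega) ω hω z hz
  have b4 := sumD_le hp hq M (N + 4) (by omega) (by omega) ω hω z hz
  have hpt : ∀ l ∈ range (2 * M), ‖(z ^ 2 - 1) * ((ω ^ l) ^ 2 - 1) *
      ∑ s ∈ range M, diagD p q z (ω ^ l) s‖ ≤ 4 * (M : ℝ) ^ 2 +
        3 * ‖diagD p q z (ω ^ l) (N + 3)‖ + 3 * ‖diagD p q z (ω ^ l) (N + 4)‖
        + ‖diagD p q z (ω ^ l) (N + 1)‖ + ‖diagD p q z (ω ^ l) (N + 2)‖ := by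
    intro l _
    have hζ : ‖ω ^ l‖ = 1 := by simp [hω1]
    generalize ω ^ l = ζ at hζ
    rw [hMdef, main_ident hp hq, ← hMdef]
    have c1 : ‖∑ s ∈ range M, diagD (dif p) (dif q) z ζ s‖ ≤ 4 * (M : ℝ) ^ 2 := by
      refine (norm_sum_le _ _).trans ?_
      have : ∀ s ∈ range M, ‖diagD (dif p) (dif q) z ζ s‖ ≤ 4 * (M : ℝ) := by
        intro s hs
        refine (diagD_dif_le hp hq z ζ hz hζ s).trans ?_
        have : (s : ℝ) + 1 ≤ M := by exact_mod_cast mem_range.mp hs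
        linarith
      refine (sum_le_sum this).trans ?_
      rw [sum_const, card_range, nsmul_eq_mul]
      linarith
    have c2 : ‖z ^ 2 * ζ ^ 2 - z ^ 2 - ζ ^ 2‖ ≤ 3 := by
      refine (norm_sub_le _ _).trans ?_
      have := norm_sub_le (z ^ 2 * ζ ^ 2) (z ^ 2)
      simp only [norm_mul, norm_pow, hz, hζ] at *
      linarith
    have c3 : ‖z ^ 2 * ζ ^ 2‖ = 1 := by simp [hz, hζ]
    refine (norm_add₃_le).trans ?_
    rw [norm_mul, norm_mul, c3]
    have d1 := norm_add_le (diagD p q z ζ (N + 3)) (diagD p q z ζ (N + 4))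
    have d2 := norm_add_le (diagD p q z ζ (N + 1)) (diagD p q z ζ (N + 2))
    have d3 := mul_le_mul c2 d1 (norm_nonneg _) (by norm_num)
    linarith
  refine (sum_le_sum hpt).trans ?_
  simp only [sum_add_distrib, ← mul_sum]
  rw [sum_const, card_range, nsmul_eq_mul]
  push_cast
  nlinarith

lemma sum_diagD {p q : ℕ → ℝ} (hp : p 0 = 0) (hq : q 0 = 0) (z ζ : ℂ) (n : ℕ) :
    ∑ s ∈ range (n + 3), diagD p q z ζ s = ∑ i ∈ range (n + 1), ∑ j ∈ range (n - i + 1),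
      ((p (i + 1) : ℂ) * z ^ (i + 1)) * ((q (j + 1) : ℂ) * ζ ^ (j + 1)) := by
  have h := sum_range_diag_flip (n + 3) (fun a b : ℕ => ((p a : ℂ) * z ^ a) * ((q b : ℂ) * ζ ^ b))
  simp only [diagD]
  rw [h, sum_range_succ']
  simp only [hp, Complex.ofReal_zero, zero_mul, sum_const_zero, add_zero]
  rw [sum_range_succ]
  have : n + 3 - (n + 1 + 1) = 1 := by omega
  rw [this]
  simp only [sum_range_one, hq, Complex.ofReal_zero, zero_mul, mul_zero, add_zero]
  refine sum_congr rfl fun i hi => ?_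
  have : n + 3 - (i + 1) = n - i + 1 + 1 := by have := mem_range.mp hi; omega
  rw [this, sum_range_succ']
  simp [hq]

lemma norm_sq_sub_one (w : ℝ) : ‖Complex.exp (w * Complex.I) ^ 2 - 1‖ = 2 * |Real.sin w| := by
  have : Complex.exp (w * Complex.I) ^ 2 - 1 =
      2 * Complex.I * (Real.sin w : ℂ) * Complex.exp (w * Complex.I) := by
    rw [Complex.exp_mul_I]
    push_cast
    have h := Complex.sin_sq_add_cos_sq (w : ℂ)
    linear_combination h + (-Complex.sin w ^ 2) * Complex.I_sq
  rw [this, norm_mul, norm_mul, Complex.norm_exp_ofReal_mul_I, Complex.norm_real, Real.norm_eq_abs]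
  simp

lemma re_term (a b : ℝ) (w v : ℝ) (i j : ℕ) :
    (((a : ℂ) * Complex.exp (w * Complex.I) ^ i) * ((b : ℂ) * Complex.exp (v * Complex.I) ^ j)).re =
      a * b * Real.cos (i * w + j * v) := by
  have : ((a : ℂ) * Complex.exp (w * Complex.I) ^ i) * ((b : ℂ) * Complex.exp (v * Complex.I) ^ j) =
      ((a * b : ℝ) : ℂ) * Complex.exp (((i * w + j * v : ℝ) : ℂ) * Complex.I) := by
    rw [← Complex.exp_nat_mul, ← Complex.exp_nat_mul]
    push_cast
    rw [add_mul, Complex.exp_add]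
    ring_nf
  rw [this, Complex.re_ofReal_mul, Complex.exp_ofReal_mul_I_re]

noncomputable def pc (x : ℝ) (a : ℕ) : ℝ := (Polynomial.Chebyshev.U ℝ ((a : ℤ) - 1)).eval x

noncomputable def HH (n : ℕ) (x y : ℝ) (z ζ : ℂ) : ℝ :=
  ‖(z ^ 2 - 1) * (ζ ^ 2 - 1) * ∑ s ∈ range (n + 3), diagD (pc x) (pc y) z ζ s‖

lemma chebU_pc (i : ℕ) (x : ℝ) : chebU i x = pc x (i + 1) := by
  simp [chebU, pc]

lemma chebU_sin (i : ℕ) (w : ℝ) : chebU i (Real.cos w) * Real.sin w = Real.sin ((i + 1) * w) := by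
  have := Polynomial.Chebyshev.U_real_cos w (i : ℤ)
  simpa [chebU] using this

lemma term_le (n : ℕ) (x y w v : ℝ) :
    (1 - Real.cos w ^ 2) * (1 - Real.cos v ^ 2) *
        |∑ i ∈ Finset.range (n + 1), ∑ j ∈ Finset.range (n - i + 1),
            chebU i (Real.cos w) * chebU j (Real.cos v) * chebU i x * chebU j y| ≤
      1 / 8 * (HH n x y (Complex.exp (w * Complex.I)) (Complex.exp (v * Complex.I)) +
        HH n x y (Complex.exp ((-w : ℝ) * Complex.I)) (Complex.exp (v * Complex.I))) := by
  have e0 : ∀ t : ℝ, 1 - Real.cos t ^ 2 = |Real.sin t| * |Real.sin t| := by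
    intro t; rw [abs_mul_abs_self]; linarith [Real.sin_sq_add_cos_sq t]
  have e1 : (1 - Real.cos w ^ 2) * (1 - Real.cos v ^ 2) *
        |∑ i ∈ Finset.range (n + 1), ∑ j ∈ Finset.range (n - i + 1),
            chebU i (Real.cos w) * chebU j (Real.cos v) * chebU i x * chebU j y| =
      |Real.sin w| * |Real.sin v| * |∑ i ∈ Finset.range (n + 1), ∑ j ∈ Finset.range (n - i + 1),
        pc x (i + 1) * pc y (j + 1) * (Real.sin ((i + 1) * w) * Real.sin ((j + 1) * v))| := by
    have : ∑ i ∈ Finset.range (n + 1), ∑ j ∈ Finset.range (n - i + 1),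
        pc x (i + 1) * pc y (j + 1) * (Real.sin ((i + 1) * w) * Real.sin ((j + 1) * v)) =
        Real.sin w * Real.sin v * ∑ i ∈ Finset.range (n + 1), ∑ j ∈ Finset.range (n - i + 1),
            chebU i (Real.cos w) * chebU j (Real.cos v) * chebU i x * chebU j y := by
      rw [mul_sum]
      refine sum_congr rfl fun i _ => ?_
      rw [mul_sum]
      refine sum_congr rfl fun j _ => ?_
      rw [← chebU_sin, ← chebU_sin, ← chebU_pc, ← chebU_pc]
      ring
    rw [this, abs_mul, abs_mul, e0, e0]
    ring
  have hx0 : pc x 0 = 0 := by simp [pc]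
  have hy0 : pc y 0 = 0 := by simp [pc]
  have e2 : ∑ i ∈ Finset.range (n + 1), ∑ j ∈ Finset.range (n - i + 1),
        pc x (i + 1) * pc y (j + 1) * (Real.sin ((i + 1) * w) * Real.sin ((j + 1) * v)) =
      1 / 2 * ((∑ s ∈ range (n + 3), diagD (pc x) (pc y) (Complex.exp ((-w : ℝ) * Complex.I))
          (Complex.exp (v * Complex.I)) s).re -
        (∑ s ∈ range (n + 3), diagD (pc x) (pc y) (Complex.exp (w * Complex.I))
          (Complex.exp (v * Complex.I)) s).re) := by
    rw [sum_diagD hx0 hy0, sum_diagD hx0 hy0, Complex.re_sum, Complex.re_sum, ← sum_sub_distrib, mul_sum]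
    refine sum_congr rfl fun i _ => ?_
    rw [Complex.re_sum, Complex.re_sum, ← sum_sub_distrib, mul_sum]
    refine sum_congr rfl fun j _ => ?_
    rw [re_term, re_term, Real.cos_add, Real.cos_add, mul_neg, Real.cos_neg, Real.sin_neg]
    push_cast
    ring
  rw [e1, e2]
  simp only [HH, norm_mul, norm_sq_sub_one, Real.sin_neg, abs_neg]
  set A := ∑ s ∈ range (n + 3), diagD (pc x) (pc y) (Complex.exp ((-w : ℝ) * Complex.I))
          (Complex.exp (v * Complex.I)) s
  set B := ∑ s ∈ range (n + 3), diagD (pc x) (pc y) (Complex.exp (w * Complex.I))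
          (Complex.exp (v * Complex.I)) s
  have h1 : |1 / 2 * (A.re - B.re)| ≤ 1 / 2 * (‖A‖ + ‖B‖) := by
    rw [abs_mul, abs_of_pos (by norm_num : (0 : ℝ) < 1 / 2)]
    have a1 := abs_sub A.re B.re
    have a2 := Complex.abs_re_le_norm A
    have a3 := Complex.abs_re_le_norm B
    linarith
  have h2 := mul_le_mul_of_nonneg_left h1 (by positivity : 0 ≤ |Real.sin w| * |Real.sin v|)
  linarith

lemma sumHH_le (n : ℕ) (hn : 2 ≤ n) (x y : ℝ) (hx : x ∈ Set.Icc (-1 : ℝ) 1)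
    (hy : y ∈ Set.Icc (-1 : ℝ) 1) (w : ℝ) :
    ∑ l ∈ range (2 * (n + 3)), HH n x y (Complex.exp (w * Complex.I))
      (Complex.exp ((l * π / (n + 3) : ℝ) * Complex.I)) ≤ 328 * ((n : ℝ) + 3) ^ 3 := by
  obtain ⟨N, rfl⟩ : ∃ N, n = N + 2 := ⟨n - 2, by omega⟩
  have hω := Complex.isPrimitiveRoot_exp (2 * (N + 5)) (by omega)
  have h := sumH_le (adm_cheb x hx) (adm_cheb y hy) N _ hω (Complex.exp (w * Complex.I))
    (Complex.norm_exp_ofReal_mul_I w)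
  have e : ((N + 2 : ℕ) : ℝ) + 3 = ((N + 5 : ℕ) : ℝ) := by push_cast; ring
  rw [e]
  refine le_of_eq_of_le ?_ h
  refine sum_congr rfl fun l _ => ?_
  have : Complex.exp ((l * π / ((N + 5 : ℕ) : ℝ) : ℝ) * Complex.I) =
      Complex.exp (2 * π * Complex.I / ((2 * (N + 5) : ℕ) : ℂ)) ^ l := by
    rw [← Complex.exp_nat_mul]
    congr 1
    push_cast
    have : (N : ℂ) + 5 ≠ 0 := by exact_mod_cast (by omega : N + 5 ≠ 0)
    field_simp
  rw [HH, this]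
  rfl

lemma sum_k_le (n m : ℕ) (hn : Even n) (g : ℝ → ℝ) (hg : ∀ t, 0 ≤ g t) :
    ∑ k ∈ Finset.Icc 1 (n / 2 + 1), g (mpV n m k) ≤
      ∑ l ∈ range (2 * (n + 3)), g (l * π / (n + 3)) := by
  set f : ℕ → ℕ := fun k => if Odd m then 2 * k else 2 * k - 1 with hf
  have h1 : ∀ k ∈ Finset.Icc 1 (n / 2 + 1), g (mpV n m k) = g ((f k : ℕ) * π / (n + 3)) := by
    intro k hk
    have hk1 := (Finset.mem_Icc.mp hk).1
    simp only [mpV, hf]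
    split_ifs
    · push_cast; rfl
    · rw [Nat.cast_sub (by omega)]; push_cast; rfl
  have hinj : Set.InjOn f (Finset.Icc 1 (n / 2 + 1) : Finset ℕ) := by
    intro a ha b hb hab
    have := Finset.mem_Icc.mp ha
    have := Finset.mem_Icc.mp hb
    simp only [hf] at hab
    split_ifs at hab <;> omega
  rw [sum_congr rfl h1, ← sum_image (f := fun l : ℕ => g ((l : ℕ) * π / (n + 3))) hinj]
  refine sum_le_sum_of_subset_of_nonneg ?_ fun _ _ _ => hg _
  intro l hl
  obtain ⟨k, hk, rfl⟩ := Finset.mem_image.mp hl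
  have := Finset.mem_Icc.mp hk
  rw [mem_range]
  simp only [hf]
  split_ifs <;> omega

/-- The Lebesgue constant of the Morrow–Patterson points grows at most like `O(n²)`:
there is a constant `C > 0` such that for every even positive integer `n` and every
point `(x,y)` of the square `Q = [-1,1]²` one has `λ_n(x,y) ≤ C n²`. -/
theorem lambdaMP_le_quadratic :
    ∃ C : ℝ, 0 < C ∧ ∀ n : ℕ, 0 < n → Even n →
      ∀ x ∈ Set.Icc (-1 : ℝ) 1, ∀ y ∈ Set.Icc (-1 : ℝ) 1,
        lambdaMP n x y ≤ C * (n : ℝ) ^ 2 := by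
  refine ⟨10496, by norm_num, fun n hn0 hn x hx y hy => ?_⟩
  have hn2 : 2 ≤ n := by obtain ⟨k, rfl⟩ := hn; omega
  have hnr : (2 : ℝ) ≤ n := by exact_mod_cast hn2
  have hm : ∀ m ∈ Finset.Icc 1 (n + 1), ∑ k ∈ Finset.Icc 1 (n / 2 + 1),
      (1 - Real.cos (mpW n m) ^ 2) * (1 - Real.cos (mpV n m k) ^ 2) *
        |∑ i ∈ Finset.range (n + 1), ∑ j ∈ Finset.range (n - i + 1),
            chebU i (Real.cos (mpW n m)) * chebU j (Real.cos (mpV n m k)) *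
              chebU i x * chebU j y| ≤ 82 * ((n : ℝ) + 3) ^ 3 := by
    intro m _
    refine (sum_le_sum fun k _ => term_le n x y (mpW n m) (mpV n m k)).trans ?_
    rw [← mul_sum, sum_add_distrib]
    have s1 := sum_k_le n m hn (fun v => HH n x y (Complex.exp (mpW n m * Complex.I))
      (Complex.exp (v * Complex.I))) (fun _ => norm_nonneg _)
    have s2 := sum_k_le n m hn (fun v => HH n x y (Complex.exp ((-mpW n m : ℝ) * Complex.I))
      (Complex.exp (v * Complex.I))) (fun _ => norm_nonneg _)
    have t1 := sumHH_le n hn2 x y hx hy (mpW n m)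
    have t2 := sumHH_le n hn2 x y hx hy (-mpW n m)
    linarith [s1.trans t1, s2.trans t2]
  have hS := sum_le_sum hm
  rw [sum_const, Nat.card_Icc, nsmul_eq_mul] at hS
  have hc : ((n + 1 + 1 - 1 : ℕ) : ℝ) = n + 1 := by push_cast [Nat.add_sub_cancel]; ring
  rw [hc] at hS
  unfold lambdaMP
  refine (mul_le_mul_of_nonneg_left hS (by positivity)).trans ?_
  have e : 8 / (((n : ℝ) + 2) * (n + 3)) * (((n : ℝ) + 1) * (82 * ((n : ℝ) + 3) ^ 3)) =
      656 * (((n : ℝ) + 1) / (n + 2)) * (n + 3) ^ 2 := by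
    field_simp
    ring
  rw [e]
  have h1 : ((n : ℝ) + 1) / (n + 2) ≤ 1 := by rw [div_le_one (by positivity)]; linarith
  have h2 : ((n : ℝ) + 3) ^ 2 ≤ 16 * n ^ 2 := by nlinarith
  have h3 := mul_le_mul h1 h2 (by positivity) (by norm_num)
  nlinarith
end

section
/- For every fixed δ ∈ (0, π/2) there exists a constant C > 0 (depending only on δ) such that for every even positive integer n and all θ, φ ∈ [δ, π−δ], the Lebesgue function of the Morrow–Patterson points satisfies λ_n(cos θ, cos φ) ≤ C·n. -/
open Real Finset

lemma aux_cos_sum (N : ℕ) (hN : 0 < N) (c : ℝ) (h0 : c ≠ 0) (h1 : |c| < 2 * N)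
    (h2 : Real.sin (c * π) = 0) :
    ∑ l ∈ Finset.range N, Real.cos (l * (c * π / N)) = (1 - Real.cos (c * π)) / 2 := by
  have hNr : (0 : ℝ) < N := by exact_mod_cast hN
  have key := Real.sin_mul_sum_cos N (c * π / N) 0
  have hs : Real.sin (c * π / N / 2) ≠ 0 := by
    obtain ⟨ha, hb⟩ := abs_lt.1 h1
    intro h
    rw [Real.sin_eq_zero_iff_of_lt_of_lt] at h
    · have : c * π = 0 := by field_simp at h; simpa using h
      rcases mul_eq_zero.1 this with h | h
      · exact h0 h
      · exact Real.pi_ne_zero h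
    · rw [div_div, lt_div_iff₀ (by positivity)]
      nlinarith [Real.pi_pos]
    · rw [div_div, div_lt_iff₀ (by positivity)]
      nlinarith [Real.pi_pos]
  have e1 : (N : ℝ) * (c * π / N) / 2 = c * π / 2 := by field_simp
  have e2 : ((N : ℝ) - 1) * (c * π / N) / 2 + 0 = c * π / 2 - c * π / N / 2 := by
    field_simp; ring
  have e3 : Real.sin (c * π / 2) * Real.cos (c * π / 2) = 0 := by
    have : c * π = 2 * (c * π / 2) := by ring
    rw [this, Real.sin_two_mul] at h2
    linarith
  have e4 : Real.cos (c * π) = 1 - 2 * Real.sin (c * π / 2) ^ 2 := by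
    have : c * π = 2 * (c * π / 2) := by ring
    rw [this, Real.cos_two_mul, Real.cos_sq']
    ring_nf
  apply mul_left_cancel₀ hs
  rw [e4]
  simp only [add_zero] at key e2
  simp only [mul_comm _ (c * π / (N : ℝ))] at key e1 e2 ⊢
  rw [key, e1, e2, Real.cos_sub]
  linear_combination Real.cos (c * π / N / 2) * e3

lemma aux_orth (N p q : ℕ) (hp : 0 < p) (hq : 0 < q) (hpN : p < N) (hqN : q < N) :
    ∑ l ∈ Finset.range N, Real.sin (p * (l * π / N)) * Real.sin (q * (l * π / N))
      = if p = q then (N : ℝ) / 2 else 0 := by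
  have hN : 0 < N := by omega
  have hpr : (0 : ℝ) < p := by exact_mod_cast hp
  have hqr : (0 : ℝ) < q := by exact_mod_cast hq
  have hpr' : (p : ℝ) < N := by exact_mod_cast hpN
  have hqr' : (q : ℝ) < N := by exact_mod_cast hqN
  have hplus := aux_cos_sum N hN (p + q) (by positivity)
    (by rw [abs_of_pos (by positivity)]; linarith)
    (by have := Real.sin_nat_mul_pi (p + q); push_cast at this; exact this)
  have hsplit : ∑ l ∈ Finset.range N, Real.sin (p * (l * π / N)) * Real.sin (q * (l * π / N))
      = (∑ l ∈ Finset.range N, Real.cos (l * (((p : ℝ) - q) * π / N))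
        - ∑ l ∈ Finset.range N, Real.cos (l * (((p : ℝ) + q) * π / N))) / 2 := by
    rw [← Finset.sum_sub_distrib, Finset.sum_div]
    refine Finset.sum_congr rfl fun l _ => ?_
    have e1 : (l : ℝ) * (((p : ℝ) - q) * π / N) = p * (l * π / N) - q * (l * π / N) := by ring
    have e2 : (l : ℝ) * (((p : ℝ) + q) * π / N) = p * (l * π / N) + q * (l * π / N) := by ring
    rw [e1, e2, Real.cos_sub, Real.cos_add]
    ring
  rw [hsplit, hplus]
  split_ifs with h
  · subst h
    have : Real.cos (((p : ℝ) + p) * π) = 1 := by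
      have := Real.cos_nat_mul_two_pi p
      rw [← this]; ring_nf
    rw [this]
    simp
  · have hminus := aux_cos_sum N hN (p - q)
      (sub_ne_zero.2 (by exact_mod_cast h))
      (by rw [abs_lt]; constructor <;> linarith)
      (by have := Real.sin_int_mul_pi ((p : ℤ) - q); push_cast at this; exact this)
    have : Real.cos (((p : ℝ) + q) * π) = Real.cos (((p : ℝ) - q) * π) := by
      rw [← Real.cos_add_nat_mul_two_pi (((p : ℝ) - q) * π) q]; ring_nf
    rw [hminus, this]
    ring

lemma aux_parseval_s1 (N M : ℕ) (hM : M < N) (a : ℕ → ℝ) :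
    ∑ l ∈ Finset.range N, (∑ i ∈ Finset.range M, a i * Real.sin ((i + 1) * (l * π / N))) ^ 2
      = (N : ℝ) / 2 * ∑ i ∈ Finset.range M, a i ^ 2 := by
  simp_rw [sq, Finset.sum_mul_sum]
  rw [Finset.sum_comm, Finset.mul_sum]
  refine Finset.sum_congr rfl fun i hi => ?_
  rw [Finset.sum_comm]
  have hi' := Finset.mem_range.1 hi
  have : ∀ j ∈ Finset.range M, ∑ l ∈ Finset.range N,
      a i * Real.sin ((i + 1) * (l * π / N)) * (a j * Real.sin ((j + 1) * (l * π / N)))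
      = if i = j then a i * a j * ((N : ℝ) / 2) else 0 := by
    intro j hj
    have hj' := Finset.mem_range.1 hj
    have h := aux_orth N (i + 1) (j + 1) (by omega) (by omega) (by omega) (by omega)
    push_cast at h
    have h2 : ∑ l ∈ Finset.range N,
      a i * Real.sin ((i + 1) * (l * π / N)) * (a j * Real.sin ((j + 1) * (l * π / N)))
      = a i * a j * ∑ l ∈ Finset.range N,
        Real.sin ((i + 1) * (l * π / N)) * Real.sin ((j + 1) * (l * π / N)) := by
      rw [Finset.mul_sum]
      exact Finset.sum_congr rfl fun l _ => by ring
    rw [h2, h]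
    by_cases hij : i = j <;> simp [hij]
  rw [Finset.sum_congr rfl this, Finset.sum_ite_eq, if_pos hi]
  ring

/-- The double sine sum. -/
noncomputable def auxF (n : ℕ) (a : ℕ → ℕ → ℝ) (w v : ℝ) : ℝ :=
  ∑ i ∈ Finset.range (n + 1), ∑ j ∈ Finset.range (n + 1),
    a i j * Real.sin ((j + 1) * v) * Real.sin ((i + 1) * w)

lemma aux_parseval2 (n : ℕ) (a : ℕ → ℕ → ℝ) :
    ∑ m ∈ Finset.range (n + 2), ∑ l ∈ Finset.range (n + 3),
      auxF n a (m * π / (n + 2)) (l * π / (n + 3)) ^ 2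
      = ((n : ℝ) + 2) / 2 * (((n : ℝ) + 3) / 2) *
        ∑ i ∈ Finset.range (n + 1), ∑ j ∈ Finset.range (n + 1), a i j ^ 2 := by
  rw [Finset.sum_comm]
  have h1 : ∀ l ∈ Finset.range (n + 3), ∑ m ∈ Finset.range (n + 2),
      auxF n a (m * π / (n + 2)) (l * π / (n + 3)) ^ 2
      = ((n : ℝ) + 2) / 2 * ∑ i ∈ Finset.range (n + 1),
        (∑ j ∈ Finset.range (n + 1), a i j * Real.sin ((j + 1) * (l * π / (n + 3)))) ^ 2 := by
    intro l _
    have h := aux_parseval_s1 (n + 2) (n + 1) (by omega)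
      (fun i => ∑ j ∈ Finset.range (n + 1), a i j * Real.sin ((j + 1) * (l * π / (n + 3))))
    push_cast at h
    rw [← h]
    simp only [auxF, Finset.sum_mul]
  rw [Finset.sum_congr rfl h1, ← Finset.mul_sum, Finset.sum_comm, mul_assoc]
  congr 1
  rw [Finset.mul_sum]
  refine Finset.sum_congr rfl fun i _ => ?_
  have h := aux_parseval_s1 (n + 3) (n + 1) (by omega) (a i)
  push_cast at h
  exact h

lemma aux_reindex (n m : ℕ) (hn : Even n) (G : ℝ → ℝ) (hG : ∀ v, 0 ≤ G v) :
    ∑ k ∈ Finset.Icc 1 (n / 2 + 1), G (mpV n m k)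
      ≤ ∑ l ∈ Finset.range (n + 3), G (l * π / (n + 3)) := by
  obtain ⟨r, rfl⟩ := hn
  set f : ℕ → ℕ := fun k => if Odd m then 2 * k else 2 * k - 1 with hf
  have h1 : ∀ k ∈ Finset.Icc 1 ((r + r) / 2 + 1),
      G (mpV (r + r) m k) = G ((f k : ℕ) * π / ((r + r : ℕ) + 3)) := by
    intro k hk
    have hk1 := (Finset.mem_Icc.1 hk).1
    simp only [hf, mpV]
    split_ifs
    · push_cast; rfl
    · rw [Nat.cast_sub (by omega)]; push_cast; rfl
  rw [Finset.sum_congr rfl h1]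
  have hinj : Set.InjOn f (Finset.Icc 1 ((r + r) / 2 + 1) : Finset ℕ) := by
    intro x hx y hy hxy
    have hx' := Finset.mem_Icc.1 (Finset.mem_coe.1 hx)
    have hy' := Finset.mem_Icc.1 (Finset.mem_coe.1 hy)
    simp only [hf] at hxy
    split_ifs at hxy <;> omega
  rw [← Finset.sum_image (f := fun l : ℕ => G ((l : ℝ) * π / ((r + r : ℕ) + 3))) hinj]
  apply Finset.sum_le_sum_of_subset_of_nonneg
  · intro l hl
    obtain ⟨k, hk, rfl⟩ := Finset.mem_image.1 hl
    have hk' := Finset.mem_Icc.1 hk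
    rw [Finset.mem_range]
    simp only [hf]
    split_ifs <;> omega
  · intro _ _ _; exact hG _

lemma aux_chebU (j : ℕ) (t : ℝ) :
    chebU j (Real.cos t) * Real.sin t = Real.sin ((j + 1) * t) := by
  have := Polynomial.Chebyshev.U_real_cos t (j : ℤ)
  simpa [chebU] using this

lemma aux_chebU_bound (j : ℕ) (δ t : ℝ) (h0 : 0 < δ) (h1 : δ < π / 2)
    (ht : t ∈ Set.Icc δ (π - δ)) : |chebU j (Real.cos t)| ≤ 1 / Real.sin δ := by
  obtain ⟨ha, hb⟩ := ht
  have hs : 0 < Real.sin δ := Real.sin_pos_of_pos_of_lt_pi h0 (by linarith)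
  have hst : Real.sin δ ≤ Real.sin t := by
    rcases le_total t (π / 2) with h | h
    · exact Real.sin_le_sin_of_le_of_le_pi_div_two (by linarith) h ha
    · rw [← Real.sin_pi_sub t]
      exact Real.sin_le_sin_of_le_of_le_pi_div_two (by linarith) (by linarith) (by linarith)
  rw [le_div_iff₀ hs]
  calc |chebU j (Real.cos t)| * Real.sin δ ≤ |chebU j (Real.cos t)| * |Real.sin t| := by
        gcongr
        exact hst.trans (le_abs_self _)
    _ = |Real.sin ((j + 1) * t)| := by rw [← abs_mul, aux_chebU]
    _ ≤ 1 := Real.abs_sin_le_one _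

/-- Truncated coefficients. -/
noncomputable def auxA (n : ℕ) (x y : ℝ) (i j : ℕ) : ℝ :=
  if i + j ≤ n then chebU i x * chebU j y else 0

lemma aux_term (n : ℕ) (x y w v : ℝ) :
    (1 - Real.cos w ^ 2) * (1 - Real.cos v ^ 2) *
        |∑ i ∈ Finset.range (n + 1), ∑ j ∈ Finset.range (n - i + 1),
            chebU i (Real.cos w) * chebU j (Real.cos v) * chebU i x * chebU j y|
      ≤ |auxF n (auxA n x y) w v| := by
  have hF : auxF n (auxA n x y) w v = Real.sin w * Real.sin v *
      ∑ i ∈ Finset.range (n + 1), ∑ j ∈ Finset.range (n - i + 1),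
            chebU i (Real.cos w) * chebU j (Real.cos v) * chebU i x * chebU j y := by
    rw [auxF, Finset.mul_sum]
    refine Finset.sum_congr rfl fun i hi => ?_
    have hi' := Finset.mem_range.1 hi
    rw [Finset.mul_sum]
    symm
    have hsub : Finset.range (n - i + 1) ⊆ Finset.range (n + 1) := by
      intro j hj
      rw [Finset.mem_range] at *
      omega
    rw [← Finset.sum_subset hsub (f := fun j => auxA n x y i j * Real.sin ((j + 1) * v) *
      Real.sin ((i + 1) * w))]
    · refine Finset.sum_congr rfl fun j hj => ?_
      have hj' := Finset.mem_range.1 hj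
      rw [auxA, if_pos (by omega), ← aux_chebU, ← aux_chebU]
      ring
    · intro j _ hj
      rw [Finset.mem_range] at hj
      rw [auxA, if_neg (by omega)]
      ring
  rw [hF, ← Real.sin_sq, ← Real.sin_sq, abs_mul, abs_mul]
  gcongr ?_ * _
  have h1 := Real.abs_sin_le_one w
  have h2 := Real.abs_sin_le_one v
  rw [← sq_abs (Real.sin w), ← sq_abs (Real.sin v)]
  gcongr
  · nlinarith [abs_nonneg (Real.sin w)]
  · nlinarith [abs_nonneg (Real.sin v)]

lemma aux_main (n : ℕ) (hn : Even n) (x y B : ℝ) (hB : 0 ≤ B)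
    (ha : ∀ i j, |auxA n x y i j| ≤ B) :
    lambdaMP n x y ≤ 8 * B * (n + 1) := by
  set S : ℝ := ∑ m ∈ Finset.range (n + 2), ∑ l ∈ Finset.range (n + 3),
      |auxF n (auxA n x y) (m * π / (n + 2)) (l * π / (n + 3))| with hS
  have h1 : lambdaMP n x y ≤ (8 / (((n : ℝ) + 2) * (n + 3))) * S := by
    rw [lambdaMP]
    gcongr
    calc _ ≤ ∑ m ∈ Finset.Icc 1 (n + 1), ∑ k ∈ Finset.Icc 1 (n / 2 + 1),
          |auxF n (auxA n x y) (mpW n m) (mpV n m k)| :=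
          Finset.sum_le_sum fun m _ => Finset.sum_le_sum fun k _ => aux_term n x y _ _
      _ ≤ ∑ m ∈ Finset.Icc 1 (n + 1), ∑ l ∈ Finset.range (n + 3),
          |auxF n (auxA n x y) (mpW n m) (l * π / (n + 3))| :=
          Finset.sum_le_sum fun m _ =>
            aux_reindex n m hn (fun v => |auxF n (auxA n x y) (mpW n m) v|)
              fun v => abs_nonneg _
      _ ≤ S := by
          rw [hS]
          apply Finset.sum_le_sum_of_subset_of_nonneg
          · intro m hm
            rw [Finset.mem_Icc] at hm
            rw [Finset.mem_range]
            omega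
          · intro _ _ _
            exact Finset.sum_nonneg fun _ _ => abs_nonneg _
  have h2 : S ^ 2 ≤ (((n : ℝ) + 2) * (n + 3)) * (((n : ℝ) + 2) / 2 * (((n : ℝ) + 3) / 2) *
        ∑ i ∈ Finset.range (n + 1), ∑ j ∈ Finset.range (n + 1), auxA n x y i j ^ 2) := by
    rw [← aux_parseval2, hS, ← Finset.sum_product', ← Finset.sum_product']
    refine sq_sum_le_card_mul_sum_sq.trans (le_of_eq ?_)
    simp [Finset.card_product]
  have h3 : ∑ i ∈ Finset.range (n + 1), ∑ j ∈ Finset.range (n + 1), auxA n x y i j ^ 2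
      ≤ ((n : ℝ) + 1) ^ 2 * B ^ 2 := by
    calc _ ≤ ∑ i ∈ Finset.range (n + 1), ∑ j ∈ Finset.range (n + 1), B ^ 2 :=
          Finset.sum_le_sum fun i _ => Finset.sum_le_sum fun j _ =>
            sq_le_sq' (abs_le.1 (ha i j)).1 (abs_le.1 (ha i j)).2
      _ = _ := by simp; ring
  have h4 : S ≤ ((n : ℝ) + 2) * (n + 3) * ((n + 1) * B) := by
    refine abs_le_of_sq_le_sq' ?_ (by positivity) |>.2
    refine h2.trans ?_
    calc _ ≤ (((n : ℝ) + 2) * (n + 3)) * (((n : ℝ) + 2) / 2 * (((n : ℝ) + 3) / 2) *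
          (((n : ℝ) + 1) ^ 2 * B ^ 2)) := by gcongr
      _ = (((n : ℝ) + 2) * (n + 3) * ((n + 1) * B)) ^ 2 / 4 := by ring
      _ ≤ _ := by linarith [sq_nonneg (((n : ℝ) + 2) * (n + 3) * ((n + 1) * B))]
  refine h1.trans ?_
  rw [div_mul_eq_mul_div, div_le_iff₀ (by positivity)]
  linarith

/-- For every fixed `δ ∈ (0, π/2)` there is a constant `C > 0` (depending only on `δ`)
such that for every even positive integer `n` and all `θ, φ ∈ [δ, π-δ]`, the Lebesgue
function of the Morrow–Patterson points satisfies `λ_n(cos θ, cos φ) ≤ C n`. -/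
theorem lambdaMP_le_linear_on_interior (δ : ℝ) (hδ0 : 0 < δ) (hδπ : δ < π / 2) :
    ∃ C : ℝ, 0 < C ∧ ∀ n : ℕ, 0 < n → Even n →
      ∀ θ ∈ Set.Icc δ (π - δ), ∀ φ ∈ Set.Icc δ (π - δ),
        lambdaMP n (Real.cos θ) (Real.cos φ) ≤ C * (n : ℝ) := by
  have hs : 0 < Real.sin δ := Real.sin_pos_of_pos_of_lt_pi hδ0 (by linarith [Real.pi_pos])
  refine ⟨16 * (1 / Real.sin δ * (1 / Real.sin δ)), by positivity, ?_⟩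
  intro n hn hev θ hθ φ hφ
  have h := aux_main n hev (Real.cos θ) (Real.cos φ) (1 / Real.sin δ * (1 / Real.sin δ))
    (by positivity) (by
      intro i j
      rw [auxA]
      split_ifs
      · rw [abs_mul]
        exact mul_le_mul (aux_chebU_bound i δ θ hδ0 hδπ hθ) (aux_chebU_bound j δ φ hδ0 hδπ hφ)
          (abs_nonneg _) (by positivity)
      · rw [abs_zero]; positivity)
  refine h.trans ?_
  have hn1 : (1 : ℝ) ≤ n := by exact_mod_cast hn
  have hB : 0 < 1 / Real.sin δ * (1 / Real.sin δ) := by positivity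
  nlinarith
end

section
/- For every even positive integer n and every (x,y) in the square Q = [-1,1]^2, the Lebesgue function of the Morrow–Patterson points satisfies λ_n(x,y) ≤ (1/(6√10))·√((n+1)(n+2)(n+3)(n+4)(2n²+10n+15)); in particular the Lebesgue constant of the Morrow–Patterson points is O(n³). -/
open Real Finset

lemma sum_cos_odd (φ : ℝ) (K : ℕ) :
    2 * sin φ * ∑ k ∈ Finset.Icc 1 K, cos ((2 * (k : ℝ) - 1) * φ) = sin (2 * K * φ) := by
  induction K with
  | zero => simp
  | succ K ih =>
    rw [Finset.sum_Icc_succ_top (by omega), mul_add, ih]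
    push_cast
    have h1 : (2 * ((K : ℝ) + 1) - 1) * φ = 2 * K * φ + φ := by ring
    have h2 : 2 * ((K : ℝ) + 1) * φ = (2 * K * φ + φ) + φ := by ring
    have h3 : sin (2 * K * φ) = sin ((2 * K * φ + φ) - φ) := by congr 1; ring
    rw [h1, h2, h3, sin_sub _ φ, sin_add (2 * K * φ + φ) φ]
    ring

lemma sum_cos_even (φ : ℝ) (K : ℕ) :
    2 * sin φ * ∑ k ∈ Finset.Icc 1 K, cos (2 * (k : ℝ) * φ) = sin ((2 * K + 1) * φ) - sin φ := by
  induction K with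
  | zero => simp
  | succ K ih =>
    rw [Finset.sum_Icc_succ_top (by omega), mul_add, ih]
    push_cast
    have h2 : (2 * ((K : ℝ) + 1) + 1) * φ = (2 * (K + 1) * φ) + φ := by ring
    have h3 : (2 * (K : ℝ) + 1) * φ = (2 * (K + 1) * φ) - φ := by ring
    rw [h2, h3, sin_sub _ φ, sin_add _ φ]
    ring

lemma sin_ne (M : ℕ) (hM : 0 < M) (d : ℤ) (h : ¬ (M : ℤ) ∣ d) : sin (d * π / M) ≠ 0 := by
  intro h0
  rw [Real.sin_eq_zero_iff] at h0
  obtain ⟨z, hz⟩ := h0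
  apply h
  refine ⟨z, ?_⟩
  have hM' : (M : ℝ) ≠ 0 := by positivity
  field_simp at hz
  rw [mul_comm]
  exact_mod_cast hz.symm

/-- Full sum over `m` -/
lemma sum_m (N : ℕ) (hN : 0 < N) (d : ℤ) (h : ¬ (2 * N : ℤ) ∣ d) :
    ∑ m ∈ Finset.Icc 1 (N - 1), cos (d * (m * π / N)) = (-1 - (-1) ^ d) / 2 := by
  have hs := sin_ne (2 * N) (by omega) d (by exact_mod_cast h)
  have hN' : (N : ℝ) ≠ 0 := by positivity
  have := sum_cos_even (d * π / (2 * N : ℕ)) (N - 1)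
  have e : ∀ m : ℕ, cos (2 * (m : ℝ) * (d * π / (2 * N : ℕ))) = cos (d * (m * π / N)) := by
    intro m; congr 1; push_cast; field_simp
  simp only [e] at this
  have e2 : (2 * ((N - 1 : ℕ) : ℝ) + 1) * (d * π / (2 * N : ℕ)) = d * π - d * π / (2 * N : ℕ) := by
    rw [Nat.cast_sub (by omega)]; push_cast; field_simp; ring
  rw [e2, sin_int_mul_pi_sub] at this
  apply mul_left_cancel₀ hs
  linarith

lemma sum_k_odd (K : ℕ) (d : ℤ) (h : ¬ (2 * K + 1 : ℤ) ∣ d) :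
    ∑ k ∈ Finset.Icc 1 K, cos (d * (2 * k * π / (2 * K + 1))) = -1 / 2 := by
  have hs := sin_ne (2 * K + 1) (by omega) d (by exact_mod_cast h)
  have hN' : (2 * (K : ℝ) + 1) ≠ 0 := by positivity
  have := sum_cos_even (d * π / (2 * K + 1 : ℕ)) K
  have e : ∀ k : ℕ, cos (2 * (k : ℝ) * (d * π / (2 * K + 1 : ℕ)))
      = cos (d * (2 * k * π / (2 * K + 1))) := by
    intro m; congr 1; push_cast; field_simp
  simp only [e] at this
  have e2 : (2 * (K : ℝ) + 1) * (d * π / (2 * K + 1 : ℕ)) = d * π := by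
    push_cast; field_simp
  rw [e2, sin_int_mul_pi] at this
  apply mul_left_cancel₀ hs
  linarith

lemma sum_k_even (K : ℕ) (d : ℤ) (h : ¬ (2 * K + 1 : ℤ) ∣ d) :
    ∑ k ∈ Finset.Icc 1 K, cos (d * ((2 * k - 1) * π / (2 * K + 1))) = -(-1) ^ d / 2 := by
  have hs := sin_ne (2 * K + 1) (by omega) d (by exact_mod_cast h)
  have hN' : (2 * (K : ℝ) + 1) ≠ 0 := by positivity
  have := sum_cos_odd (d * π / (2 * K + 1 : ℕ)) K
  have e : ∀ k : ℕ, cos ((2 * (k : ℝ) - 1) * (d * π / (2 * K + 1 : ℕ)))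
      = cos (d * ((2 * k - 1) * π / (2 * K + 1))) := by
    intro m; congr 1; push_cast; field_simp
  simp only [e] at this
  have e2 : 2 * (K : ℝ) * (d * π / (2 * K + 1 : ℕ)) = d * π - d * π / (2 * K + 1 : ℕ) := by
    push_cast; field_simp; ring
  rw [e2, sin_int_mul_pi_sub] at this
  apply mul_left_cancel₀ hs
  linarith

lemma sin_mul_sin_eq (a b : ℕ) (t : ℝ) :
    sin (a * t) * sin (b * t) = (cos (((a - b : ℤ) : ℝ) * t) - cos (((a + b : ℤ) : ℝ) * t)) / 2 := by
  push_cast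
  rw [sub_mul, add_mul, cos_sub, cos_add]; ring

lemma par (a b : ℕ) : (-1 : ℝ) ^ ((a : ℤ) - b) = (-1) ^ ((a : ℤ) + b) := by
  have : (a : ℤ) + b = (a - b) + 2 * b := by ring
  rw [this, zpow_add₀ (by norm_num), zpow_mul]; simp

/-- Discrete orthogonality in `w`. -/
lemma orth_m (N a a' : ℕ) (ha : 0 < a) (ha' : 0 < a') (haN : a < N) (haN' : a' < N) :
    ∑ m ∈ Finset.Icc 1 (N - 1), sin (a * (m * π / N)) * sin (a' * (m * π / N))
      = if a = a' then (N : ℝ) / 2 else 0 := by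
  simp only [sin_mul_sin_eq, ← Finset.sum_div, Finset.sum_sub_distrib]
  rw [sum_m N (by omega) (a + a')]
  swap
  · rintro ⟨c, hc⟩
    have h1 : 0 < c := by nlinarith
    nlinarith
  split_ifs with h
  · subst h
    rw [← par]
    simp [Nat.cast_sub (show 1 ≤ N by omega)]
    ring
  · rw [sum_m N (by omega) (a - a'), par]
    · ring
    · intro hd
      have := Int.eq_zero_of_abs_lt_dvd hd (by rw [abs_lt]; omega)
      omega

lemma orth_m_alt (N a a' : ℕ) (ha : 0 < a) (ha' : 0 < a') (haN : a + a' < N) :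
    ∑ m ∈ Finset.Icc 1 (N - 1), (-1) ^ m * (sin (a * (m * π / N)) * sin (a' * (m * π / N))) = 0 := by
  have hN' : (N : ℝ) ≠ 0 := by have : 0 < N := by omega
                               positivity
  have key : ∀ (d : ℤ) (m : ℕ), (-1) ^ m * cos (d * (m * π / N)) =
      cos (((d + N : ℤ) : ℝ) * (m * π / N)) := by
    intro d m
    have : ((d + N : ℤ) : ℝ) * (m * π / N) = d * (m * π / N) + m * π := by
      push_cast; field_simp
    rw [this, cos_add_nat_mul_pi]
  have e : ∀ m : ℕ, (-1) ^ m * (sin (a * (m * π / N)) * sin (a' * (m * π / N))) =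
     (cos (((a - a' + N : ℤ) : ℝ) * (m * π / N)) - cos (((a + a' + N : ℤ) : ℝ) * (m * π / N))) / 2 := by
    intro m
    rw [sin_mul_sin_eq, ← key, ← key]; ring
  simp only [e, ← Finset.sum_div, Finset.sum_sub_distrib]
  rw [sum_m N (by omega), sum_m N (by omega), zpow_add₀ (by norm_num), zpow_add₀ (by norm_num), par]
  · ring
  · intro hd
    have := Int.le_of_dvd (by omega) hd
    omega
  · intro hd
    have := Int.le_of_dvd (by omega) hd
    omega

lemma orth_k (n m b b' : ℕ) (K : ℕ) (hn : n = 2 * K - 2) (hK : 1 ≤ K)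
    (hb : 0 < b) (hb' : 0 < b') (hbN : b < n + 3) (hbN' : b' < n + 3) :
    ∑ k ∈ Finset.Icc 1 K, sin (b * mpV n m k) * sin (b' * mpV n m k)
      = if b = b' then ((n : ℝ) + 3) / 4 else
        if b + b' = n + 3 then (-1) ^ m * (((n : ℝ) + 3) / 4) else 0 := by
  have hM : (n : ℝ) + 3 = 2 * K + 1 := by
    have : n + 3 = 2 * K + 1 := by omega
    exact_mod_cast this
  have nd1 : b + b' ≠ n + 3 → ¬ (2 * K + 1 : ℤ) ∣ (b + b' : ℤ) := by
    rintro h ⟨c, hc⟩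
    have h1 : 0 < c := by
      by_contra hcon
      have : (2 * K + 1 : ℤ) * c ≤ 0 := by apply mul_nonpos_of_nonneg_of_nonpos <;> omega
      omega
    have h2 : c < 2 := by
      by_contra hcon
      have : (2 * K + 1 : ℤ) * 2 ≤ (2 * K + 1 : ℤ) * c := by gcongr; omega
      omega
    have : c = 1 := by omega
    subst this
    omega
  have nd2 : b ≠ b' → ¬ (2 * K + 1 : ℤ) ∣ (b - b' : ℤ) := by
    intro h hd
    have := Int.eq_zero_of_abs_lt_dvd hd (by rw [abs_lt]; omega)
    omega
  simp only [sin_mul_sin_eq, ← Finset.sum_div, Finset.sum_sub_distrib]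
  unfold mpV
  rw [hM]
  have hpar : Odd (b + b') → (-1 : ℝ) ^ ((b : ℤ) + b') = -1 := by
    intro h
    rw [Odd.neg_one_zpow]
    exact_mod_cast h
  by_cases hm : Odd m
  · simp only [if_pos hm, hm.neg_one_pow]
    split_ifs with h1 h2
    · subst h1
      rw [sum_k_odd K _ (nd1 (by omega))]
      simp; ring
    · rw [sum_k_odd K _ (nd2 h1)]
      have e : ∀ k : ℕ, cos (((b + b' : ℤ) : ℝ) * (2 * k * π / (2 * K + 1))) = 1 := by
        intro k
        have : ((b + b' : ℤ) : ℝ) = 2 * K + 1 := by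
          rw [← hM]; exact_mod_cast h2
        rw [this]
        have h3 : (2 * (K : ℝ) + 1) * (2 * k * π / (2 * K + 1)) = k * (2 * π) := by field_simp
        rw [h3, cos_nat_mul_two_pi]
      simp only [e]
      simp; ring
    · rw [sum_k_odd K _ (nd2 h1), sum_k_odd K _ (nd1 h2)]; ring
  · have hm' : Even m := by simpa using hm
    simp only [if_neg hm, hm'.neg_one_pow]
    split_ifs with h1 h2
    · subst h1
      rw [sum_k_even K _ (nd1 (by omega)), ← par]
      simp; ring
    · rw [sum_k_even K _ (nd2 h1), par, hpar (by rw [h2, Nat.odd_iff]; omega)]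
      have e : ∀ k : ℕ, cos (((b + b' : ℤ) : ℝ) * ((2 * k - 1) * π / (2 * K + 1))) = -1 := by
        intro k
        have : ((b + b' : ℤ) : ℝ) = 2 * K + 1 := by
          rw [← hM]; exact_mod_cast h2
        rw [this]
        have h3 : (2 * (K : ℝ) + 1) * ((2 * k - 1) * π / (2 * K + 1)) = k * (2 * π) - π := by
          field_simp
        rw [h3, cos_sub_pi, cos_nat_mul_two_pi]
      simp only [e]
      simp; ring
    · rw [sum_k_even K _ (nd2 h1), sum_k_even K _ (nd1 h2), par]; ring

lemma abstract_bound {ι κ : Type*} [DecidableEq ι] (S : Finset ι) (P : Finset κ) (W : κ → ℝ)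
    (hW : ∀ p ∈ P, 0 ≤ W p) (E : ι → κ → ℝ) (c : ι → ℝ)
    (orth : ∀ I ∈ S, ∀ J ∈ S, ∑ p ∈ P, W p * (E I p * E J p) = if I = J then 1 else 0)
    (hone : ∑ p ∈ P, W p = 1) :
    ∑ p ∈ P, W p * |∑ I ∈ S, E I p * c I| ≤ Real.sqrt (∑ I ∈ S, c I ^ 2) := by
  apply Real.le_sqrt_of_sq_le
  have h1 := Finset.sum_sq_le_sum_mul_sum_of_sq_eq_mul P (r := fun p => W p * |∑ I ∈ S, E I p * c I|)
    (f := W) (g := fun p => W p * (∑ I ∈ S, E I p * c I) ^ 2) hW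
    (fun p hp => mul_nonneg (hW p hp) (sq_nonneg _))
    (fun p hp => by rw [mul_pow, sq_abs]; ring)
  rw [hone, one_mul] at h1
  refine h1.trans (le_of_eq ?_)
  calc ∑ p ∈ P, W p * (∑ I ∈ S, E I p * c I) ^ 2
      = ∑ p ∈ P, ∑ I ∈ S, ∑ J ∈ S, c I * c J * (W p * (E I p * E J p)) := by
        refine Finset.sum_congr rfl fun p _ => ?_
        rw [sq, Finset.sum_mul_sum, Finset.mul_sum]
        refine Finset.sum_congr rfl fun I _ => ?_
        rw [Finset.mul_sum]
        refine Finset.sum_congr rfl fun J _ => ?_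
        ring
    _ = ∑ I ∈ S, ∑ J ∈ S, c I * c J * ∑ p ∈ P, W p * (E I p * E J p) := by
        rw [Finset.sum_comm]
        refine Finset.sum_congr rfl fun I _ => ?_
        rw [Finset.sum_comm]
        refine Finset.sum_congr rfl fun J _ => ?_
        rw [Finset.mul_sum]
    _ = ∑ I ∈ S, c I ^ 2 := by
        refine Finset.sum_congr rfl fun I hI => ?_
        rw [Finset.sum_congr rfl fun J hJ => by rw [orth I hI J hJ]]
        simp [hI, sq]

lemma chebU_abs_le (j : ℕ) (x : ℝ) (hx : x ∈ Set.Icc (-1 : ℝ) 1) : |chebU j x| ≤ j + 1 := by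
  have hx' : |x| ≤ 1 := abs_le.mpr hx
  induction j with
  | zero => simp [chebU]
  | succ j ih =>
    have : chebU (j + 1) x = x * chebU j x + (Polynomial.Chebyshev.T ℝ ((j : ℤ) + 1)).eval x := by
      unfold chebU
      push_cast
      rw [Polynomial.Chebyshev.U_eq_X_mul_U_add_T]
      simp
    rw [this]
    have hT := Polynomial.Chebyshev.abs_eval_T_real_le_one ((j : ℤ) + 1) hx'
    have h2 : |x * chebU j x| ≤ 1 * (j + 1) := by
      rw [abs_mul]; gcongr
    have := abs_add_le (x * chebU j x) ((Polynomial.Chebyshev.T ℝ ((j : ℤ) + 1)).eval x)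
    push_cast
    linarith

lemma sum_sq_succ (r : ℕ) :
    ∑ i ∈ Finset.range r, ((i : ℝ) + 1) ^ 2 = (r : ℝ) * (r + 1) * (2 * r + 1) / 6 := by
  induction r with
  | zero => simp
  | succ r ih => rw [Finset.sum_range_succ, ih]; push_cast; ring

lemma sum_poly (A : ℝ) (r : ℕ) :
    ∑ i ∈ Finset.range r, ((i : ℝ) + 1) ^ 2 *
      ((A - (i + 1)) * ((A - (i + 1)) + 1) * (2 * (A - (i + 1)) + 1) / 6)
    = ((2 * A ^ 3 + 3 * A ^ 2 + A) * ((r : ℝ) * (r + 1) * (2 * r + 1) / 6)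
      + (-6 * A ^ 2 - 6 * A - 1) * ((r : ℝ) ^ 2 * (r + 1) ^ 2 / 4)
      + (6 * A + 3) * ((r : ℝ) * (r + 1) * (2 * r + 1) * (3 * r ^ 2 + 3 * r - 1) / 30)
      - 2 * ((r : ℝ) ^ 2 * (r + 1) ^ 2 * (2 * r ^ 2 + 2 * r - 1) / 12)) / 6 := by
  induction r with
  | zero => simp
  | succ r ih => rw [Finset.sum_range_succ, ih]; push_cast; ring

lemma sum_total (n : ℕ) :
    ∑ i ∈ Finset.range (n + 1), ∑ j ∈ Finset.range (n - i + 1),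
      (((i : ℝ) + 1) * ((j : ℝ) + 1)) ^ 2 =
    ((n : ℝ) + 1) * ((n : ℝ) + 2) * ((n : ℝ) + 3) * ((n : ℝ) + 4) *
        (2 * (n : ℝ) ^ 2 + 10 * (n : ℝ) + 15) / 360 := by
  have := sum_poly (n + 2) (n + 1)
  calc _ = _ := by
        refine Finset.sum_congr rfl fun i hi => ?_
        simp only [mul_pow, ← Finset.mul_sum]
        rw [sum_sq_succ]
        have : i ≤ n := by simpa [Nat.lt_succ_iff] using hi
        rw [Nat.cast_add, Nat.cast_sub this]
        have e : (n : ℝ) - i + (1 : ℕ) = (n + 2 - (i + 1)) := by push_cast; ring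
        rw [e]
    _ = _ := this
    _ = _ := by push_cast; ring

lemma chebU_sin_s2 (j : ℕ) (t : ℝ) : chebU j (cos t) * sin t = sin (((j + 1 : ℕ) : ℝ) * t) := by
  unfold chebU
  rw [Polynomial.Chebyshev.U_real_cos]
  push_cast; rfl

lemma orth_full (n : ℕ) (hne : Even n) (i j i' j' : ℕ) (h : i + j ≤ n) (h' : i' + j' ≤ n) :
    ∑ m ∈ Finset.Icc 1 (n + 1), ∑ k ∈ Finset.Icc 1 (n / 2 + 1),
      (8 / (((n : ℝ) + 2) * (n + 3))) *
      ((1 - Real.cos (mpW n m) ^ 2) * (1 - Real.cos (mpV n m k) ^ 2)) *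
        ((chebU i (Real.cos (mpW n m)) * chebU j (Real.cos (mpV n m k))) *
         (chebU i' (Real.cos (mpW n m)) * chebU j' (Real.cos (mpV n m k))))
      = if i = i' ∧ j = j' then 1 else 0 := by
  obtain ⟨q, hq⟩ := hne
  have e1 : ∀ m k : ℕ, (8 / (((n : ℝ) + 2) * (n + 3))) *
      ((1 - Real.cos (mpW n m) ^ 2) * (1 - Real.cos (mpV n m k) ^ 2)) *
        ((chebU i (Real.cos (mpW n m)) * chebU j (Real.cos (mpV n m k))) *
         (chebU i' (Real.cos (mpW n m)) * chebU j' (Real.cos (mpV n m k))))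
      = (8 / (((n : ℝ) + 2) * (n + 3))) *
        ((sin (((i + 1 : ℕ) : ℝ) * mpW n m) * sin (((i' + 1 : ℕ) : ℝ) * mpW n m)) *
        (sin (((j + 1 : ℕ) : ℝ) * mpV n m k) * sin (((j' + 1 : ℕ) : ℝ) * mpV n m k))) := by
    intro m k
    rw [← chebU_sin_s2, ← chebU_sin_s2, ← chebU_sin_s2, ← chebU_sin_s2, ← sin_sq, ← sin_sq]
    ring
  simp only [e1, ← Finset.mul_sum]
  have hk : ∀ m : ℕ, _ := fun m => orth_k n m (j + 1) (j' + 1) (n / 2 + 1) (by omega) (by omega)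
    (by omega) (by omega) (by omega) (by omega)
  simp only [hk]
  have hw : ∀ m : ℕ, mpW n m = m * π / ((n + 2 : ℕ) : ℝ) := by
    intro m; unfold mpW; push_cast; rfl
  simp only [hw]
  by_cases h1 : j = j'
  · subst h1
    have := orth_m (n + 2) (i + 1) (i' + 1) (by omega) (by omega) (by omega) (by omega)
    simp only [Nat.add_sub_cancel, show n + 2 - 1 = n + 1 from rfl] at this
    simp only [if_true, ← Finset.sum_mul, this]
    by_cases h2 : i = i'
    · simp only [h2, if_true, and_self]
      push_cast
      have : (n : ℝ) + 2 ≠ 0 := by positivity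
      have : (n : ℝ) + 3 ≠ 0 := by positivity
      field_simp
      norm_num
    · simp [h2]
  · simp only [h1, and_false, if_false, Nat.add_right_cancel_iff]
    split_ifs with h3
    · have := orth_m_alt (n + 2) (i + 1) (i' + 1) (by omega) (by omega) (by omega)
      simp only [show n + 2 - 1 = n + 1 from rfl] at this
      rw [mul_eq_zero]; right
      rw [← zero_mul (((n : ℝ) + 3) / 4), ← this, Finset.sum_mul]
      refine Finset.sum_congr rfl fun m _ => ?_
      ring
    · simp

/-- The Lebesgue function of the Morrow–Patterson points is bounded on the square
`Q = [-1,1]²` by `(1/(6√10))·√((n+1)(n+2)(n+3)(n+4)(2n²+10n+15))`, which is `O(n³)`. -/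
theorem lambdaMP_le_cubic (n : ℕ) (hn : 0 < n) (hne : Even n)
    (x : ℝ) (hx : x ∈ Set.Icc (-1 : ℝ) 1) (y : ℝ) (hy : y ∈ Set.Icc (-1 : ℝ) 1) :
    lambdaMP n x y ≤ (1 / (6 * Real.sqrt 10)) *
      Real.sqrt (((n : ℝ) + 1) * ((n : ℝ) + 2) * ((n : ℝ) + 3) * ((n : ℝ) + 4) *
        (2 * (n : ℝ) ^ 2 + 10 * (n : ℝ) + 15)) := by
  set W : ℕ × ℕ → ℝ := fun p => (8 / (((n : ℝ) + 2) * (n + 3))) *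
      ((1 - Real.cos (mpW n p.1) ^ 2) * (1 - Real.cos (mpV n p.1 p.2) ^ 2)) with hW
  set E : (Σ _ : ℕ, ℕ) → ℕ × ℕ → ℝ := fun I p =>
    chebU I.1 (Real.cos (mpW n p.1)) * chebU I.2 (Real.cos (mpV n p.1 p.2)) with hE
  set c : (Σ _ : ℕ, ℕ) → ℝ := fun I => chebU I.1 x * chebU I.2 y with hc
  set S : Finset (Σ _ : ℕ, ℕ) := (Finset.range (n + 1)).sigma (fun i => Finset.range (n - i + 1))
    with hS
  have memS : ∀ I ∈ S, I.1 + I.2 ≤ n := by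
    intro I hI
    simp only [hS, Finset.mem_sigma, Finset.mem_range] at hI
    omega
  have orth : ∀ I ∈ S, ∀ J ∈ S,
      ∑ p ∈ Finset.Icc 1 (n + 1) ×ˢ Finset.Icc 1 (n / 2 + 1), W p * (E I p * E J p)
        = if I = J then 1 else 0 := by
    intro I hI J hJ
    rw [Finset.sum_product]
    have := orth_full n hne I.1 I.2 J.1 J.2 (memS I hI) (memS J hJ)
    simp only [hW, hE]
    rw [this]
    obtain ⟨i, j⟩ := I
    obtain ⟨i', j'⟩ := J
    simp
  have h0 : (⟨0, 0⟩ : Σ _ : ℕ, ℕ) ∈ S := by simp [hS]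
  have hone : ∑ p ∈ Finset.Icc 1 (n + 1) ×ˢ Finset.Icc 1 (n / 2 + 1), W p = 1 := by
    have := orth _ h0 _ h0
    simpa [hE, chebU] using this
  have main := abstract_bound S _ W (by
    intro p _
    simp only [hW]
    rw [← sin_sq, ← sin_sq]; positivity) E c orth hone
  have hl : lambdaMP n x y = ∑ p ∈ Finset.Icc 1 (n + 1) ×ˢ Finset.Icc 1 (n / 2 + 1),
      W p * |∑ I ∈ S, E I p * c I| := by
    unfold lambdaMP
    rw [Finset.sum_product, Finset.mul_sum]
    refine Finset.sum_congr rfl fun m _ => ?_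
    rw [Finset.mul_sum]
    refine Finset.sum_congr rfl fun k _ => ?_
    rw [hS, Finset.sum_sigma]
    simp only [hW, hE, hc]
    rw [mul_assoc, mul_assoc, mul_assoc]
    simp only [mul_assoc]
  rw [hl]
  refine main.trans ?_
  have hb : ∑ I ∈ S, c I ^ 2 ≤ ((n : ℝ) + 1) * ((n : ℝ) + 2) * ((n : ℝ) + 3) * ((n : ℝ) + 4) *
        (2 * (n : ℝ) ^ 2 + 10 * (n : ℝ) + 15) / 360 := by
    rw [← sum_total, hS, Finset.sum_sigma]
    refine Finset.sum_le_sum fun i _ => Finset.sum_le_sum fun j _ => ?_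
    rw [← sq_abs (c _)]
    simp only [hc]
    rw [abs_mul]
    have := chebU_abs_le i x hx
    have := chebU_abs_le j y hy
    gcongr
  refine (Real.sqrt_le_sqrt hb).trans (le_of_eq ?_)
  rw [Real.sqrt_div' _ (by norm_num)]
  have : Real.sqrt 360 = 6 * Real.sqrt 10 := by
    rw [show (360 : ℝ) = 6 ^ 2 * 10 by norm_num, Real.sqrt_mul (by norm_num),
      Real.sqrt_sq (by norm_num)]
  rw [this]; ring
end

section
/- Let n be an even positive integer and let i, j be non-negative integers. Define I(i,j) = Σ_{m=1}^{n+1} Σ_{k=1}^{n/2+1} sin(w_m) sin(v_k) sin((i+1)w_m) sin((j+1)v_k). If n+2 divides neither i nor i+2, or if n+3 divides neither j nor j+2, then I(i,j) = 0. -/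
open Real Finset

/-- The sum `I(i,j) = Σ_m Σ_k sin(w_m) sin(v_k) sin((i+1)w_m) sin((j+1)v_k)`. -/
noncomputable def mpI (n i j : ℕ) : ℝ :=
  ∑ m ∈ Finset.Icc 1 (n + 1), ∑ k ∈ Finset.Icc 1 (n / 2 + 1),
    Real.sin (mpW n m) * Real.sin (mpV n m k) *
      Real.sin (((i : ℝ) + 1) * mpW n m) * Real.sin (((j : ℝ) + 1) * mpV n m k)

lemma tele_even (x : ℝ) (h : ℕ) :
    2 * Real.sin x * ∑ k ∈ Finset.Icc 1 h, Real.cos (2 * k * x)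
      = Real.sin ((2 * h + 1) * x) - Real.sin x := by
  induction h with
  | zero => simp
  | succ h ih =>
    rw [Finset.sum_Icc_succ_top (by omega), mul_add, ih]
    push_cast
    have e1 : (2 * ((h : ℝ) + 1) + 1) * x = 2 * (h + 1) * x + x := by ring
    have e2 : (2 * (h : ℝ) + 1) * x = 2 * (h + 1) * x - x := by ring
    rw [e1, e2, Real.sin_add, Real.sin_sub]
    ring

lemma tele_odd (x : ℝ) (h : ℕ) :
    2 * Real.sin x * ∑ k ∈ Finset.Icc 1 h, Real.cos ((2 * k - 1) * x)
      = Real.sin (2 * h * x) := by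
  induction h with
  | zero => simp
  | succ h ih =>
    rw [Finset.sum_Icc_succ_top (by omega), mul_add, ih]
    push_cast
    have e1 : 2 * ((h : ℝ) + 1) * x = (2 * (h + 1) - 1) * x + x := by ring
    have e2 : 2 * (h : ℝ) * x = (2 * (h + 1) - 1) * x - x := by ring
    rw [e1, e2, Real.sin_add, Real.sin_sub]
    ring

lemma sin_ne_s3 (a q : ℕ) (hq : 0 < q) (h : ¬ q ∣ a) : Real.sin (a * π / q) ≠ 0 := by
  intro h0
  obtain ⟨z, hz⟩ := Real.sin_eq_zero_iff.1 h0
  have hq' : (q : ℝ) ≠ 0 := by positivity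
  have hp := Real.pi_ne_zero
  have h1 : (z : ℝ) * q = a := by
    field_simp at hz
    linarith
  have h2 : z * (q : ℤ) = a := by exact_mod_cast h1
  apply h
  have : (q : ℤ) ∣ (a : ℤ) := ⟨z, by rw [← h2]; ring⟩
  exact_mod_cast this

lemma sum_even (a h : ℕ) (hd : ¬ (2 * h + 1) ∣ a) :
    ∑ k ∈ Finset.Icc 1 h, Real.cos (2 * k * (a * π / (2 * h + 1 : ℕ))) = -1 / 2 := by
  have hs := sin_ne_s3 a (2 * h + 1) (by omega) hd
  have ht := tele_even (a * π / (2 * h + 1 : ℕ)) h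
  have e : (2 * (h : ℝ) + 1) * (a * π / (2 * h + 1 : ℕ)) = a * π := by
    push_cast; field_simp
  rw [e, Real.sin_nat_mul_pi] at ht
  apply mul_left_cancel₀ (mul_ne_zero two_ne_zero hs)
  rw [ht]; ring

lemma sum_odd (a h : ℕ) (hd : ¬ (2 * h + 1) ∣ a) :
    ∑ k ∈ Finset.Icc 1 h, Real.cos ((2 * k - 1) * (a * π / (2 * h + 1 : ℕ)))
      = -(-1) ^ a / 2 := by
  have hs := sin_ne_s3 a (2 * h + 1) (by omega) hd
  have ht := tele_odd (a * π / (2 * h + 1 : ℕ)) h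
  have e : 2 * (h : ℝ) * (a * π / (2 * h + 1 : ℕ)) = a * π - (a * π / (2 * h + 1 : ℕ)) := by
    push_cast; field_simp; ring
  rw [e, Real.sin_sub, Real.sin_nat_mul_pi, Real.cos_nat_mul_pi] at ht
  apply mul_left_cancel₀ (mul_ne_zero two_ne_zero hs)
  rw [ht]; ring

lemma sum_full (a M : ℕ) (hd : ¬ (2 * (M + 1)) ∣ a) :
    ∑ m ∈ Finset.Icc 1 M, Real.cos (m * (a * π / (M + 1))) = -((-1) ^ a + 1) / 2 := by
  have hs := sin_ne_s3 a (2 * (M + 1)) (by omega) hd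
  have ht := tele_even (a * π / (2 * (M + 1) : ℕ)) M
  have e : (2 * (M : ℝ) + 1) * (a * π / (2 * (M + 1) : ℕ))
      = a * π - (a * π / (2 * (M + 1) : ℕ)) := by
    push_cast; field_simp; ring
  rw [e, Real.sin_sub, Real.sin_nat_mul_pi, Real.cos_nat_mul_pi] at ht
  have e3 : ∑ m ∈ Finset.Icc 1 M, Real.cos (m * (a * π / (M + 1)))
      = ∑ k ∈ Finset.Icc 1 M, Real.cos (2 * k * (a * π / (2 * (M + 1) : ℕ))) := by
    refine Finset.sum_congr rfl fun k _ => ?_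
    congr 1
    push_cast; field_simp
  apply mul_left_cancel₀ (mul_ne_zero two_ne_zero hs)
  rw [e3, ht]; ring

lemma sin_mul_sin' (a : ℕ) (v : ℝ) :
    Real.sin v * Real.sin (((a : ℝ) + 1) * v)
      = (Real.cos (a * v) - Real.cos ((a + 2 : ℕ) * v)) / 2 := by
  have e1 : (a : ℝ) * v = (a + 1) * v - v := by ring
  have e2 : ((a + 2 : ℕ) : ℝ) * v = (a + 1) * v + v := by push_cast; ring
  rw [e1, e2, Real.cos_add, Real.cos_sub]
  ring

lemma inner_zero (h j m : ℕ) (h1 : ¬ (2 * h + 1) ∣ j) (h2 : ¬ (2 * h + 1) ∣ (j + 2))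
    (n : ℕ) (hn : n + 3 = 2 * h + 1) :
    ∑ k ∈ Finset.Icc 1 h, Real.sin (mpV n m k) * Real.sin (((j : ℝ) + 1) * mpV n m k) = 0 := by
  have hc : (n : ℝ) + 3 = ((2 * h + 1 : ℕ) : ℝ) := by rw [← hn]; push_cast; ring
  simp_rw [sin_mul_sin', ← Finset.sum_div, Finset.sum_sub_distrib, mpV]
  split_ifs with hm
  · have key : ∀ a : ℕ, ¬ (2 * h + 1) ∣ a →
        ∑ k ∈ Finset.Icc 1 h, Real.cos (a * (2 * k * π / (n + 3))) = -1 / 2 := by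
      intro a ha
      rw [← sum_even a h ha]
      refine Finset.sum_congr rfl fun k _ => ?_
      rw [hc]; congr 1; ring
    rw [key j h1, key (j + 2) h2]; ring
  · have key : ∀ a : ℕ, ¬ (2 * h + 1) ∣ a →
        ∑ k ∈ Finset.Icc 1 h, Real.cos (a * ((2 * k - 1) * π / (n + 3))) = -(-1) ^ a / 2 := by
      intro a ha
      rw [← sum_odd a h ha]
      refine Finset.sum_congr rfl fun k _ => ?_
      rw [hc]; congr 1; ring
    rw [key j h1, key (j + 2) h2]; ring

lemma refl_term (j : ℕ) (v : ℝ) :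
    Real.sin (π - v) * Real.sin (((j : ℝ) + 1) * (π - v))
      = (-1) ^ j * (Real.sin v * Real.sin (((j : ℝ) + 1) * v)) := by
  have e : ((j : ℝ) + 1) * (π - v) = (j + 1 : ℕ) * π - (j + 1) * v := by push_cast; ring
  rw [e, Real.sin_pi_sub, Real.sin_sub, Real.sin_nat_mul_pi, Real.cos_nat_mul_pi]
  ring

/-- The inner sum is a constant times a sign power. -/
lemma inner_sign (h j n : ℕ) (hn : n + 3 = 2 * h + 1) :
    ∃ c : ℝ, ∀ m : ℕ,
    ∑ k ∈ Finset.Icc 1 h, Real.sin (mpV n m k) * Real.sin (((j : ℝ) + 1) * mpV n m k)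
      = c * ((-1) ^ j) ^ m := by
  have hc : (n : ℝ) + 3 = 2 * h + 1 := by exact_mod_cast hn
  refine ⟨∑ k ∈ Finset.Icc 1 h, Real.sin ((2 * k - 1) * π / (n + 3)) *
    Real.sin (((j : ℝ) + 1) * ((2 * k - 1) * π / (n + 3))), fun m => ?_⟩
  unfold mpV
  split_ifs with hm
  · have e : (((-1 : ℝ)) ^ j) ^ m = (-1) ^ j := by
      rw [← pow_mul, mul_comm, pow_mul, hm.neg_one_pow]
    rw [e, Finset.sum_mul]
    refine Finset.sum_bij' (fun k _ => h + 1 - k) (fun k _ => h + 1 - k) ?_ ?_ ?_ ?_ ?_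
    · intro k hk; simp only [Finset.mem_Icc] at *; omega
    · intro k hk; simp only [Finset.mem_Icc] at *; omega
    · intro k hk; simp only [Finset.mem_Icc] at *; omega
    · intro k hk; simp only [Finset.mem_Icc] at *; omega
    · intro k hk
      simp only [Finset.mem_Icc] at hk
      have e2 : 2 * (k : ℝ) * π / (n + 3)
          = π - (2 * ((h + 1 - k : ℕ) : ℝ) - 1) * π / (n + 3) := by
        rw [Nat.cast_sub (by omega), hc]
        push_cast; field_simp; ring
      rw [e2, refl_term]; ring
  · have e : (((-1 : ℝ)) ^ j) ^ m = 1 := by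
      rw [← pow_mul, mul_comm, pow_mul, (Nat.not_odd_iff_even.1 hm).neg_one_pow, one_pow]
    rw [e, mul_one]

lemma outer_zero (n i j : ℕ) (h1 : ¬ (n + 2) ∣ i) (h2 : ¬ (n + 2) ∣ (i + 2)) :
    ∑ m ∈ Finset.Icc 1 (n + 1), (Real.sin (mpW n m) * Real.sin (((i : ℝ) + 1) * mpW n m)) *
      (((-1) ^ j) ^ m) = 0 := by
  simp_rw [sin_mul_sin', mpW]
  rcases Nat.even_or_odd j with hj | hj
  · have key : ∀ a : ℕ, ¬ (n + 2) ∣ a →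
        ∑ m ∈ Finset.Icc 1 (n + 1), Real.cos (a * (m * π / (n + 2))) = -((-1) ^ a + 1) / 2 := by
      intro a ha
      rw [← sum_full a (n + 1) (fun hd => ha (dvd_trans ⟨2, by ring⟩ hd))]
      refine Finset.sum_congr rfl fun k _ => ?_
      congr 1; push_cast
      rw [show (n : ℝ) + 1 + 1 = n + 2 by ring]; ring
    simp_rw [hj.neg_one_pow, one_pow, mul_one, ← Finset.sum_div, Finset.sum_sub_distrib]
    rw [key i h1, key (i + 2) h2]; ring
  · have key : ∀ a : ℕ, ¬ (n + 2) ∣ a →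
        ∑ m ∈ Finset.Icc 1 (n + 1), Real.cos (a * (m * π / (n + 2))) * (-1) ^ m
          = -((-1) ^ (a + (n + 2)) + 1) / 2 := by
      intro a ha
      rw [← sum_full (a + (n + 2)) (n + 1)
        (fun hd => ha ((Nat.dvd_add_left (dvd_refl _)).1 (dvd_trans ⟨2, by ring⟩ hd)))]
      refine Finset.sum_congr rfl fun k _ => ?_
      have e : (k : ℝ) * ((a + (n + 2) : ℕ) * π / ((n + 1 : ℕ) + 1))
          = a * (k * π / (n + 2)) + k * π := by
        push_cast
        rw [show (n : ℝ) + 1 + 1 = n + 2 by ring]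
        field_simp
      rw [e, Real.cos_add, Real.sin_nat_mul_pi, Real.cos_nat_mul_pi]; ring
    simp_rw [hj.neg_one_pow, div_mul_eq_mul_div, sub_mul, ← Finset.sum_div,
      Finset.sum_sub_distrib]
    rw [key i h1, key (i + 2) h2]; ring

/-- If `n+2` divides neither `i` nor `i+2`, or `n+3` divides neither `j` nor `j+2`,
then `I(i,j) = 0`. -/
theorem mpI_eq_zero (n : ℕ) (hn : 0 < n) (hne : Even n) (i j : ℕ)
    (h : (¬ (n + 2) ∣ i ∧ ¬ (n + 2) ∣ (i + 2)) ∨ (¬ (n + 3) ∣ j ∧ ¬ (n + 3) ∣ (j + 2))) :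
    mpI n i j = 0 := by
  have hN : n + 3 = 2 * (n / 2 + 1) + 1 := by
    obtain ⟨r, hr⟩ := hne
    omega
  have hI : mpI n i j = ∑ m ∈ Finset.Icc 1 (n + 1),
      (Real.sin (mpW n m) * Real.sin (((i : ℝ) + 1) * mpW n m)) *
      ∑ k ∈ Finset.Icc 1 (n / 2 + 1),
        Real.sin (mpV n m k) * Real.sin (((j : ℝ) + 1) * mpV n m k) := by
    unfold mpI
    refine Finset.sum_congr rfl fun m _ => ?_
    rw [Finset.mul_sum]
    refine Finset.sum_congr rfl fun k _ => ?_
    ring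
  rw [hI]
  rcases h with ⟨h1, h2⟩ | ⟨h1, h2⟩
  · obtain ⟨c, hc⟩ := inner_sign (n / 2 + 1) j n hN
    simp_rw [hc]
    have ho := outer_zero n i j h1 h2
    calc _ = c * ∑ m ∈ Finset.Icc 1 (n + 1),
          (Real.sin (mpW n m) * Real.sin (((i : ℝ) + 1) * mpW n m)) * (((-1) ^ j) ^ m) := by
          rw [Finset.mul_sum]
          refine Finset.sum_congr rfl fun m _ => ?_
          ring
      _ = 0 := by rw [ho, mul_zero]
  · refine Finset.sum_eq_zero fun m _ => ?_
    rw [hN] at h1 h2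
    rw [inner_zero (n / 2 + 1) j m h1 h2 n hN, mul_zero]
end

section
/- Let n be an even positive integer. For every real bivariate polynomial p of total degree at most 2n, the cubature formula (4/π²)·∫_{−1}^{1}∫_{−1}^{1} p(x,y)·√(1−x²)·√(1−y²) dx dy = C_n · Σ_{m=1}^{n+1} Σ_{k=1}^{n/2+1} sin²(w_m)·sin²(v_k)·p(cos w_m, cos v_k) holds. -/
open Real Finset

/-- Cosine polynomials of degree at most `d`. -/
def MPcos (d : ℕ) (f : ℝ → ℝ) : Prop :=
  ∃ c : ℕ → ℝ, ∀ θ, f θ = ∑ i ∈ Finset.range (d + 1), c i * Real.cos (i * θ)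

lemma MPcos.basic (d i : ℕ) (h : i ≤ d) (a : ℝ) : MPcos d (fun θ => a * Real.cos (i * θ)) := by
  refine ⟨fun j => if j = i then a else 0, fun θ => ?_⟩
  rw [Finset.sum_eq_single i]
  · simp
  · intro j _ hj; simp [hj]
  · intro hi; simp at hi; omega

lemma MPcos.add {d : ℕ} {f g : ℝ → ℝ} (hf : MPcos d f) (hg : MPcos d g) :
    MPcos d (fun θ => f θ + g θ) := by
  obtain ⟨c, hc⟩ := hf
  obtain ⟨e, he⟩ := hg
  refine ⟨fun i => c i + e i, fun θ => ?_⟩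
  simp only [hc, he, add_mul, Finset.sum_add_distrib]

lemma MPcos.sum {d : ℕ} (s : Finset ℕ) (f : ℕ → ℝ → ℝ) (hf : ∀ i ∈ s, MPcos d (f i)) :
    MPcos d (fun θ => ∑ i ∈ s, f i θ) := by
  induction s using Finset.induction_on with
  | empty => exact ⟨fun _ => 0, fun θ => by simp⟩
  | insert a s ha ih =>
    have h := (hf a (by simp)).add (ih (fun i hi => hf i (by simp [hi])))
    simpa only [Finset.sum_insert ha] using h

lemma MPcos.mul_cos {d : ℕ} {f : ℝ → ℝ} (hf : MPcos d f) :
    MPcos (d + 1) (fun θ => Real.cos θ * f θ) := by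
  obtain ⟨c, hc⟩ := hf
  have h : MPcos (d + 1) (fun θ => ∑ i ∈ Finset.range (d + 1),
      (Real.cos θ * (c i * Real.cos (i * θ)))) := by
    apply MPcos.sum
    intro i hi
    have hi' : i ≤ d := by simp at hi; omega
    rcases i with _ | i
    · have := MPcos.basic (d + 1) 1 (by omega) (c 0)
      refine (congrArg (MPcos (d+1)) ?_).mpr this
      funext θ; simp; ring
    · have := (MPcos.basic (d + 1) (i + 2) (by omega) (c (i + 1) / 2)).add
        (MPcos.basic (d + 1) i (by omega) (c (i + 1) / 2))
      refine (congrArg (MPcos (d+1)) ?_).mpr this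
      funext θ
      have e1 : ((i + 2 : ℕ) : ℝ) * θ = ((i + 1 : ℕ) : ℝ) * θ + θ := by push_cast; ring
      have e2 : (i : ℝ) * θ = ((i + 1 : ℕ) : ℝ) * θ - θ := by push_cast; ring
      rw [e1, e2, Real.cos_add, Real.cos_sub]; ring
  refine (congrArg (MPcos (d+1)) ?_).mpr h
  funext θ; rw [hc, Finset.mul_sum]

lemma MPcos.pow (a : ℕ) : MPcos (a + 2) (fun θ => Real.cos θ ^ a * Real.sin θ ^ 2) := by
  induction a with
  | zero =>
    have := (MPcos.basic 2 0 (by omega) (1 / 2)).add (MPcos.basic 2 2 (by omega) (-1 / 2))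
    refine (congrArg (MPcos 2) ?_).mpr this
    funext θ
    have := Real.sin_sq_add_cos_sq θ
    push_cast
    rw [Real.cos_two_mul]; simp; linarith
  | succ a ih =>
    refine (congrArg (MPcos (a + 2 + 1)) ?_).mpr ih.mul_cos
    funext θ; ring

/-- Twice the trapezoidal sum on the grid `mπ/M`. -/
noncomputable def mpTrap (M : ℕ) (f : ℝ → ℝ) : ℝ :=
  ∑ m ∈ Finset.range M, (f (m * π / M) + f ((m + 1 : ℕ) * π / M))

lemma mpTrap_cos (M i : ℕ) (hi : 0 < i) (hM : i < 2 * M) :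
    mpTrap M (fun θ => Real.cos (i * θ)) = 0 := by
  have hM0 : (0 : ℝ) < M := by exact_mod_cast (by omega : 0 < M)
  have hi0 : (0 : ℝ) < i := by exact_mod_cast hi
  have hiM : (i : ℝ) < 2 * M := by exact_mod_cast hM
  set h : ℝ := i * π / (2 * M) with hh
  have hs : 0 < Real.sin h := by
    apply Real.sin_pos_of_pos_of_lt_pi
    · positivity
    · rw [hh, div_lt_iff₀ (by positivity)]
      nlinarith [Real.pi_pos]
  have key : Real.sin h * mpTrap M (fun θ => Real.cos (i * θ)) =
      Real.cos h * ∑ m ∈ Finset.range M,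
        (Real.sin (i * ((m + 1 : ℕ) * π / M)) - Real.sin (i * (m * π / M))) := by
    unfold mpTrap
    rw [Finset.mul_sum, Finset.mul_sum]
    refine Finset.sum_congr rfl fun m _ => ?_
    have e : (i : ℝ) * ((m + 1 : ℕ) * π / M) = i * (m * π / M) + 2 * h := by
      rw [hh]; push_cast; field_simp
    beta_reduce
    rw [e, Real.sin_add, Real.cos_add, Real.cos_two_mul, Real.sin_two_mul]
    have := Real.sin_sq_add_cos_sq h
    have e2 : Real.sin h ^ 2 = 1 - Real.cos h ^ 2 := by linarith
    ring_nf
    rw [e2]; ring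
  rw [Finset.sum_range_sub (fun m : ℕ => Real.sin (i * (m * π / M)))] at key
  have e3 : (i : ℝ) * (M * π / M) = i * π := by field_simp
  rw [e3, Real.sin_nat_mul_pi] at key
  simp at key
  rcases key with h0 | h0
  · exact absurd h0 hs.ne'
  · exact h0

lemma mpTrap_one (M : ℕ) : mpTrap M (fun _ => 1) = 2 * M := by
  simp [mpTrap]; ring

lemma mpTrap_sum (M : ℕ) (s : Finset ℕ) (c : ℕ → ℝ) (f : ℕ → ℝ → ℝ) :
    mpTrap M (fun θ => ∑ i ∈ s, c i * f i θ) = ∑ i ∈ s, c i * mpTrap M (f i) := by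
  unfold mpTrap
  simp_rw [← Finset.sum_add_distrib, ← mul_add, Finset.mul_sum]
  rw [Finset.sum_comm]

lemma mpInt_cos (i : ℕ) (hi : 0 < i) : ∫ θ in (0:ℝ)..π, Real.cos (i * θ) = 0 := by
  have hi0 : (i : ℝ) ≠ 0 := by exact_mod_cast hi.ne'
  rw [intervalIntegral.integral_comp_mul_left (fun x => Real.cos x) hi0]
  simp [Real.sin_nat_mul_pi]

lemma MPcos.quad {d : ℕ} {f : ℝ → ℝ} (hf : MPcos d f) (M : ℕ) (hM : d < 2 * M) :
    mpTrap M f = 2 * M / π * ∫ θ in (0:ℝ)..π, f θ := by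
  obtain ⟨c, hc⟩ := hf
  have hf' : f = fun θ => ∑ i ∈ Finset.range (d + 1), c i * Real.cos (i * θ) := funext hc
  rw [hf', mpTrap_sum M _ c (fun i θ => Real.cos (i * θ)),
    intervalIntegral.integral_finsetSum
      (fun i _ => Continuous.intervalIntegrable (by fun_prop) _ _), Finset.mul_sum]
  refine Finset.sum_congr rfl fun i hi => ?_
  simp at hi
  rw [intervalIntegral.integral_const_mul]
  rcases Nat.eq_zero_or_pos i with rfl | hpos
  · simp [mpTrap_one]
    field_simp
  · rw [mpTrap_cos M i hpos (by omega), mpInt_cos i hpos]; simp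

lemma MPcos.alt {d : ℕ} {f : ℝ → ℝ} (hf : MPcos d f) (M : ℕ) (hM : d < M) :
    mpTrap M (fun θ => f θ * Real.cos (M * θ)) = 0 := by
  obtain ⟨c, hc⟩ := hf
  have hf' : (fun θ => f θ * Real.cos (M * θ)) = fun θ => ∑ i ∈ Finset.range (d + 1),
      c i * (Real.cos (i * θ) * Real.cos (M * θ)) := by
    funext θ; rw [hc, Finset.sum_mul]; simp only [mul_assoc]
  rw [hf', mpTrap_sum M _ c (fun i θ => Real.cos (i * θ) * Real.cos (M * θ))]
  refine Finset.sum_eq_zero fun i hi => ?_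
  simp at hi
  have h1 := mpTrap_cos M (M + i) (by omega) (by omega)
  have h2 := mpTrap_cos M (M - i) (by omega) (by omega)
  have : mpTrap M (fun θ => Real.cos (i * θ) * Real.cos (M * θ)) =
      (mpTrap M (fun θ => Real.cos ((M + i : ℕ) * θ)) +
        mpTrap M (fun θ => Real.cos ((M - i : ℕ) * θ))) / 2 := by
    unfold mpTrap
    rw [← Finset.sum_add_distrib, Finset.sum_div]
    refine Finset.sum_congr rfl fun m _ => ?_
    rw [Nat.cast_sub (by omega : i ≤ M)]
    simp only [Nat.cast_add, add_mul, sub_mul, Real.cos_add, Real.cos_sub]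
    ring
  rw [this, h1, h2]; simp

lemma mpTrap_half (K : ℕ) (f : ℝ → ℝ) (h0 : f 0 = 0) (h1 : f π = 0) :
    mpTrap (K + 1) f = 2 * ∑ m ∈ Finset.Icc 1 K, f (m * π / (K + 1 : ℕ)) := by
  have hI : ∑ m ∈ Finset.Icc 1 K, f (m * π / (K + 1 : ℕ)) =
      ∑ m ∈ Finset.range K, f ((m + 1 : ℕ) * π / (K + 1 : ℕ)) := by
    rw [Finset.range_eq_Ico, Finset.sum_Ico_add' (fun m : ℕ => f (m * π / (K + 1 : ℕ))) 0 K 1]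
    rfl
  have hK : ((K + 1 : ℕ) : ℝ) * π / (K + 1 : ℕ) = π := by
    have : ((K + 1 : ℕ) : ℝ) ≠ 0 := by positivity
    field_simp
  rw [hI, mpTrap, Finset.sum_add_distrib, Finset.sum_range_succ', Finset.sum_range_succ
    (fun m : ℕ => f ((m + 1 : ℕ) * π / (K + 1 : ℕ))), hK, h1]
  simp only [Nat.cast_zero, zero_mul, zero_div, h0]
  ring

/-- One-dimensional quadrature. -/
lemma mp_quad (K a : ℕ) (h : a + 2 < 2 * (K + 1)) :
    ∑ m ∈ Finset.Icc 1 K, Real.cos (m * π / (K + 1 : ℕ)) ^ a *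
      Real.sin (m * π / (K + 1 : ℕ)) ^ 2 =
    ((K : ℝ) + 1) / π * ∫ θ in (0:ℝ)..π, Real.cos θ ^ a * Real.sin θ ^ 2 := by
  have h1 := (MPcos.pow a).quad (K + 1) h
  rw [mpTrap_half K _ (by simp) (by simp)] at h1
  push_cast at h1 ⊢
  have e : (2 : ℝ) * (K + 1) / π = 2 * ((K + 1) / π) := by ring
  rw [e, mul_assoc] at h1
  exact mul_left_cancel₀ two_ne_zero h1

lemma mp_alt (K a : ℕ) (h : a + 2 < K + 1) :
    ∑ m ∈ Finset.Icc 1 K, (-1 : ℝ) ^ m * (Real.cos (m * π / (K + 1 : ℕ)) ^ a *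
      Real.sin (m * π / (K + 1 : ℕ)) ^ 2) = 0 := by
  have h1 := (MPcos.pow a).alt (K + 1) h
  rw [mpTrap_half K _ (by simp) (by simp)] at h1
  have h2 := (mul_eq_zero.mp h1).resolve_left two_ne_zero
  rw [← h2]
  refine Finset.sum_congr rfl fun m _ => ?_
  have : ((K + 1 : ℕ) : ℝ) * (m * π / (K + 1 : ℕ)) = m * π := by
    have : ((K + 1 : ℕ) : ℝ) ≠ 0 := by positivity
    field_simp
  rw [this, Real.cos_nat_mul_pi]; ring

lemma mp_split (t : ℕ) (G : ℕ → ℝ) : ∑ j ∈ Finset.Icc 1 (2 * t + 2), G j =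
    ∑ k ∈ Finset.Icc 1 (t + 1), (G (2 * k - 1) + G (2 * k)) := by
  induction t with
  | zero => norm_num [Finset.sum_Icc_succ_top]
  | succ t ih =>
    rw [Finset.sum_Icc_succ_top (by omega : 1 ≤ t + 1 + 1), ← ih,
      show 2 * (t + 1) + 2 = 2 * t + 2 + 1 + 1 by ring, Finset.sum_Icc_succ_top (by omega),
      Finset.sum_Icc_succ_top (by omega), show 2 * (t + 1 + 1) - 1 = 2 * t + 2 + 1 by omega,
      show 2 * (t + 1 + 1) = 2 * t + 2 + 1 + 1 by ring]
    ring

lemma mp_inner (t m : ℕ) (g : ℝ → ℝ) :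
    ∑ k ∈ Finset.Icc 1 (t + 1), g (mpV (2 * t) m k) =
      ∑ j ∈ Finset.Icc 1 (2 * t + 2),
        (1 - (-1 : ℝ) ^ m * (-1 : ℝ) ^ j) / 2 * g (j * π / (2 * t + 2 + 1 : ℕ)) := by
  rw [mp_split]
  refine Finset.sum_congr rfl fun k hk => ?_
  simp only [Finset.mem_Icc] at hk
  have e1 : (-1 : ℝ) ^ (2 * k) = 1 := by simp
  have e2 : (-1 : ℝ) ^ (2 * k - 1) = -1 := Odd.neg_one_pow ⟨k - 1, by omega⟩
  have e3 : ((2 * k - 1 : ℕ) : ℝ) = 2 * k - 1 := by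
    rw [Nat.cast_sub (by omega)]; push_cast; ring
  have e4 : ((2 * t + 2 + 1 : ℕ) : ℝ) = ((2 * t : ℕ) : ℝ) + 3 := by push_cast; ring
  rw [e1, e2, e3, e4]
  unfold mpV
  by_cases hm : Odd m
  · rw [if_pos hm, hm.neg_one_pow]; push_cast; ring
  · rw [if_neg hm, (Nat.not_odd_iff_even.mp hm).neg_one_pow]; push_cast; ring

lemma mp_monomial (t a b : ℕ) (hab : a + b ≤ 2 * (2 * t)) :
    ∑ m ∈ Finset.Icc 1 (2 * t + 1), ∑ k ∈ Finset.Icc 1 (t + 1),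
      Real.sin (mpW (2 * t) m) ^ 2 * Real.sin (mpV (2 * t) m k) ^ 2 *
        (Real.cos (mpW (2 * t) m) ^ a * Real.cos (mpV (2 * t) m k) ^ b) =
    ((2 * t : ℝ) + 2) * ((2 * t : ℝ) + 3) / (2 * π ^ 2) *
      ((∫ θ in (0:ℝ)..π, Real.cos θ ^ a * Real.sin θ ^ 2) *
        ∫ θ in (0:ℝ)..π, Real.cos θ ^ b * Real.sin θ ^ 2) := by
  set F : ℕ → ℝ := fun m => Real.cos (m * π / (2 * t + 1 + 1 : ℕ)) ^ a *
    Real.sin (m * π / (2 * t + 1 + 1 : ℕ)) ^ 2 with hF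
  set H : ℕ → ℝ := fun m => Real.cos (m * π / (2 * t + 2 + 1 : ℕ)) ^ b *
    Real.sin (m * π / (2 * t + 2 + 1 : ℕ)) ^ 2 with hH
  have hFq := mp_quad (2 * t + 1) a (by omega)
  have hHq := mp_quad (2 * t + 2) b (by omega)
  have hz : (∑ m ∈ Finset.Icc 1 (2 * t + 1), (-1 : ℝ) ^ m * F m) *
      (∑ j ∈ Finset.Icc 1 (2 * t + 2), (-1 : ℝ) ^ j * H j) = 0 := by
    by_cases ha : a < 2 * t
    · rw [mp_alt (2 * t + 1) a (by omega), zero_mul]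
    · rw [mp_alt (2 * t + 2) b (by omega), mul_zero]
  have step : ∑ m ∈ Finset.Icc 1 (2 * t + 1), ∑ k ∈ Finset.Icc 1 (t + 1),
      Real.sin (mpW (2 * t) m) ^ 2 * Real.sin (mpV (2 * t) m k) ^ 2 *
        (Real.cos (mpW (2 * t) m) ^ a * Real.cos (mpV (2 * t) m k) ^ b) =
      (1 / 2) * ((∑ m ∈ Finset.Icc 1 (2 * t + 1), F m) * ∑ j ∈ Finset.Icc 1 (2 * t + 2), H j) -
      (1 / 2) * ((∑ m ∈ Finset.Icc 1 (2 * t + 1), (-1 : ℝ) ^ m * F m) *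
      (∑ j ∈ Finset.Icc 1 (2 * t + 2), (-1 : ℝ) ^ j * H j)) := by
    rw [Finset.sum_mul_sum, Finset.sum_mul_sum, Finset.mul_sum, Finset.mul_sum,
      ← Finset.sum_sub_distrib]
    refine Finset.sum_congr rfl fun m _ => ?_
    have hw : mpW (2 * t) m = m * π / (2 * t + 1 + 1 : ℕ) := by
      unfold mpW; push_cast; ring
    have := mp_inner t m (fun θ => Real.sin (mpW (2 * t) m) ^ 2 * Real.sin θ ^ 2 *
        (Real.cos (mpW (2 * t) m) ^ a * Real.cos θ ^ b))
    rw [this, Finset.mul_sum, Finset.mul_sum, ← Finset.sum_sub_distrib]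
    refine Finset.sum_congr rfl fun j _ => ?_
    rw [hw]
    simp only [hF, hH]
    ring
  rw [step, hz, hFq, hHq]
  push_cast
  field_simp
  ring

lemma mp_subst (a : ℕ) : ∫ x in (-1 : ℝ)..1, x ^ a * Real.sqrt (1 - x ^ 2) =
    ∫ θ in (0:ℝ)..π, Real.cos θ ^ a * Real.sin θ ^ 2 := by
  have h := intervalIntegral.integral_comp_mul_deriv (a := 0) (b := π) (f := Real.cos)
    (f' := fun θ => - Real.sin θ) (g := fun x => x ^ a * Real.sqrt (1 - x ^ 2))
    (fun x _ => Real.hasDerivAt_cos x) (by fun_prop) (by fun_prop)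
  rw [Real.cos_zero, Real.cos_pi] at h
  rw [intervalIntegral.integral_symm, ← h, ← intervalIntegral.integral_neg]
  refine intervalIntegral.integral_congr fun θ hθ => ?_
  rw [Set.uIcc_of_le Real.pi_pos.le] at hθ
  have hs := Real.sin_nonneg_of_mem_Icc hθ
  have : 1 - Real.cos θ ^ 2 = Real.sin θ ^ 2 := by
    linarith [Real.sin_sq_add_cos_sq θ]
  simp only [Function.comp, this, Real.sqrt_sq hs]
  ring

lemma mp_integral (p : MvPolynomial (Fin 2) ℝ) :
    ∫ x in (-1 : ℝ)..1, ∫ y in (-1 : ℝ)..1,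
      MvPolynomial.eval ![x, y] p * Real.sqrt (1 - x ^ 2) * Real.sqrt (1 - y ^ 2) =
    ∑ d ∈ p.support, p.coeff d *
      ((∫ θ in (0:ℝ)..π, Real.cos θ ^ (d 0) * Real.sin θ ^ 2) *
        ∫ θ in (0:ℝ)..π, Real.cos θ ^ (d 1) * Real.sin θ ^ 2) := by
  have inner : ∀ x : ℝ, ∫ y in (-1 : ℝ)..1,
      MvPolynomial.eval ![x, y] p * Real.sqrt (1 - x ^ 2) * Real.sqrt (1 - y ^ 2) =
      ∑ d ∈ p.support, (p.coeff d * ∫ θ in (0:ℝ)..π, Real.cos θ ^ (d 1) * Real.sin θ ^ 2) *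
        (x ^ (d 0) * Real.sqrt (1 - x ^ 2)) := by
    intro x
    have : ∀ y : ℝ, MvPolynomial.eval ![x, y] p * Real.sqrt (1 - x ^ 2) * Real.sqrt (1 - y ^ 2) =
        ∑ d ∈ p.support, (p.coeff d * (x ^ (d 0) * Real.sqrt (1 - x ^ 2))) *
          (y ^ (d 1) * Real.sqrt (1 - y ^ 2)) := by
      intro y
      rw [MvPolynomial.eval_eq', Finset.sum_mul, Finset.sum_mul]
      refine Finset.sum_congr rfl fun d _ => ?_
      simp [Fin.prod_univ_two]; ring
    simp_rw [this]
    rw [intervalIntegral.integral_finsetSum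
      (fun i _ => Continuous.intervalIntegrable (by fun_prop) _ _)]
    refine Finset.sum_congr rfl fun d _ => ?_
    rw [intervalIntegral.integral_const_mul, mp_subst]; ring
  simp_rw [inner]
  rw [intervalIntegral.integral_finsetSum
    (fun i _ => Continuous.intervalIntegrable (by fun_prop) _ _)]
  refine Finset.sum_congr rfl fun d _ => ?_
  rw [intervalIntegral.integral_const_mul, mp_subst]; ring

/-- The cubature formula at the Morrow–Patterson points: for every even positive
integer `n` and every real bivariate polynomial `p` of total degree at most `2n`,
`(4/π²)·∫∫ p(x,y)√(1-x²)√(1-y²) dx dy = C_n Σ_m Σ_k sin²(w_m) sin²(v_k) p(cos w_m, cos v_k)`,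
where `C_n = 8/((n+2)(n+3))`. -/
theorem mp_cubature (n : ℕ) (hn : 0 < n) (hne : Even n)
    (p : MvPolynomial (Fin 2) ℝ) (hp : p.totalDegree ≤ 2 * n) :
    (4 / π ^ 2) *
        ∫ x in (-1 : ℝ)..1, ∫ y in (-1 : ℝ)..1,
          MvPolynomial.eval ![x, y] p * Real.sqrt (1 - x ^ 2) * Real.sqrt (1 - y ^ 2) =
      (8 / (((n : ℝ) + 2) * ((n : ℝ) + 3))) *
        ∑ m ∈ Finset.Icc 1 (n + 1), ∑ k ∈ Finset.Icc 1 (n / 2 + 1),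
          Real.sin (mpW n m) ^ 2 * Real.sin (mpV n m k) ^ 2 *
            MvPolynomial.eval ![Real.cos (mpW n m), Real.cos (mpV n m k)] p := by
  obtain ⟨t, rfl⟩ := hne.two_dvd
  rw [mp_integral, Nat.mul_div_cancel_left t (by norm_num : 0 < 2)]
  have hsum : ∑ m ∈ Finset.Icc 1 (2 * t + 1), ∑ k ∈ Finset.Icc 1 (t + 1),
      Real.sin (mpW (2 * t) m) ^ 2 * Real.sin (mpV (2 * t) m k) ^ 2 *
        MvPolynomial.eval ![Real.cos (mpW (2 * t) m), Real.cos (mpV (2 * t) m k)] p =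
      ∑ d ∈ p.support, p.coeff d *
        ∑ m ∈ Finset.Icc 1 (2 * t + 1), ∑ k ∈ Finset.Icc 1 (t + 1),
          Real.sin (mpW (2 * t) m) ^ 2 * Real.sin (mpV (2 * t) m k) ^ 2 *
          (Real.cos (mpW (2 * t) m) ^ (d 0) * Real.cos (mpV (2 * t) m k) ^ (d 1)) := by
    simp_rw [MvPolynomial.eval_eq', Finset.mul_sum]
    rw [Finset.sum_comm (s := p.support)]
    refine Finset.sum_congr rfl fun m _ => ?_
    rw [Finset.sum_comm (s := p.support)]
    refine Finset.sum_congr rfl fun k _ => Finset.sum_congr rfl fun d _ => ?_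
    simp [Fin.prod_univ_two]; ring
  rw [hsum, Finset.mul_sum, Finset.mul_sum]
  refine Finset.sum_congr rfl fun d hd => ?_
  have hdeg : d 0 + d 1 ≤ 2 * (2 * t) := by
    have h := (MvPolynomial.le_totalDegree hd).trans hp
    rw [Finsupp.sum_fintype _ _ (fun _ => rfl), Fin.sum_univ_two] at h
    exact h
  rw [mp_monomial t (d 0) (d 1) hdeg]
  have := Real.pi_pos
  push_cast
  field_simp
  ring
end

section
/- Let n be an even positive integer and f : [-1,1]² → ℝ a continuous function. Define L_n f(x,y) = C_n Σ_{m=1}^{n+1} Σ_{k=1}^{n/2+1} (1−x_m²)(1−y_k²)·f(x_m,y_k)·Σ_{i=0}^{n} Σ_{j=0}^{n−i} U_i(x_m) U_j(y_k) U_i(x) U_j(y). Then L_n f interpolates f at the Morrow–Patterson points, i.e. L_n f(x_{m'}, y_{k'}) = f(x_{m'}, y_{k'}) for every m' = 1,…,n+1 and k' = 1,…,n/2+1. -/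
open Real Finset

lemma cos_sum_aux (N : ℕ) (r : ℤ) (hN : 0 < N) (hr : ¬ (2 * (N : ℤ)) ∣ r) :
    ∑ a ∈ range N, Real.cos (a * (r * π / N)) = (1 - (-1 : ℝ) ^ r) / 2 := by
  have hNR : (N : ℝ) ≠ 0 := by positivity
  set θ : ℝ := r * π / N with hθ
  have hs : Real.sin (θ / 2) ≠ 0 := by
    intro h
    obtain ⟨c, hc⟩ := Real.sin_eq_zero_iff.mp h
    apply hr
    refine ⟨c, ?_⟩
    have : (r : ℝ) = 2 * N * c := by
      rw [hθ] at hc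
      field_simp at hc
      have hp := Real.pi_pos.ne'
      first
        | linarith
        | (apply mul_right_cancel₀ hp; linarith)
    exact_mod_cast this
  have key : ∀ K : ℕ, 2 * Real.sin (θ / 2) * ∑ a ∈ range K, Real.cos (a * θ)
      = Real.sin (K * θ - θ / 2) + Real.sin (θ / 2) := by
    intro K
    induction K with
    | zero => simp
    | succ K ih =>
      rw [Finset.sum_range_succ, mul_add, ih]
      have e : (((K + 1 : ℕ) : ℝ) * θ - θ / 2) = K * θ + θ / 2 := by push_cast; ring
      rw [e, Real.sin_add, Real.sin_sub]; ring
  have h := key N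
  have e : (N : ℝ) * θ - θ / 2 = r * π - θ / 2 := by rw [hθ]; field_simp
  rw [e, Real.sin_sub, Real.sin_int_mul_pi, Real.cos_int_mul_pi] at h
  apply mul_left_cancel₀ hs
  linarith

lemma sin_orth (n p q : ℕ) (hp : 0 < p) (hp' : p < n + 2) (hq : 0 < q) (hq' : q < n + 2) :
    ∑ a ∈ range (n + 1), Real.sin (((a : ℝ) + 1) * (p * π / (n + 2))) *
      Real.sin (((a : ℝ) + 1) * (q * π / (n + 2))) = if p = q then ((n : ℝ) + 2) / 2 else 0 := by
  have h0 : ∑ a ∈ range (n + 1), Real.sin (((a : ℝ) + 1) * (p * π / (n + 2))) *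
      Real.sin (((a : ℝ) + 1) * (q * π / (n + 2)))
      = ∑ a ∈ range (n + 2), Real.sin ((a : ℝ) * (p * π / (n + 2))) *
      Real.sin ((a : ℝ) * (q * π / (n + 2))) := by
    rw [Finset.sum_range_succ' _ (n + 1)]
    simp
  have h1 : ∀ a : ℕ, Real.sin ((a : ℝ) * (p * π / (n + 2))) * Real.sin ((a : ℝ) * (q * π / (n + 2)))
      = (Real.cos (a * ((((p : ℤ) - q : ℤ) : ℝ) * π / ((n + 2 : ℕ) : ℝ)))
        - Real.cos (a * ((((p : ℤ) + q : ℤ) : ℝ) * π / ((n + 2 : ℕ) : ℝ)))) / 2 := by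
    intro a
    have e1 : (a : ℝ) * ((((p : ℤ) - q : ℤ) : ℝ) * π / ((n + 2 : ℕ) : ℝ))
      = a * (p * π / (n + 2)) - a * (q * π / (n + 2)) := by push_cast; ring
    have e2 : (a : ℝ) * ((((p : ℤ) + q : ℤ) : ℝ) * π / ((n + 2 : ℕ) : ℝ))
      = a * (p * π / (n + 2)) + a * (q * π / (n + 2)) := by push_cast; ring
    rw [e1, e2, Real.cos_sub, Real.cos_add]; ring
  rw [h0, Finset.sum_congr rfl (fun a _ => h1 a), ← Finset.sum_div, Finset.sum_sub_distrib]
  have h2 := cos_sum_aux (n + 2) ((p : ℤ) + q) (by omega) (by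
    rintro ⟨c, hc⟩
    have : 0 < c := by
      by_contra hcc
      push Not at hcc
      have : (2 * ((n + 2 : ℕ) : ℤ)) * c ≤ 0 := mul_nonpos_of_nonneg_of_nonpos (by positivity) hcc
      omega
    have : (2 * ((n + 2 : ℕ) : ℤ)) * 1 ≤ (2 * ((n + 2 : ℕ) : ℤ)) * c :=
      mul_le_mul_of_nonneg_left (by omega) (by positivity)
    omega)
  rw [h2]
  split_ifs with hpq
  · subst hpq
    have : (-1 : ℝ) ^ ((p : ℤ) + p) = 1 := Even.neg_one_zpow ⟨_, rfl⟩
    rw [this]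
    simp
  · have h3 := cos_sum_aux (n + 2) ((p : ℤ) - q) (by omega) (by
      intro hd
      have := Int.eq_zero_of_abs_lt_dvd hd (by rw [abs_lt]; constructor <;> push_cast <;> omega)
      omega)
    rw [h3]
    have : (-1 : ℝ) ^ ((p : ℤ) + q) = (-1 : ℝ) ^ ((p : ℤ) - q) := by
      have : (p : ℤ) + q = (p - q) + (q + q) := by ring
      rw [this, zpow_add₀ (by norm_num), Even.neg_one_zpow (n := (q : ℤ) + q) ⟨_, rfl⟩, mul_one]
    rw [this]; simp

lemma triangle_half (n : ℕ) (g : ℕ → ℕ → ℝ)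
    (hg : ∀ i ≤ n, ∀ j ≤ n + 1, g (n - i) (n + 1 - j) = g i j) :
    2 * ∑ i ∈ range (n + 1), ∑ j ∈ range (n - i + 1), g i j =
      ∑ i ∈ range (n + 1), ∑ j ∈ range (n + 2), g i j := by
  have h1 : ∀ i ∈ range (n + 1), ∑ j ∈ range (n + 2), g i j =
      ∑ j ∈ range (n - i + 1), g i j + ∑ j ∈ range (i + 1), g i (n + 1 - j) := by
    intro i hi
    have hi' : i ≤ n := by simpa [Nat.lt_succ_iff] using hi
    have e : n + 2 = (n - i + 1) + (i + 1) := by omega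
    rw [e, Finset.sum_range_add, ← Finset.sum_range_reflect (fun j => g i (n - i + 1 + j))]
    congr 1
    apply Finset.sum_congr rfl
    intro j hj
    have : j < i + 1 := by simpa using hj
    congr 1
    omega
  rw [Finset.sum_congr rfl h1, Finset.sum_add_distrib, two_mul]
  congr 1
  rw [← Finset.sum_range_reflect (fun i => ∑ j ∈ range (i + 1), g i (n + 1 - j))]
  apply Finset.sum_congr rfl
  intro i hi
  have hi' : i < n + 1 := by simpa using hi
  have e : n + 1 - 1 - i = n - i := by omega
  simp only [e]
  apply Finset.sum_congr rfl
  intro j hj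
  have hj' : j < n - i + 1 := by simpa using hj
  exact (hg i (by omega) j (by omega)).symm

lemma sin_reflect (N a b m : ℕ) (hN : 0 < N) (hab : a + b = N) :
    Real.sin ((a : ℝ) * (m * π / N)) = -(-1) ^ m * Real.sin ((b : ℝ) * (m * π / N)) := by
  have hNR : (N : ℝ) ≠ 0 := by positivity
  have e : (a : ℝ) * (m * π / N) = m * π - b * (m * π / N) := by
    have : (N : ℝ) = a + b := by rw [← hab]; push_cast; rfl
    field_simp
    rw [this]; ring
  rw [e, Real.sin_sub, Real.sin_nat_mul_pi, Real.cos_nat_mul_pi]; ring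

/-- Integer numerator of the angle `v_k`. -/
def mpL (m k : ℕ) : ℕ := if Odd m then 2 * k else 2 * k - 1

lemma kernel_sum (n m l m' l' : ℕ) (hm : 0 < m) (hm2 : m < n + 2) (hm' : 0 < m')
    (hm2' : m' < n + 2) (hl : 0 < l) (hl2 : l < n + 3) (hl' : 0 < l') (hl2' : l' < n + 3)
    (hpar : Odd (m + l)) (hpar' : Odd (m' + l')) :
    ∑ i ∈ range (n + 1), ∑ j ∈ range (n - i + 1),
      (Real.sin (((i : ℝ) + 1) * (m * π / (n + 2))) * Real.sin (((i : ℝ) + 1) * (m' * π / (n + 2)))) *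
      (Real.sin (((j : ℝ) + 1) * (l * π / (n + 3))) * Real.sin (((j : ℝ) + 1) * (l' * π / (n + 3))))
    = if m = m' ∧ l = l' then ((n : ℝ) + 2) * (n + 3) / 8 else 0 := by
  have h := triangle_half n (fun i j =>
      (Real.sin (((i : ℝ) + 1) * (m * π / (n + 2))) * Real.sin (((i : ℝ) + 1) * (m' * π / (n + 2)))) *
      (Real.sin (((j : ℝ) + 1) * (l * π / (n + 3))) * Real.sin (((j : ℝ) + 1) * (l' * π / (n + 3)))))
    (by
      intro i hi j hj
      have r1 : ∀ p : ℕ, Real.sin ((((n - i : ℕ) : ℝ) + 1) * (p * π / (n + 2)))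
          = -(-1) ^ p * Real.sin (((i : ℝ) + 1) * (p * π / (n + 2))) := by
        intro p
        have := sin_reflect (n + 2) (n - i + 1) (i + 1) p (by omega) (by omega)
        simpa only [Nat.cast_add, Nat.cast_one, Nat.cast_ofNat] using this
      have r2 : ∀ p : ℕ, Real.sin ((((n + 1 - j : ℕ) : ℝ) + 1) * (p * π / (n + 3)))
          = -(-1) ^ p * Real.sin (((j : ℝ) + 1) * (p * π / (n + 3))) := by
        intro p
        have := sin_reflect (n + 3) (n + 1 - j + 1) (j + 1) p (by omega) (by omega)
        simpa only [Nat.cast_add, Nat.cast_one, Nat.cast_ofNat] using this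
      simp only [r1, r2]
      have p1 : (-1 : ℝ) ^ m * (-1) ^ l = -1 := by rw [← pow_add]; exact hpar.neg_one_pow
      have p2 : (-1 : ℝ) ^ m' * (-1) ^ l' = -1 := by rw [← pow_add]; exact hpar'.neg_one_pow
      generalize Real.sin (((i : ℝ) + 1) * (m * π / (n + 2))) = A
      generalize Real.sin (((i : ℝ) + 1) * (m' * π / (n + 2))) = B
      generalize Real.sin (((j : ℝ) + 1) * (l * π / (n + 3))) = C
      generalize Real.sin (((j : ℝ) + 1) * (l' * π / (n + 3))) = D
      calc _ = (((-1 : ℝ) ^ m * (-1) ^ l) * ((-1 : ℝ) ^ m' * (-1) ^ l')) * (A * B * (C * D)) := by ring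
        _ = _ := by rw [p1, p2]; ring)
  rw [← Finset.sum_mul_sum] at h
  have o1 := sin_orth n m m' hm hm2 hm' hm2'
  have o2 := sin_orth (n + 1) l l' hl hl2 hl' hl2'
  have e : (((n + 1 : ℕ) : ℝ) + 2) = n + 3 := by push_cast; ring
  rw [e] at o2
  rw [o1, o2] at h
  by_cases h1 : m = m' <;> by_cases h2 : l = l' <;> simp only [h1, h2, if_true, if_false, and_true, and_false, and_self, mul_zero, zero_mul] at h ⊢ <;> linarith

lemma mpV_eq (n m k : ℕ) (hk : 1 ≤ k) : mpV n m k = (mpL m k : ℝ) * π / (n + 3) := by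
  unfold mpV mpL
  split_ifs
  · push_cast; rfl
  · rw [Nat.cast_sub (by omega)]; push_cast; rfl

lemma chebU_cos (j : ℕ) (θ : ℝ) : chebU j (Real.cos θ) * Real.sin θ = Real.sin (((j : ℝ) + 1) * θ) := by
  unfold chebU
  have := Polynomial.Chebyshev.U_real_cos θ (j : ℤ)
  simpa using this

lemma sin_pos_aux (N p : ℕ) (hp : 0 < p) (hp' : p < N) : 0 < Real.sin ((p : ℝ) * π / N) := by
  have hN : (0 : ℝ) < N := by exact_mod_cast (by omega : 0 < N)
  have hpR : (p : ℝ) < N := by exact_mod_cast hp'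
  have hp0 : (0 : ℝ) < p := by exact_mod_cast hp
  apply Real.sin_pos_of_pos_of_lt_pi
  · positivity
  · rw [div_lt_iff₀ hN]; nlinarith [Real.pi_pos]

lemma mpL_bounds (n m k : ℕ) (hne : Even n) (hk : k ∈ Finset.Icc 1 (n / 2 + 1)) :
    0 < mpL m k ∧ mpL m k < n + 3 ∧ Odd (m + mpL m k) := by
  rw [Finset.mem_Icc] at hk
  obtain ⟨c, rfl⟩ := hne
  unfold mpL
  split_ifs with h
  · refine ⟨by omega, by omega, ?_⟩
    rw [Nat.odd_iff] at *; omega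
  · refine ⟨by omega, by omega, ?_⟩
    rw [Nat.odd_iff] at *; omega

lemma kernel_eval (n m k m' k' : ℕ) (hne : Even n) (hm : m ∈ Finset.Icc 1 (n + 1))
    (hk : k ∈ Finset.Icc 1 (n / 2 + 1)) (hm' : m' ∈ Finset.Icc 1 (n + 1))
    (hk' : k' ∈ Finset.Icc 1 (n / 2 + 1)) :
    (1 - Real.cos (mpW n m) ^ 2) * (1 - Real.cos (mpV n m k) ^ 2) *
            ∑ i ∈ Finset.range (n + 1), ∑ j ∈ Finset.range (n - i + 1),
              chebU i (Real.cos (mpW n m)) * chebU j (Real.cos (mpV n m k)) *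
                chebU i (Real.cos (mpW n m')) * chebU j (Real.cos (mpV n m' k')) =
      if m = m' ∧ k = k' then ((n : ℝ) + 2) * (n + 3) / 8 else 0 := by
  obtain ⟨l1, l2, l3⟩ := mpL_bounds n m k hne hk
  obtain ⟨l1', l2', l3'⟩ := mpL_bounds n m' k' hne hk'
  rw [Finset.mem_Icc] at hm hm' hk hk'
  have hK := kernel_sum n m (mpL m k) m' (mpL m' k') (by omega) (by omega) (by omega) (by omega)
    l1 l2 l1' l2' l3 l3'
  have hiff : (m = m' ∧ mpL m k = mpL m' k') ↔ (m = m' ∧ k = k') := by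
    constructor
    · rintro ⟨rfl, h⟩
      refine ⟨rfl, ?_⟩
      unfold mpL at h
      split_ifs at h <;> omega
    · rintro ⟨rfl, rfl⟩; exact ⟨rfl, rfl⟩
  simp only [hiff] at hK
  have s1 : 0 < Real.sin (mpW n m) := by
    have := sin_pos_aux (n + 2) m (by omega) (by omega)
    simpa only [mpW, Nat.cast_add, Nat.cast_ofNat] using this
  have s1' : 0 < Real.sin (mpW n m') := by
    have := sin_pos_aux (n + 2) m' (by omega) (by omega)
    simpa only [mpW, Nat.cast_add, Nat.cast_ofNat] using this
  have s2 : 0 < Real.sin (mpV n m k) := by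
    have := sin_pos_aux (n + 3) (mpL m k) l1 l2
    rw [mpV_eq n m k hk.1]
    simpa only [Nat.cast_add, Nat.cast_ofNat] using this
  have s2' : 0 < Real.sin (mpV n m' k') := by
    have := sin_pos_aux (n + 3) (mpL m' k') l1' l2'
    rw [mpV_eq n m' k' hk'.1]
    simpa only [Nat.cast_add, Nat.cast_ofNat] using this
  rw [← mpV_eq n m k hk.1, ← mpV_eq n m' k' hk'.1] at hK
  change ∑ i ∈ range (n + 1), ∑ j ∈ range (n - i + 1),
      (Real.sin (((i : ℝ) + 1) * mpW n m) * Real.sin (((i : ℝ) + 1) * mpW n m')) * _ = _ at hK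
  simp only [← chebU_cos] at hK
  rw [← Real.sin_sq, ← Real.sin_sq]
  generalize hT : ∑ i ∈ Finset.range (n + 1), ∑ j ∈ Finset.range (n - i + 1),
              chebU i (Real.cos (mpW n m)) * chebU j (Real.cos (mpV n m k)) *
                chebU i (Real.cos (mpW n m')) * chebU j (Real.cos (mpV n m' k')) = T
  have hK2 : (Real.sin (mpW n m) * Real.sin (mpW n m') * (Real.sin (mpV n m k) * Real.sin (mpV n m' k'))) * T
      = if m = m' ∧ k = k' then ((n : ℝ) + 2) * (n + 3) / 8 else 0 := by
    rw [← hK, ← hT, Finset.mul_sum]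
    apply Finset.sum_congr rfl
    intro i _
    rw [Finset.mul_sum]
    apply Finset.sum_congr rfl
    intro j _
    ring
  by_cases h : m = m' ∧ k = k'
  · rw [if_pos h] at hK2 ⊢
    obtain ⟨rfl, rfl⟩ := h
    rw [← hK2]; ring
  · rw [if_neg h] at hK2 ⊢
    have hne0 : Real.sin (mpW n m) * Real.sin (mpW n m') * (Real.sin (mpV n m k) * Real.sin (mpV n m' k')) ≠ 0 := by
      positivity
    have : T = 0 := (mul_eq_zero.mp hK2).resolve_left hne0
    rw [this, mul_zero]

/-- The interpolation operator `L_n` at the Morrow–Patterson points interpolates: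
for every continuous `f : [-1,1]² → ℝ`, the polynomial
`L_n f(x,y) = C_n Σ_m Σ_k (1-x_m²)(1-y_k²) f(x_m,y_k) Σ_{i+j≤n} U_i(x_m)U_j(y_k)U_i(x)U_j(y)`
agrees with `f` at every Morrow–Patterson point `(x_{m'}, y_{k'})`. -/
theorem mp_interpolation (n : ℕ) (hn : 0 < n) (hne : Even n)
    (f : ℝ × ℝ → ℝ) (hf : ContinuousOn f (Set.Icc (-1 : ℝ) 1 ×ˢ Set.Icc (-1 : ℝ) 1))
    (m' : ℕ) (hm' : m' ∈ Finset.Icc 1 (n + 1)) (k' : ℕ) (hk' : k' ∈ Finset.Icc 1 (n / 2 + 1)) :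
    (8 / (((n : ℝ) + 2) * ((n : ℝ) + 3))) *
        ∑ m ∈ Finset.Icc 1 (n + 1), ∑ k ∈ Finset.Icc 1 (n / 2 + 1),
          (1 - Real.cos (mpW n m) ^ 2) * (1 - Real.cos (mpV n m k) ^ 2) *
            f (Real.cos (mpW n m), Real.cos (mpV n m k)) *
            ∑ i ∈ Finset.range (n + 1), ∑ j ∈ Finset.range (n - i + 1),
              chebU i (Real.cos (mpW n m)) * chebU j (Real.cos (mpV n m k)) *
                chebU i (Real.cos (mpW n m')) * chebU j (Real.cos (mpV n m' k')) =
      f (Real.cos (mpW n m'), Real.cos (mpV n m' k')) := by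
  have hterm : ∀ m ∈ Finset.Icc 1 (n + 1), ∀ k ∈ Finset.Icc 1 (n / 2 + 1),
      (1 - Real.cos (mpW n m) ^ 2) * (1 - Real.cos (mpV n m k) ^ 2) *
            f (Real.cos (mpW n m), Real.cos (mpV n m k)) *
            ∑ i ∈ Finset.range (n + 1), ∑ j ∈ Finset.range (n - i + 1),
              chebU i (Real.cos (mpW n m)) * chebU j (Real.cos (mpV n m k)) *
                chebU i (Real.cos (mpW n m')) * chebU j (Real.cos (mpV n m' k')) =
      if m = m' then (if k = k' then
        f (Real.cos (mpW n m'), Real.cos (mpV n m' k')) * (((n : ℝ) + 2) * (n + 3) / 8) else 0)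
        else 0 := by
    intro m hm k hk
    have h := kernel_eval n m k m' k' hne hm hk hm' hk'
    rw [mul_right_comm, h]
    by_cases h1 : m = m'
    · by_cases h2 : k = k'
      · subst h1; subst h2; simp [mul_comm]
      · simp [h2]
    · simp [h1]
  rw [Finset.sum_congr rfl (fun m hm => Finset.sum_congr rfl (hterm m hm))]
  have : ∀ m : ℕ, ∑ k ∈ Finset.Icc 1 (n / 2 + 1), (if m = m' then (if k = k' then
        f (Real.cos (mpW n m'), Real.cos (mpV n m' k')) * (((n : ℝ) + 2) * (n + 3) / 8) else 0)
        else 0) = if m = m' then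
        f (Real.cos (mpW n m'), Real.cos (mpV n m' k')) * (((n : ℝ) + 2) * (n + 3) / 8) else 0 := by
    intro m
    split_ifs
    · rw [Finset.sum_ite_eq', if_pos hk']
    · simp
  simp only [this]
  rw [Finset.sum_ite_eq', if_pos hm']
  have h2 : (n : ℝ) + 2 ≠ 0 := by positivity
  have h3 : (n : ℝ) + 3 ≠ 0 := by positivity
  field_simp
end

section
/- Let ν be an even positive integer. The covering radius of the Morrow–Patterson points MP_ν with respect to the Dubiner distance on the square Q = [-1,1]² equals 2π/(ν+3); that is, sup over (x,y) ∈ Q of the infimum over Morrow–Patterson points (a,b) ∈ MP_ν of max{|arccos(x) − arccos(a)|, |arccos(y) − arccos(b)|} is equal to 2π/(ν+3). -/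
open Real Finset

theorem mp_near (N : ℕ) (hN : 1 ≤ N) (u : ℝ) (h0 : 0 ≤ u) (h1 : u ≤ N + 1) :
    ∃ k ∈ Finset.Icc 1 N, |u - k| ≤ 1 := by
  by_cases hu : u < 1
  · refine ⟨1, Finset.mem_Icc.2 ⟨le_refl _, hN⟩, ?_⟩
    rw [abs_le]; push_cast; constructor <;> linarith
  push Not at hu
  by_cases hu2 : (N : ℝ) ≤ u
  · refine ⟨N, Finset.mem_Icc.2 ⟨hN, le_refl _⟩, ?_⟩
    rw [abs_le]; constructor <;> linarith
  push Not at hu2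
  have a := Nat.floor_le h0
  have b := Nat.lt_floor_add_one u
  refine ⟨⌊u⌋₊, Finset.mem_Icc.2 ⟨Nat.le_floor (by simpa using hu), ?_⟩, ?_⟩
  · have : (⌊u⌋₊ : ℝ) ≤ N := by linarith
    exact_mod_cast this
  · rw [abs_le]; constructor <;> linarith

theorem mpW_arccos (n m : ℕ) (hm : m ∈ Finset.Icc 1 (n + 1)) :
    Real.arccos (Real.cos (mpW n m)) = mpW n m := by
  have h2 : (m : ℝ) ≤ n + 1 := by exact_mod_cast (Finset.mem_Icc.1 hm).2
  have hp := Real.pi_pos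
  apply Real.arccos_cos
  · unfold mpW; positivity
  · unfold mpW; rw [div_le_iff₀ (by positivity)]; nlinarith

theorem mpV_arccos (n m k : ℕ) (hk : k ∈ Finset.Icc 1 (n / 2 + 1)) :
    Real.arccos (Real.cos (mpV n m k)) = mpV n m k := by
  have h1 : (1 : ℝ) ≤ k := by exact_mod_cast (Finset.mem_Icc.1 hk).1
  have h2 : 2 * (k : ℝ) ≤ n + 2 := by
    have := (Finset.mem_Icc.1 hk).2
    have : 2 * k ≤ n + 2 := by omega
    exact_mod_cast this
  have hp := Real.pi_pos
  have h3 : (0 : ℝ) ≤ 2 * k - 1 := by linarith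
  apply Real.arccos_cos
  · unfold mpV; split_ifs <;> positivity
  · unfold mpV; split_ifs <;> rw [div_le_iff₀ (by positivity)] <;> nlinarith

theorem mp_scale (c t u b B : ℝ) (hB : 0 < B) (h : |t / B - u| ≤ b) (hc : c = u * B) :
    |t - c| ≤ b * B := by
  have : t - c = (t / B - u) * B := by rw [hc]; field_simp
  rw [this, abs_mul, abs_of_pos hB]
  exact mul_le_mul_of_nonneg_right h hB.le

theorem mp_AB (ν : ℕ) : π / ((ν : ℝ) + 2) ≤ 2 * π / ((ν : ℝ) + 3) := by
  have hp := Real.pi_pos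
  have : (0 : ℝ) ≤ ν := Nat.cast_nonneg _
  rw [div_le_div_iff₀ (by positivity) (by positivity)]
  nlinarith

theorem mp_cover (ν : ℕ) (hne : Even ν) (s t : ℝ) (hs : 0 ≤ s) (hs' : s ≤ π)
    (ht : 0 ≤ t) (ht' : t ≤ π) :
    ∃ m ∈ Finset.Icc 1 (ν + 1), ∃ k ∈ Finset.Icc 1 (ν / 2 + 1),
      max |s - mpW ν m| |t - mpV ν m k| ≤ 2 * π / ((ν : ℝ) + 3) := by
  have hp := Real.pi_pos
  have hA : 0 < π / ((ν : ℝ) + 2) := by positivity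
  have hB : 0 < π / ((ν : ℝ) + 3) := by positivity
  have h1 : s / (π / ((ν : ℝ) + 2)) ≤ ν + 2 := by
    rw [div_le_iff₀ hA]; field_simp; exact hs'
  have h2 : t / (π / ((ν : ℝ) + 3)) ≤ ν + 3 := by
    rw [div_le_iff₀ hB]; field_simp; exact ht'
  have h2' : 0 ≤ t / (π / ((ν : ℝ) + 3)) := by positivity
  obtain ⟨m, hm, hmd⟩ := mp_near (ν + 1) (by omega) _ (by positivity : 0 ≤ s / (π / ((ν : ℝ) + 2)))
    (by push_cast; linarith)
  have hn : ((ν / 2 + 1 : ℕ) : ℝ) = ν / 2 + 1 := by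
    obtain ⟨p, rfl⟩ := hne
    have : (p + p) / 2 = p := by omega
    rw [this]; push_cast; ring
  have hW : |s - mpW ν m| ≤ 2 * π / ((ν : ℝ) + 3) := by
    have := mp_scale (mpW ν m) s m 1 _ hA hmd (by unfold mpW; ring)
    linarith [mp_AB ν]
  refine ⟨m, hm, ?_⟩
  by_cases ho : Odd m
  · obtain ⟨k, hk, hkd⟩ := mp_near (ν / 2 + 1) (by omega) (t / (π / ((ν : ℝ) + 3)) / 2)
      (by positivity) (by rw [hn]; linarith)
    refine ⟨k, hk, max_le hW ?_⟩
    have := mp_scale (mpV ν m k) t (2 * k) 2 _ hB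
      (by rw [abs_le] at hkd ⊢; constructor <;> linarith [hkd.1, hkd.2])
      (by rw [mpV, if_pos ho]; ring)
    rwa [← mul_div_assoc] at this
  · obtain ⟨k, hk, hkd⟩ := mp_near (ν / 2 + 1) (by omega) ((t / (π / ((ν : ℝ) + 3)) + 1) / 2)
      (by positivity) (by rw [hn]; linarith)
    refine ⟨k, hk, max_le hW ?_⟩
    have := mp_scale (mpV ν m k) t (2 * k - 1) 2 _ hB
      (by rw [abs_le] at hkd ⊢; constructor <;> linarith [hkd.1, hkd.2])
      (by rw [mpV, if_neg ho]; ring)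
    rwa [← mul_div_assoc] at this

/-- The covering radius of the Morrow–Patterson points `MP_ν` with respect to the
Dubiner distance `d_Q((x,y),(a,b)) = max(|arccos x - arccos a|, |arccos y - arccos b|)`
on the square `Q = [-1,1]²` equals `2π/(ν+3)`. -/
theorem mp_covering_radius (ν : ℕ) (hν : 0 < ν) (hne : Even ν) :
    sSup {r : ℝ | ∃ x ∈ Set.Icc (-1 : ℝ) 1, ∃ y ∈ Set.Icc (-1 : ℝ) 1,
        r = sInf {d : ℝ | ∃ m ∈ Finset.Icc 1 (ν + 1), ∃ k ∈ Finset.Icc 1 (ν / 2 + 1),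
          d = max |Real.arccos x - Real.arccos (Real.cos (mpW ν m))|
                  |Real.arccos y - Real.arccos (Real.cos (mpV ν m k))|}} =
      2 * π / ((ν : ℝ) + 3) := by
  have hp := Real.pi_pos
  have hn0 : (0 : ℝ) ≤ ν := Nat.cast_nonneg _
  apply IsGreatest.csSup_eq
  constructor
  · refine ⟨1, by norm_num, 1, by norm_num, ?_⟩
    symm
    apply IsLeast.csInf_eq
    constructor
    · have e1 : (1 : ℕ) ∈ Finset.Icc 1 (ν + 1) := by simp
      have e2 : (1 : ℕ) ∈ Finset.Icc 1 (ν / 2 + 1) := by simp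
      refine ⟨1, e1, 1, e2, ?_⟩
      rw [mpW_arccos _ _ e1, mpV_arccos _ _ _ e2, Real.arccos_one, zero_sub, zero_sub, abs_neg,
        abs_neg]
      have a : mpW ν 1 = π / ((ν : ℝ) + 2) := by simp [mpW]
      have b : mpV ν 1 1 = 2 * π / ((ν : ℝ) + 3) := by simp [mpV]
      rw [a, b, abs_of_pos (by positivity), abs_of_pos (by positivity), max_eq_right (mp_AB ν)]
    · rintro d ⟨m, hm, k, hk, rfl⟩
      rw [mpW_arccos _ _ hm, mpV_arccos _ _ _ hk, Real.arccos_one, zero_sub, zero_sub, abs_neg,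
        abs_neg]
      by_cases ho : Odd m
      · refine le_trans ?_ (le_max_right _ _)
        refine le_trans ?_ (le_abs_self _)
        have h1 : (1 : ℝ) ≤ k := by exact_mod_cast (Finset.mem_Icc.1 hk).1
        rw [mpV, if_pos ho]
        apply div_le_div_of_nonneg_right _ (by positivity)
        nlinarith
      · refine le_trans ?_ (le_max_left _ _)
        refine le_trans ?_ (le_abs_self _)
        have h1 : (2 : ℝ) ≤ m := by
          have := (Finset.mem_Icc.1 hm).1
          have h3 : m ≠ 1 := by rintro rfl; exact ho odd_one
          have : 2 ≤ m := by omega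
          exact_mod_cast this
        rw [mpW]
        apply div_le_div₀ (by positivity) (by nlinarith) (by positivity) (by linarith)
  · rintro r ⟨x, hx, y, hy, rfl⟩
    obtain ⟨m, hm, k, hk, h⟩ := mp_cover ν hne (Real.arccos x) (Real.arccos y)
      (Real.arccos_nonneg _) (Real.arccos_le_pi _) (Real.arccos_nonneg _) (Real.arccos_le_pi _)
    refine le_trans (csInf_le ⟨0, ?_⟩ ⟨m, hm, k, hk, rfl⟩) ?_
    · rintro d ⟨m, hm, k, hk, rfl⟩
      exact le_trans (abs_nonneg _) (le_max_left _ _)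
    · rw [mpW_arccos _ _ hm, mpV_arccos _ _ _ hk]
      exact h
end

section
/- Let ν be an even positive integer and let A_ν = MP_ν ∪ {(1,1), (−1,1)}. The covering radius of A_ν with respect to the Dubiner distance on the square Q = [-1,1]² equals π/(ν+2); that is, sup over (x,y) ∈ Q of the infimum over (a,b) ∈ A_ν of max{|arccos(x) − arccos(a)|, |arccos(y) − arccos(b)|} is equal to π/(ν+2). -/
open Real Finset

theorem mp_aux_chain (a g h t : ℝ) (hgh : g ≤ h) (K : ℕ) :
    a + 2 * g - h ≤ t → t ≤ a + 2 * ((K : ℝ) + 1) * g + h →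
    ∃ k ∈ Finset.Icc 1 (K + 1), |t - (a + 2 * (k : ℝ) * g)| ≤ h := by
  induction K with
  | zero =>
    intro h1 h2
    refine ⟨1, by simp, ?_⟩
    push_cast at h2 ⊢
    rw [abs_le]
    constructor <;> linarith
  | succ K ih =>
    intro h1 h2
    by_cases hc : t ≤ a + 2 * ((K : ℝ) + 1) * g + h
    · obtain ⟨k, hk, hk'⟩ := ih h1 hc
      refine ⟨k, ?_, hk'⟩
      rw [Finset.mem_Icc] at hk ⊢
      omega
    · push Not at hc
      refine ⟨K + 1 + 1, by simp, ?_⟩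
      push_cast at h2 ⊢
      rw [abs_le]
      constructor <;> linarith

theorem mp_aux_col (h s : ℝ) (hs : 0 ≤ s) (K : ℕ) :
    s ≤ ((K : ℝ) + 1) * h → ∃ j ≤ K, (j : ℝ) * h ≤ s ∧ s ≤ ((j : ℝ) + 1) * h := by
  induction K with
  | zero =>
    intro h2
    exact ⟨0, le_rfl, by simpa using hs, by simpa using h2⟩
  | succ K ih =>
    intro h2
    by_cases hc : s ≤ ((K : ℝ) + 1) * h
    · obtain ⟨j, hj, hj'⟩ := ih hc
      exact ⟨j, by omega, hj'⟩
    · push Not at hc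
      exact ⟨K + 1, le_rfl, by push_cast; linarith, h2⟩

theorem mp_aux_W (n m : ℕ) (hm : m ≤ n + 1) :
    Real.arccos (Real.cos (mpW n m)) = m * (π / ((n : ℝ) + 2)) := by
  have hp := Real.pi_pos
  have hm' : (m : ℝ) ≤ n + 1 := by exact_mod_cast hm
  have hn : (0 : ℝ) ≤ n := Nat.cast_nonneg n
  rw [Real.arccos_cos]
  · unfold mpW; ring
  · unfold mpW; positivity
  · unfold mpW
    rw [div_le_iff₀ (by positivity)]
    nlinarith

theorem mp_aux_Vodd (p m k : ℕ) (hm : Odd m) (hk : k ≤ p + 1) :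
    Real.arccos (Real.cos (mpV (p + p) m k)) =
      0 + 2 * (k : ℝ) * (π / (2 * (p : ℝ) + 3)) := by
  have hp := Real.pi_pos
  have hk' : (k : ℝ) ≤ p + 1 := by exact_mod_cast hk
  unfold mpV
  rw [if_pos hm]
  push_cast
  rw [Real.arccos_cos]
  · rw [two_mul (p : ℝ)]; ring
  · positivity
  · rw [div_le_iff₀ (by positivity)]
    nlinarith

theorem mp_aux_Veven (p m k : ℕ) (hm : ¬ Odd m) (hk1 : 1 ≤ k) (hk : k ≤ p + 1) :
    Real.arccos (Real.cos (mpV (p + p) m k)) =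
      -(π / (2 * (p : ℝ) + 3)) + 2 * (k : ℝ) * (π / (2 * (p : ℝ) + 3)) := by
  have hp := Real.pi_pos
  have hk' : (k : ℝ) ≤ p + 1 := by exact_mod_cast hk
  have hk1' : (1 : ℝ) ≤ k := by exact_mod_cast hk1
  unfold mpV
  rw [if_neg hm]
  push_cast
  rw [Real.arccos_cos]
  · rw [two_mul (p : ℝ)]; ring
  · apply div_nonneg
    · apply mul_nonneg <;> linarith
    · positivity
  · rw [div_le_iff₀ (by positivity)]
    nlinarith

/-- The covering radius of `A_ν = MP_ν ∪ {(1,1), (-1,1)}` with respect to the Dubiner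
distance `d_Q((x,y),(a,b)) = max(|arccos x - arccos a|, |arccos y - arccos b|)` on the
square `Q = [-1,1]²` equals `π/(ν+2)`. -/
theorem mp_aug_covering_radius (ν : ℕ) (hν : 0 < ν) (hne : Even ν) :
    sSup {r : ℝ | ∃ x ∈ Set.Icc (-1 : ℝ) 1, ∃ y ∈ Set.Icc (-1 : ℝ) 1,
        r = sInf {d : ℝ |
          (∃ m ∈ Finset.Icc 1 (ν + 1), ∃ k ∈ Finset.Icc 1 (ν / 2 + 1),
            d = max |Real.arccos x - Real.arccos (Real.cos (mpW ν m))|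
                    |Real.arccos y - Real.arccos (Real.cos (mpV ν m k))|) ∨
          d = max |Real.arccos x - Real.arccos 1| |Real.arccos y - Real.arccos 1| ∨
          d = max |Real.arccos x - Real.arccos (-1)| |Real.arccos y - Real.arccos 1|}} =
      π / ((ν : ℝ) + 2) := by
  obtain ⟨p, rfl⟩ := hne
  have hp2 : (p + p) / 2 = p := by omega
  rw [hp2]
  have hpi := Real.pi_pos
  obtain ⟨h, hh⟩ : ∃ h : ℝ, h = π / (((p + p : ℕ) : ℝ) + 2) := ⟨_, rfl⟩
  obtain ⟨g, hg⟩ : ∃ g : ℝ, g = π / (2 * (p : ℝ) + 3) := ⟨_, rfl⟩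
  have hW := fun m hm => mp_aux_W (p + p) m hm
  have hVo := fun m k hm hk => mp_aux_Vodd p m k hm hk
  have hVe := fun m k hm hk1 hk => mp_aux_Veven p m k hm hk1 hk
  rw [← hh] at hW ⊢
  rw [← hg] at hVo hVe
  have hpi1 : π = (2 * (p : ℝ) + 2) * h := by
    rw [hh]; push_cast; field_simp; ring
  have hpi2 : π = (2 * (p : ℝ) + 3) * g := by
    rw [hg]; field_simp
  have hp0 : (0 : ℝ) ≤ p := Nat.cast_nonneg p
  have hh0 : 0 < h := by rw [hh]; positivity
  have hg0 : 0 < g := by rw [hg]; positivity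
  have hgh : g ≤ h := by
    by_contra hc
    push Not at hc
    nlinarith
  have hhg : h ≤ 2 * g := by
    by_contra hc
    push Not at hc
    nlinarith
  have hhpi : h ≤ π := by nlinarith
  rw [Real.arccos_one, Real.arccos_neg_one]
  apply IsGreatest.csSup_eq
  constructor
  · refine ⟨1, by simp, -1, by simp, ?_⟩
    rw [Real.arccos_one, Real.arccos_neg_one]
    symm
    apply IsLeast.csInf_eq
    have hlow : ∀ m k : ℕ, m ∈ Finset.Icc 1 (p + p + 1) →
        h ≤ max |0 - Real.arccos (Real.cos (mpW (p + p) m))|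
          |π - Real.arccos (Real.cos (mpV (p + p) m k))| := by
      intro m k hm
      rw [Finset.mem_Icc] at hm
      apply le_max_of_le_left
      rw [hW m hm.2, zero_sub, abs_neg, abs_of_nonneg (by positivity)]
      have : (1 : ℝ) ≤ m := by exact_mod_cast hm.1
      nlinarith
    constructor
    · left
      refine ⟨1, by simp, p + 1, by simp, ?_⟩
      apply le_antisymm (hlow _ _ (by simp))
      rw [hW 1 (by omega), hVo 1 (p + 1) (by decide) le_rfl]
      push_cast
      apply max_le
      · rw [abs_le]; constructor <;> linarith
      · rw [abs_le]; constructor <;> linarith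
    · rintro d (⟨m, hm, k, hk, rfl⟩ | rfl | rfl)
      · exact hlow m k hm
      · apply le_max_of_le_right
        rw [sub_zero, abs_of_pos hpi]; exact hhpi
      · apply le_max_of_le_right
        rw [sub_zero, abs_of_pos hpi]; exact hhpi
  · rintro r ⟨x, -, y, -, rfl⟩
    have hs0 := Real.arccos_nonneg x
    have hs1 := Real.arccos_le_pi x
    have ht0 := Real.arccos_nonneg y
    have ht1 := Real.arccos_le_pi y
    generalize Real.arccos x = s at *
    generalize Real.arccos y = t at *
    have key : ∀ S : Set ℝ, (∀ d ∈ S, 0 ≤ d) → (∃ d ∈ S, d ≤ h) → sInf S ≤ h := by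
      rintro S h0 ⟨d, hd, hdh⟩
      exact (csInf_le ⟨0, h0⟩ hd).trans hdh
    apply key
    · rintro d (⟨m, hm, k, hk, rfl⟩ | rfl | rfl) <;> exact le_max_of_le_left (abs_nonneg _)
    have hodd : ∀ m : ℕ, Odd m → m ≤ p + p + 1 → |s - m * h| ≤ h → 2 * g - h ≤ t →
        ∃ k ∈ Finset.Icc 1 (p + 1), max |s - Real.arccos (Real.cos (mpW (p + p) m))|
          |t - Real.arccos (Real.cos (mpV (p + p) m k))| ≤ h := by
      intro m hm hm1 hs ht
      obtain ⟨k, hk, hk'⟩ := mp_aux_chain 0 g h t hgh p (by linarith) (by linarith)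
      refine ⟨k, hk, ?_⟩
      rw [hW m hm1, hVo m k hm (Finset.mem_Icc.1 hk).2]
      exact max_le hs hk'
    have heven : ∀ m : ℕ, ¬ Odd m → m ≤ p + p + 1 → |s - m * h| ≤ h → t < 2 * g - h →
        ∃ k ∈ Finset.Icc 1 (p + 1), max |s - Real.arccos (Real.cos (mpW (p + p) m))|
          |t - Real.arccos (Real.cos (mpV (p + p) m k))| ≤ h := by
      intro m hm hm1 hs ht
      obtain ⟨k, hk, hk'⟩ := mp_aux_chain (-g) g h t hgh p (by linarith) (by nlinarith)
      refine ⟨k, hk, ?_⟩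
      rw [hW m hm1, hVe m k hm (Finset.mem_Icc.1 hk).1 (Finset.mem_Icc.1 hk).2]
      exact max_le hs hk'
    obtain ⟨j, hj, hj1, hj2⟩ := mp_aux_col h s hs0 (p + p + 1) (by push_cast; linarith)
    have hA : |s - (j : ℝ) * h| ≤ h := by rw [abs_le]; constructor <;> linarith
    have hB : |s - ((j + 1 : ℕ) : ℝ) * h| ≤ h := by
      push_cast; rw [abs_le]; constructor <;> linarith
    rcases le_or_gt (2 * g - h) t with ht | ht
    · obtain ⟨m, hm, hm1, hms⟩ : ∃ m : ℕ, Odd m ∧ m ≤ p + p + 1 ∧ |s - m * h| ≤ h := by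
        by_cases ho : Odd j
        · exact ⟨j, ho, hj, hA⟩
        · refine ⟨j + 1, ?_, ?_, hB⟩
          · rw [Nat.not_odd_iff_even] at ho; exact ho.add_one
          · rw [Nat.not_odd_iff_even] at ho
            obtain ⟨q, rfl⟩ := ho
            omega
      obtain ⟨k, hk, hk'⟩ := hodd m hm hm1 hms ht
      exact ⟨_, Or.inl ⟨m, Finset.mem_Icc.2 ⟨hm.pos, hm1⟩, k, hk, rfl⟩, hk'⟩
    · have ht' : |t - 0| ≤ h := by rw [abs_le]; constructor <;> linarith
      by_cases hj0 : j = 0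
      · subst hj0
        refine ⟨_, Or.inr (Or.inl rfl), max_le ?_ ht'⟩
        simpa using hA
      by_cases hjl : j = p + p + 1
      · refine ⟨_, Or.inr (Or.inr rfl), max_le ?_ ht'⟩
        have : π = ((j + 1 : ℕ) : ℝ) * h := by rw [hpi1, hjl]; push_cast; ring
        rw [this]; exact hB
      obtain ⟨m, hm, hm0, hm1, hms⟩ :
          ∃ m : ℕ, ¬ Odd m ∧ 1 ≤ m ∧ m ≤ p + p + 1 ∧ |s - m * h| ≤ h := by
        by_cases ho : Odd j
        · refine ⟨j + 1, ?_, by omega, by omega, hB⟩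
          rw [Nat.not_odd_iff_even]; exact ho.add_one
        · exact ⟨j, ho, by omega, hj, hA⟩
      obtain ⟨k, hk, hk'⟩ := heven m hm hm1 hms ht
      exact ⟨_, Or.inl ⟨m, Finset.mem_Icc.2 ⟨hm0, hm1⟩, k, hk, rfl⟩, hk'⟩
end

section
/- Let n be a positive integer, μ > 2 a real number, and ν an even positive integer with ν ≥ 2μn. Then for every real bivariate polynomial p of total degree at most n, max_{(x,y) ∈ [-1,1]²} |p(x,y)| ≤ (1/cos(π/μ)) · max over the Morrow–Patterson points (a,b) ∈ MP_ν of |p(a,b)|. In particular, the Morrow–Patterson points form an optimal admissible polynomial mesh on the square. -/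
open Real Finset

/-- the modified exponential, periodic on `[-π, π]` -/
noncomputable def gfun (t : ℝ) (x : ℝ) : ℂ :=
  Complex.exp (Complex.I * x * t) - Complex.I * x * (Real.sin (π * t) / π : ℝ)

/-- its Fourier coefficients -/
noncomputable def acoef (t : ℝ) (k : ℤ) : ℂ :=
  (1 / (2 * π) : ℝ) • ∫ x in (-π)..π, Complex.exp (-(Complex.I * k * x)) * gfun t x

lemma gfun_per (t : ℝ) : gfun t (-π) = gfun t π := by
  have hpi : (π : ℂ) ≠ 0 := by exact_mod_cast Real.pi_ne_zero
  unfold gfun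
  have h1 : Complex.exp (Complex.I * (π : ℝ) * t)
      = Complex.cos (π * t) + Complex.sin (π * t) * Complex.I := by
    rw [← Complex.exp_mul_I]; congr 1; ring
  have h2 : Complex.exp (Complex.I * ((-π : ℝ) : ℂ) * t)
      = Complex.cos (π * t) - Complex.sin (π * t) * Complex.I := by
    rw [show Complex.I * ((-π : ℝ) : ℂ) * t = (-(π * t)) * Complex.I by push_cast; ring,
      Complex.exp_mul_I]
    simp; ring
  rw [h1, h2]
  push_cast
  field_simp
  ring

lemma gfun_cont (t : ℝ) : Continuous (gfun t) := by
  unfold gfun; fun_prop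

lemma exp_kpi (k : ℤ) : Complex.exp (-(Complex.I * k * (π : ℝ))) = (-1) ^ k := by
  rw [show -(Complex.I * k * ((π : ℝ) : ℂ)) = ((-k : ℤ) : ℂ) * (π * Complex.I) by push_cast; ring,
    Complex.exp_int_mul, Complex.exp_pi_mul_I]
  simp [zpow_neg, ← inv_zpow]

lemma exp_kpi' (k : ℤ) : Complex.exp (-(Complex.I * k * ((-π : ℝ) : ℂ))) = (-1) ^ k := by
  rw [show -(Complex.I * k * ((-π : ℝ) : ℂ)) = ((k : ℤ) : ℂ) * (π * Complex.I) by push_cast; ring,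
    Complex.exp_int_mul, Complex.exp_pi_mul_I]

lemma acoef_eq (t : ℝ) (k : ℤ) (hk : k ≠ 0) (ht : t - k ≠ 0) :
    acoef t k = (((-1 : ℝ) ^ k * (Real.sin (π * t) / π) * (1 / (t - k) + 1 / k) : ℝ) : ℂ) := by
  have hpi : (π : ℂ) ≠ 0 := by exact_mod_cast Real.pi_ne_zero
  have hk' : (k : ℂ) ≠ 0 := by exact_mod_cast hk
  have ht' : (t : ℂ) - k ≠ 0 := by exact_mod_cast ht
  set c : ℂ := ((Real.sin (π * t) / π : ℝ) : ℂ) with hc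
  let H : ℝ → ℂ := fun x => Complex.exp (Complex.I * (t - k) * x) / (Complex.I * (t - k))
    - Complex.I * c * (x * Complex.exp (-(Complex.I * k * x)) / (-(Complex.I * k))
      + Complex.exp (-(Complex.I * k * x)) / k ^ 2)
  have hd : ∀ x : ℝ, HasDerivAt H (Complex.exp (-(Complex.I * k * x)) * gfun t x) x := by
    intro x
    have hx : HasDerivAt (fun y : ℝ => (y : ℂ)) 1 x := Complex.ofRealCLM.hasDerivAt
    have e1 := (hx.const_mul (Complex.I * (t - k))).cexp
    have e2 := ((hx.const_mul (Complex.I * k)).neg).cexp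
    have := (e1.div_const (Complex.I * (t - k))).sub
      ((((hx.mul e2).div_const (-(Complex.I * k))).add (e2.div_const ((k : ℂ) ^ 2))).const_mul
        (Complex.I * c))
    convert! this using 1
    have : Complex.exp (Complex.I * (t - k) * x)
      = Complex.exp (-(Complex.I * k * x)) * Complex.exp (Complex.I * x * t) := by
      rw [← Complex.exp_add]; congr 1; ring
    rw [this]
    unfold gfun
    rw [← hc]
    simp only [Pi.neg_apply]
    field_simp
    ring_nf
    simp only [Complex.I_sq]
    ring
  have hint : ∫ x in (-π)..π, Complex.exp (-(Complex.I * k * x)) * gfun t x = H π - H (-π) := by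
    apply intervalIntegral.integral_eq_sub_of_hasDerivAt (fun x _ => hd x)
    apply Continuous.intervalIntegrable
    have := gfun_cont t
    fun_prop
  rw [acoef, hint]
  simp only [H]
  rw [exp_kpi, exp_kpi']
  have h1 : Complex.exp (Complex.I * (t - k) * (π : ℝ))
      = (-1) ^ k * (Complex.cos (π * t) + Complex.sin (π * t) * Complex.I) := by
    rw [← exp_kpi, ← Complex.exp_mul_I, ← Complex.exp_add]; congr 1; ring
  have h2 : Complex.exp (Complex.I * (t - k) * ((-π : ℝ) : ℂ))
      = (-1) ^ k * (Complex.cos (π * t) - Complex.sin (π * t) * Complex.I) := by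
    rw [← exp_kpi', show Complex.cos (π * t) - Complex.sin (π * t) * Complex.I
      = Complex.cos (-(π * t)) + Complex.sin (-(π * t)) * Complex.I by simp; ring,
      ← Complex.exp_mul_I, ← Complex.exp_add]; congr 1; push_cast; ring
  rw [h1, h2, hc, Complex.real_smul]
  push_cast
  generalize ((-1 : ℂ) ^ k) = e
  field_simp
  ring_nf
  try simp only [Complex.I_sq]
  try ring

lemma acoef_summable (t : ℝ) (h0 : 0 < t) (h1 : t ≤ 1 / 2) : Summable (acoef t) := by
  have hs : Summable (fun k : ℤ => (2 * |t|) * (1 / (k : ℝ) ^ 2)) :=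
    (Real.summable_one_div_int_pow.mpr (by norm_num)).mul_left _
  have hs' : Summable (fun k : ℤ => if k = 0 then ‖acoef t 0‖ else (2 * |t|) * (1 / (k : ℝ) ^ 2)) := by
    refine (hs.update 0 ‖acoef t 0‖).congr ?_
    intro k
    simp [Function.update_apply]
  refine Summable.of_norm_bounded hs' ?_
  intro k
  split_ifs with hk
  · rw [hk]
  · have hkabs : (1 : ℝ) ≤ |(k : ℝ)| := by exact_mod_cast Int.one_le_abs hk
    have htk : |(k : ℝ)| / 2 ≤ |t - k| := by
      have := abs_sub_abs_le_abs_sub (k : ℝ) t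
      rw [abs_sub_comm, abs_of_pos h0] at this
      linarith
    have htk0 : 0 < |t - k| := by linarith
    have hk0 : (k : ℝ) ≠ 0 := by exact_mod_cast hk
    rw [acoef_eq t k hk (abs_pos.mp htk0), Complex.norm_real, Real.norm_eq_abs]
    have : (1 / (t - k) + 1 / k) = t / ((t - k) * k) := by
      have := abs_pos.mp htk0
      field_simp; ring
    rw [this, abs_mul, abs_mul, abs_zpow, abs_neg, abs_one, one_zpow, one_mul, abs_div, abs_div t,
      abs_mul, abs_of_pos Real.pi_pos]
    have hsn : |Real.sin (π * t)| / π ≤ 1 := by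
      rw [div_le_one Real.pi_pos]
      have := Real.abs_sin_le_one (π * t)
      have := Real.pi_gt_three
      linarith
    have hb : |t| / (|t - k| * |(k : ℝ)|) ≤ 2 * |t| * (1 / (k : ℝ) ^ 2) := by
      rw [← sq_abs (k : ℝ), mul_one_div, div_le_div_iff₀ (by positivity) (by positivity)]
      have := mul_le_mul_of_nonneg_right htk (by positivity : 0 ≤ 2 * |t| * |(k : ℝ)|)
      nlinarith
    calc _ ≤ 1 * (|t| / (|t - k| * |(k : ℝ)|)) := by gcongr
      _ ≤ _ := by rw [one_mul]; exact hb

lemma gfun_hasSum (t : ℝ) (h0 : 0 < t) (h1 : t ≤ 1 / 2) (x : ℝ) (hx : x ∈ Set.Icc (-π) π) :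
    HasSum (fun k : ℤ => acoef t k * Complex.exp (Complex.I * x * (k : ℝ))) (gfun t x) := by
  have hT : Fact (0 < 2 * π) := ⟨by positivity⟩
  have hend : -π + 2 * π = π := by ring
  have hper : gfun t (-π) = gfun t (-π + 2 * π) := by rw [hend]; exact gfun_per t
  let G : C(AddCircle (2 * π), ℂ) :=
    ⟨AddCircle.liftIco (2 * π) (-π) (gfun t),
      AddCircle.liftIco_continuous hper (gfun_cont t).continuousOn⟩
  have hG : ∀ y ∈ Set.Icc (-π) π, G (y : AddCircle (2 * π)) = gfun t y := by
    intro y hy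
    change AddCircle.liftIco (2 * π) (-π) (gfun t) y = gfun t y
    by_cases h : y = -π
    · apply AddCircle.liftIco_coe_apply
      rw [hend, h]; constructor <;> linarith [Real.pi_pos]
    · rw [← AddCircle.liftIoc_eq_liftIco hper]
      apply AddCircle.liftIoc_coe_apply
      rw [hend]; exact ⟨lt_of_le_of_ne hy.1 (Ne.symm h), hy.2⟩
  have hf : ∀ (k : ℤ) (y : ℝ), fourier k (y : AddCircle (2 * π))
      = Complex.exp (Complex.I * y * (k : ℝ)) := by
    intro k y
    have hpi : (π : ℂ) ≠ 0 := by exact_mod_cast Real.pi_ne_zero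
    rw [fourier_coe_apply]; congr 1; push_cast; field_simp
  have hc : ∀ k, fourierCoeff G k = acoef t k := by
    intro k
    rw [fourierCoeff_eq_intervalIntegral _ _ (-π), hend, acoef]
    congr 1
    apply intervalIntegral.integral_congr
    intro y hy
    rw [Set.uIcc_of_le (by linarith [Real.pi_pos])] at hy
    simp only [hf, hG y hy, smul_eq_mul]
    congr 2; push_cast; ring
  have hs : Summable (fourierCoeff G) := (acoef_summable t h0 h1).congr (fun k => (hc k).symm)
  have := has_pointwise_sum_fourier_series_of_summable hs (x : AddCircle (2 * π))
  rw [hG x hx] at this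
  simpa only [hc, hf, smul_eq_mul] using this

/-- exponential sums with real frequencies bounded by `σ` -/
def expSum (σ : ℝ) : Submodule ℂ (ℝ → ℂ) :=
  Submodule.span ℂ {f | ∃ l : ℝ, |l| ≤ σ ∧ f = fun x : ℝ => Complex.exp (Complex.I * l * x)}

lemma expSum_mono {a b : ℝ} (h : a ≤ b) : expSum a ≤ expSum b := by
  apply Submodule.span_mono
  rintro f ⟨l, hl, rfl⟩
  exact ⟨l, hl.trans h, rfl⟩

lemma expSum_mul {a b : ℝ} {f g : ℝ → ℂ} (hf : f ∈ expSum a) (hg : g ∈ expSum b) :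
    f * g ∈ expSum (a + b) := by
  have h := Submodule.mul_mem_mul hf hg
  unfold expSum at h
  rw [Submodule.span_mul_span] at h
  refine Submodule.span_mono ?_ h
  rintro _ ⟨_, ⟨l, hl, rfl⟩, _, ⟨m, hm, rfl⟩, rfl⟩
  refine ⟨l + m, (abs_add_le _ _).trans (add_le_add hl hm), ?_⟩
  funext x
  simp only [Pi.mul_apply]
  rw [← Complex.exp_add]
  congr 1
  push_cast
  ring

lemma expSum_one : (1 : ℝ → ℂ) ∈ expSum 0 := by
  apply Submodule.subset_span
  refine ⟨0, by simp, ?_⟩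
  funext x
  simp

lemma expSum_pow {a : ℝ} {f : ℝ → ℂ} (hf : f ∈ expSum a) (k : ℕ) : f ^ k ∈ expSum (k * a) := by
  induction k with
  | zero => simpa using expSum_one
  | succ k ih =>
    rw [pow_succ]
    have := expSum_mul ih hf
    convert this using 2
    push_cast
    ring

lemma expSum_cos (α a : ℝ) : (fun x : ℝ => ((Real.cos (α + a * x) : ℝ) : ℂ)) ∈ expSum |a| := by
  have h1 : (fun x : ℝ => Complex.exp (Complex.I * a * x)) ∈ expSum |a| :=
    Submodule.subset_span ⟨a, le_rfl, rfl⟩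
  have h2 : (fun x : ℝ => Complex.exp (Complex.I * (-a : ℝ) * x)) ∈ expSum |a| :=
    Submodule.subset_span ⟨-a, by simp, rfl⟩
  have := (expSum |a|).add_mem ((expSum |a|).smul_mem (Complex.exp (Complex.I * α) / 2) h1)
    ((expSum |a|).smul_mem (Complex.exp (-(Complex.I * α)) / 2) h2)
  convert this using 1
  funext x
  simp only [Pi.add_apply, Pi.smul_apply, smul_eq_mul]
  rw [div_mul_eq_mul_div, div_mul_eq_mul_div, ← Complex.exp_add, ← Complex.exp_add,
    Complex.ofReal_cos, Complex.cos, add_div]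
  push_cast
  congr 3 <;> ring

lemma expSum_hasSum (t : ℝ) (h0 : 0 < t) (h1 : t ≤ 1 / 2) (f : ℝ → ℂ) (hf : f ∈ expSum π) :
    ∃ f' : ℂ, HasDerivAt f f' 0 ∧ HasSum (fun k : ℤ => acoef t k * f k)
      (f t - f' * (Real.sin (π * t) / π : ℝ)) := by
  unfold expSum at hf
  induction hf using Submodule.span_induction with
  | mem f hf =>
    obtain ⟨l, hl, rfl⟩ := hf
    refine ⟨Complex.I * l, ?_, ?_⟩
    · have hx : HasDerivAt (fun y : ℝ => (y : ℂ)) 1 0 := Complex.ofRealCLM.hasDerivAt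
      simpa using (hx.const_mul (Complex.I * l)).cexp
    · have := gfun_hasSum t h0 h1 l (abs_le.mp hl)
      simpa only [gfun] using this
  | zero => exact ⟨0, hasDerivAt_const _ _, by simp⟩
  | add f g _ _ hf hg =>
    obtain ⟨f', hf', hfs⟩ := hf
    obtain ⟨g', hg', hgs⟩ := hg
    refine ⟨f' + g', hf'.add hg', ?_⟩
    convert hfs.add hgs using 1
    · funext k; simp only [Pi.add_apply]; ring
    · simp only [Pi.add_apply]; ring
  | smul c f _ hf =>
    obtain ⟨f', hf', hfs⟩ := hf
    refine ⟨c * f', by simpa using! hf'.const_mul c, ?_⟩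
    convert! hfs.mul_left c using 1
    · funext k; simp only [Pi.smul_apply, smul_eq_mul]; ring
    · simp only [Pi.smul_apply, smul_eq_mul]; ring

lemma expSum_real (t : ℝ) (h0 : 0 < t) (h1 : t ≤ 1 / 2) (F : ℝ → ℝ) (M : ℝ)
    (hF : (fun x => (F x : ℂ)) ∈ expSum π) (hM : ∀ x, |F x| ≤ M) (hF0 : F 0 = M) :
    HasSum (fun k : ℤ => (acoef t k * (F k : ℂ)).re) (F t) := by
  obtain ⟨f', hd, hs⟩ := expSum_hasSum t h0 h1 _ hF
  have hre : HasDerivAt F f'.re 0 := by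
    have := Complex.reCLM.hasFDerivAt.comp_hasDerivAt (0 : ℝ) hd
    simpa [Function.comp_def] using! this
  have hz : f'.re = 0 := by
    refine IsLocalMax.hasDerivAt_eq_zero (f := F) (a := 0) ?_ hre
    refine Filter.Eventually.of_forall (fun x => ?_)
    rw [hF0]
    exact (abs_le.mp (hM x)).2
  have := Complex.hasSum_re hs
  rw [Complex.sub_re, Complex.re_mul_ofReal, hz] at this
  simpa using this

lemma key (t : ℝ) (h0 : 0 < t) (h1 : t ≤ 1 / 2) (F : ℝ → ℝ) (M : ℝ)
    (hF : (fun x => (F x : ℂ)) ∈ expSum π) (hM : ∀ x, |F x| ≤ M) (hF0 : F 0 = M) :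
    M * Real.cos (π * t) ≤ F t := by
  have hM0 : 0 ≤ M := (abs_nonneg _).trans (hM 0)
  have s1 := expSum_real t h0 h1 F M hF hM hF0
  have hc : (fun x : ℝ => ((M * Real.cos (π * x) : ℝ) : ℂ)) ∈ expSum π := by
    have := (expSum |π|).smul_mem (M : ℂ) (expSum_cos 0 π)
    rw [abs_of_pos Real.pi_pos] at this
    convert this using 1
    funext x
    simp
  have s2 := expSum_real t h0 h1 (fun x => M * Real.cos (π * x)) M hc (by
    intro x
    rw [abs_mul, abs_of_nonneg hM0]
    exact mul_le_of_le_one_right hM0 (Real.abs_cos_le_one _)) (by simp)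
  refine hasSum_le ?_ s2 s1
  intro k
  by_cases hk : k = 0
  · subst hk; simp [hF0]
  have hcos : Real.cos (π * k) = (-1) ^ k := by
    rw [mul_comm]; exact Real.cos_int_mul_pi k
  have hk0 : (k : ℝ) ≠ 0 := by exact_mod_cast hk
  have hneg : (t - k) * k < 0 := by
    rcases lt_or_gt_of_ne hk with h | h
    · have : (k : ℝ) < 0 := by exact_mod_cast h
      nlinarith
    · have : (1 : ℝ) ≤ k := by exact_mod_cast h
      nlinarith
  have htk : t - k ≠ 0 := by
    intro h; rw [h] at hneg; simp at hneg
  rw [acoef_eq t k hk htk]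
  rw [← Complex.ofReal_mul, ← Complex.ofReal_mul, Complex.ofReal_re, Complex.ofReal_re, hcos]
  have e : (1 / (t - k) + 1 / k) = t / ((t - k) * k) := by
    field_simp; ring
  have hq : t / ((t - k) * k) ≤ 0 := div_nonpos_of_nonneg_of_nonpos h0.le hneg.le
  have hsn : 0 ≤ Real.sin (π * t) / π := by
    apply div_nonneg _ Real.pi_pos.le
    apply Real.sin_nonneg_of_nonneg_of_le_pi
    · have := Real.pi_pos; positivity
    · nlinarith [Real.pi_pos]
  have hprod : Real.sin (π * t) / π * (t / ((t - k) * k)) ≤ 0 := mul_nonpos_of_nonneg_of_nonpos hsn hq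
  rw [e]
  obtain ⟨hl, hu⟩ := abs_le.mp (hM k)
  have hsq : ((-1 : ℝ) ^ k = 1) ∨ ((-1 : ℝ) ^ k = -1) := by
    rcases Int.even_or_odd k with h | h
    · exact Or.inl h.neg_one_zpow
    · exact Or.inr h.neg_one_zpow
  rcases hsq with h | h <;> rw [h] <;> nlinarith

lemma grid (a h : ℝ) (K : ℕ) (x : ℝ) (h0 : a ≤ x) (h1 : x ≤ a + (K + 2) * h) :
    ∃ k ∈ Finset.Icc 1 (K + 1), |a + k * h - x| ≤ h := by
  induction K with
  | zero =>
    refine ⟨1, by simp, ?_⟩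
    rw [abs_le]; push_cast at *
    constructor <;> linarith
  | succ K ih =>
    by_cases hx : x ≤ a + (K + 2) * h
    · obtain ⟨k, hk, hk'⟩ := ih hx
      rw [Finset.mem_Icc] at hk
      exact ⟨k, by rw [Finset.mem_Icc]; omega, hk'⟩
    · refine ⟨K + 2, by simp, ?_⟩
      push_cast at *
      rw [abs_le]; constructor <;> linarith

lemma mp_near_s10 (ν : ℕ) (hne : Even ν) (hν : 0 < ν) (θ φ : ℝ) (hθ : θ ∈ Set.Icc 0 π)
    (hφ : φ ∈ Set.Icc 0 π) : ∃ q ∈ Finset.Icc 1 (ν + 1) ×ˢ Finset.Icc 1 (ν / 2 + 1),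
      |mpW ν q.1 - θ| ≤ 2 * π / ν ∧ |mpV ν q.1 q.2 - φ| ≤ 2 * π / ν := by
  have hpi := Real.pi_pos
  have hν' : (0 : ℝ) < ν := by exact_mod_cast hν
  obtain ⟨r, hr⟩ := hne
  have hr2 : ν / 2 = r := by omega
  have hrr : (ν : ℝ) = r + r := by exact_mod_cast hr
  obtain ⟨m, hm, hm'⟩ := grid 0 (π / (ν + 2)) ν θ hθ.1 (by
    rw [mul_div_cancel₀ _ (by positivity)]; simpa using hθ.2)
  have b1 : π / (ν + 2) ≤ 2 * π / ν := by
    rw [div_le_div_iff₀ (by positivity) (by positivity)]; nlinarith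
  have b2 : 2 * π / (ν + 3) ≤ 2 * π / ν := by
    gcongr; linarith
  by_cases ho : Odd m
  · obtain ⟨k, hk, hk'⟩ := grid 0 (2 * π / (ν + 3)) r φ hφ.1 (by
      refine hφ.2.trans ?_
      rw [zero_add, mul_div_assoc', le_div_iff₀ (by positivity), hrr]
      nlinarith)
    refine ⟨(m, k), by simp only [Finset.mem_product, hr2]; exact ⟨hm, hk⟩, ?_, ?_⟩
    · refine le_trans (le_of_eq ?_) (hm'.trans b1)
      simp only [mpW]; congr 1; ring
    · refine le_trans (le_of_eq ?_) (hk'.trans b2)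
      simp only [mpV, if_pos ho]; congr 1; ring
  · obtain ⟨k, hk, hk'⟩ := grid (-(π / (ν + 3))) (2 * π / (ν + 3)) r φ (by
      have : 0 < π / ((ν : ℝ) + 3) := by positivity
      linarith [hφ.1]) (by
      refine hφ.2.trans (le_of_eq ?_)
      rw [hrr]
      field_simp
      ring)
    refine ⟨(m, k), by simp only [Finset.mem_product, hr2]; exact ⟨hm, hk⟩, ?_, ?_⟩
    · refine le_trans (le_of_eq ?_) (hm'.trans b1)
      simp only [mpW]; congr 1; ring
    · refine le_trans (le_of_eq ?_) (hk'.trans b2)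
      simp only [mpV, if_neg ho]; congr 1; ring

lemma line_mem (n : ℕ) (hn : 0 < n) (p : MvPolynomial (Fin 2) ℝ) (hp : p.totalDegree ≤ n)
    (α β a b : ℝ) (ha : |a| ≤ π / n) (hb : |b| ≤ π / n) :
    (fun x : ℝ => ((MvPolynomial.eval ![Real.cos (α + a * x), Real.cos (β + b * x)] p : ℝ) : ℂ))
      ∈ expSum π := by
  have hn' : (0 : ℝ) < n := by exact_mod_cast hn
  have : (fun x : ℝ =>
      ((MvPolynomial.eval ![Real.cos (α + a * x), Real.cos (β + b * x)] p : ℝ) : ℂ))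
      = ∑ d ∈ p.support, ((p.coeff d : ℝ) : ℂ) • ((fun x : ℝ => ((Real.cos (α + a * x) : ℝ) : ℂ)) ^ (d 0)
        * (fun x : ℝ => ((Real.cos (β + b * x) : ℝ) : ℂ)) ^ (d 1)) := by
    funext x
    rw [MvPolynomial.eval_eq', Finset.sum_apply]
    push_cast
    refine Finset.sum_congr rfl (fun d _ => ?_)
    simp [Fin.prod_univ_two]
  rw [this]
  refine Submodule.sum_mem _ (fun d hd => Submodule.smul_mem _ _ ?_)
  refine expSum_mono ?_ (expSum_mul (expSum_pow (expSum_cos α a) _) (expSum_pow (expSum_cos β b) _))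
  have h := (MvPolynomial.le_totalDegree hd).trans hp
  rw [Finsupp.sum_fintype _ _ (by simp), Fin.sum_univ_two] at h
  have h' : (d 0 : ℝ) + d 1 ≤ n := by exact_mod_cast h
  calc (d 0 : ℝ) * |a| + d 1 * |b| ≤ d 0 * (π / n) + d 1 * (π / n) := by gcongr
    _ = (d 0 + d 1) * (π / n) := by ring
    _ ≤ n * (π / n) := by have := Real.pi_pos; gcongr
    _ = π := by field_simp

/-- The Morrow–Patterson points form an optimal admissible polynomial mesh: for a
positive integer `n`, a real `μ > 2`, and an even positive integer `ν ≥ 2μn`, every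
real bivariate polynomial `p` of total degree at most `n` satisfies
`max_{Q} |p| ≤ (1/cos(π/μ)) · max_{MP_ν} |p|`. -/
theorem mp_admissible_mesh (n : ℕ) (hn : 0 < n) (μ : ℝ) (hμ : 2 < μ)
    (ν : ℕ) (hν : 0 < ν) (hne : Even ν) (hge : 2 * μ * n ≤ (ν : ℝ))
    (p : MvPolynomial (Fin 2) ℝ) (hp : p.totalDegree ≤ n) :
    ∀ x ∈ Set.Icc (-1 : ℝ) 1, ∀ y ∈ Set.Icc (-1 : ℝ) 1,
      |MvPolynomial.eval ![x, y] p| ≤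
        (1 / Real.cos (π / μ)) *
          ((Finset.Icc 1 (ν + 1) ×ˢ Finset.Icc 1 (ν / 2 + 1)).sup'
            (by
              refine ⟨(1, 1), ?_⟩
              simp [Finset.mem_product])
            fun q => |MvPolynomial.eval
              ![Real.cos (mpW ν q.1), Real.cos (mpV ν q.1 q.2)] p|) := by
  classical
  have hpi := Real.pi_pos
  have hn' : (0 : ℝ) < n := by exact_mod_cast hn
  have hν' : (0 : ℝ) < ν := by exact_mod_cast hν
  have hμ0 : 0 < μ := by linarith
  let P : ℝ × ℝ → ℝ := fun z => MvPolynomial.eval ![z.1, z.2] p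
  have hcont : Continuous P := by
    refine (MvPolynomial.continuous_eval p).comp ?_
    refine continuous_pi (fun i => ?_)
    fin_cases i
    · exact continuous_fst
    · exact continuous_snd
  obtain ⟨⟨X, Y⟩, hXY, hmax⟩ := (isCompact_Icc.prod isCompact_Icc :
    IsCompact (Set.Icc (-1 : ℝ) 1 ×ˢ Set.Icc (-1 : ℝ) 1)).exists_isMaxOn
    ⟨(0, 0), by simp⟩ hcont.abs.continuousOn
  have hmax' : ∀ u ∈ Set.Icc (-1 : ℝ) 1, ∀ v ∈ Set.Icc (-1 : ℝ) 1,
      |MvPolynomial.eval ![u, v] p| ≤ |MvPolynomial.eval ![X, Y] p| := by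
    intro u hu v hv
    exact hmax (a := (u, v)) ⟨hu, hv⟩
  set M := |MvPolynomial.eval ![X, Y] p| with hMdef
  obtain ⟨hX, hY⟩ := hXY
  simp only at hX hY
  obtain ⟨q, hq, hq1, hq2⟩ := mp_near_s10 ν hne hν (Real.arccos X) (Real.arccos Y)
    ⟨Real.arccos_nonneg _, Real.arccos_le_pi _⟩ ⟨Real.arccos_nonneg _, Real.arccos_le_pi _⟩
  set θ := Real.arccos X with hθ
  set φ := Real.arccos Y with hφ
  have hcθ : Real.cos θ = X := Real.cos_arccos hX.1 hX.2
  have hcφ : Real.cos φ = Y := Real.cos_arccos hY.1 hY.2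
  have hb : 2 * π / ν * μ ≤ π / n := by
    rw [div_mul_eq_mul_div, div_le_div_iff₀ hν' hn']
    nlinarith
  have hb' : ∀ d : ℝ, |d| ≤ 2 * π / ν → |d * μ| ≤ π / n := by
    intro d hd
    rw [abs_mul, abs_of_pos hμ0]
    exact (mul_le_mul_of_nonneg_right hd hμ0.le).trans hb
  obtain ⟨ε, hε, hεM⟩ : ∃ ε : ℝ, |ε| = 1 ∧ ε * MvPolynomial.eval ![X, Y] p = M := by
    rcases abs_choice (MvPolynomial.eval ![X, Y] p) with h | h
    · exact ⟨1, by simp, by rw [hMdef, h, one_mul]⟩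
    · exact ⟨-1, by simp, by rw [hMdef, h]; ring⟩
  set a := (mpW ν q.1 - θ) * μ with ha
  set b := (mpV ν q.1 q.2 - φ) * μ with hbd
  have hk := key (1 / μ) (by positivity)
    (by rw [div_le_div_iff₀ hμ0 two_pos]; linarith)
    (fun x => ε * MvPolynomial.eval ![Real.cos (θ + a * x), Real.cos (φ + b * x)] p) M
    (by
      have := (expSum π).smul_mem (ε : ℂ)
        (line_mem n hn p hp θ φ a b (hb' _ hq1) (hb' _ hq2))
      convert this using 1
      funext x
      simp)
    (by
      intro x
      rw [abs_mul, hε, one_mul]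
      exact hmax' _ (Real.cos_mem_Icc _) _ (Real.cos_mem_Icc _))
    (by simp [hcθ, hcφ, hεM])
  have e1 : θ + a * (1 / μ) = mpW ν q.1 := by rw [ha]; field_simp; ring
  have e2 : φ + b * (1 / μ) = mpV ν q.1 q.2 := by rw [hbd]; field_simp; ring
  simp only [e1, e2] at hk
  rw [mul_one_div] at hk
  have hcos : 0 < Real.cos (π / μ) := by
    apply Real.cos_pos_of_mem_Ioo
    constructor
    · have : 0 < π / μ := by positivity
      linarith
    · rw [div_lt_div_iff₀ hμ0 two_pos]; nlinarith
  intro x hx y hy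
  refine (hmax' x hx y hy).trans ?_
  rw [one_div, ← div_eq_inv_mul, le_div_iff₀ hcos]
  refine hk.trans ((le_abs_self _).trans ?_)
  rw [abs_mul, hε, one_mul]
  exact Finset.le_sup' (fun q : ℕ × ℕ => |MvPolynomial.eval
              ![Real.cos (mpW ν q.1), Real.cos (mpV ν q.1 q.2)] p|) hq
end

section
/- For every natural number l and all real numbers α, β with sin((α−β)/2) ≠ 0, sin((α+β)/2) ≠ 0 and sin β ≠ 0: (sin α / sin β) · Σ_{i=0}^{l} sin((i+1)α)·sin((i+1)β) = (cos(α/2)cos(β/2)/(2 sin β))·( sin((2l+3)(α−β)/2) − sin((2l+3)(α+β)/2) ) + (cos(α/2)/(4 cos(β/2)))·( (cos((α−β)/2)/sin((α−β)/2))·sin((2l+3)(α−β)/2) + (cos((α+β)/2)/sin((α+β)/2))·sin((2l+3)(α+β)/2) ). -/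
open Real Finset

lemma aux_step (k x : ℝ) (h : Real.sin (x / 2) ≠ 0) :
    Real.cos ((k + 1) * x) =
      (Real.sin ((2 * (k + 1) + 1) * x / 2) - Real.sin ((2 * k + 1) * x / 2)) /
        (2 * Real.sin (x / 2)) := by
  rw [show (2 * (k + 1) + 1) * x / 2 = (k + 1) * x + x / 2 by ring,
    show (2 * k + 1) * x / 2 = (k + 1) * x - x / 2 by ring, Real.sin_add, Real.sin_sub]
  field_simp
  ring

lemma aux_sum (n : ℕ) (α β : ℝ)
    (h₁ : Real.sin ((α - β) / 2) ≠ 0) (h₂ : Real.sin ((α + β) / 2) ≠ 0) :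
    ∑ i ∈ Finset.range n,
          Real.sin (((i : ℝ) + 1) * α) * Real.sin (((i : ℝ) + 1) * β) =
      Real.sin ((2 * (n : ℝ) + 1) * (α - β) / 2) / (4 * Real.sin ((α - β) / 2)) -
      Real.sin ((2 * (n : ℝ) + 1) * (α + β) / 2) / (4 * Real.sin ((α + β) / 2)) := by
  induction n with
  | zero =>
    simp only [Finset.range_zero, Finset.sum_empty, Nat.cast_zero, mul_zero, zero_add, one_mul]
    field_simp
    ring
  | succ n ih =>
    rw [Finset.sum_range_succ, ih]
    have e : Real.sin (((n : ℝ) + 1) * α) * Real.sin (((n : ℝ) + 1) * β) =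
        (Real.cos (((n : ℝ) + 1) * (α - β)) - Real.cos (((n : ℝ) + 1) * (α + β))) / 2 := by
      rw [mul_sub, mul_add, Real.cos_sub, Real.cos_add]
      ring
    rw [e, aux_step _ _ h₁, aux_step _ _ h₂]
    push_cast
    field_simp
    ring

/-- For every natural `l` and reals `α, β` with `sin((α-β)/2) ≠ 0`, `sin((α+β)/2) ≠ 0`
and `sin β ≠ 0`:
`(sin α / sin β) Σ_{i=0}^{l} sin((i+1)α) sin((i+1)β)
  = (cos(α/2)cos(β/2)/(2 sin β))(sin((2l+3)(α-β)/2) - sin((2l+3)(α+β)/2))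
    + (cos(α/2)/(4cos(β/2)))((cos((α-β)/2)/sin((α-β)/2)) sin((2l+3)(α-β)/2)
       + (cos((α+β)/2)/sin((α+β)/2)) sin((2l+3)(α+β)/2))`. -/
theorem sum_sin_mul_sin_ratio (l : ℕ) (α β : ℝ)
    (h₁ : Real.sin ((α - β) / 2) ≠ 0) (h₂ : Real.sin ((α + β) / 2) ≠ 0)
    (h₃ : Real.sin β ≠ 0) :
    (Real.sin α / Real.sin β) *
        ∑ i ∈ Finset.range (l + 1),
          Real.sin (((i : ℝ) + 1) * α) * Real.sin (((i : ℝ) + 1) * β) =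
      (Real.cos (α / 2) * Real.cos (β / 2) / (2 * Real.sin β)) *
          (Real.sin ((2 * (l : ℝ) + 3) * (α - β) / 2) -
            Real.sin ((2 * (l : ℝ) + 3) * (α + β) / 2)) +
        (Real.cos (α / 2) / (4 * Real.cos (β / 2))) *
          ((Real.cos ((α - β) / 2) / Real.sin ((α - β) / 2)) *
              Real.sin ((2 * (l : ℝ) + 3) * (α - β) / 2) +
            (Real.cos ((α + β) / 2) / Real.sin ((α + β) / 2)) *
              Real.sin ((2 * (l : ℝ) + 3) * (α + β) / 2)) := by
  rw [aux_sum (l + 1) α β h₁ h₂]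
  have e : 2 * ((l + 1 : ℕ) : ℝ) + 1 = 2 * (l : ℝ) + 3 := by
    push_cast
    ring
  rw [e]
  have hb : Real.sin β = 2 * Real.sin (β / 2) * Real.cos (β / 2) := by
    rw [← Real.sin_two_mul]
    congr 1
    ring
  have ha : Real.sin α = 2 * Real.sin (α / 2) * Real.cos (α / 2) := by
    rw [← Real.sin_two_mul]
    congr 1
    ring
  have k1 : Real.sin (α / 2) = Real.sin ((α - β) / 2) * Real.cos (β / 2) +
      Real.cos ((α - β) / 2) * Real.sin (β / 2) := by
    rw [← Real.sin_add]
    congr 1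
    ring
  have k2 : Real.sin (α / 2) = Real.sin ((α + β) / 2) * Real.cos (β / 2) -
      Real.cos ((α + β) / 2) * Real.sin (β / 2) := by
    rw [← Real.sin_sub]
    congr 1
    ring
  have hsb : Real.sin (β / 2) ≠ 0 := by
    intro h
    apply h₃
    rw [hb, h]
    ring
  have hcb : Real.cos (β / 2) ≠ 0 := by
    intro h
    apply h₃
    rw [hb, h]
    ring
  rw [ha, hb]
  generalize Real.sin ((2 * (l : ℝ) + 3) * (α - β) / 2) = S
  generalize Real.sin ((2 * (l : ℝ) + 3) * (α + β) / 2) = T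
  generalize Real.sin ((α - β) / 2) = s1 at *
  generalize Real.sin ((α + β) / 2) = s2 at *
  generalize Real.cos ((α - β) / 2) = c1 at *
  generalize Real.cos ((α + β) / 2) = c2 at *
  generalize Real.sin (α / 2) = sa at *
  generalize Real.cos (α / 2) = ca at *
  generalize Real.sin (β / 2) = sb at *
  generalize Real.cos (β / 2) = cb at *
  have t1 : 2 * sa * ca / (2 * sb * cb) * (S / (4 * s1)) =
      ca * cb / (2 * (2 * sb * cb)) * S + ca / (4 * cb) * (c1 / s1 * S) := by
    rw [k1]
    field_simp
    ring
  have t2 : 2 * sa * ca / (2 * sb * cb) * (T / (4 * s2)) =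
      ca * cb / (2 * (2 * sb * cb)) * T - ca / (4 * cb) * (c2 / s2 * T) := by
    rw [k2]
    field_simp
    ring
  rw [mul_sub, t1, t2]
  ring
end

section
/- Let n be an even positive integer and let w_m = mπ/(n+2) for m = 1,…,n+1. Then for every θ ∈ [0, π/2], Σ_{m=1}^{n+1} 1/sin²((w_m + θ)/2) ≤ 8(n+2)²/π. -/
open Real Finset

lemma aux_term_s18 (n m : ℕ) (hm : 1 ≤ m) (hm' : m ≤ n + 1)
    (θ : ℝ) (hθ : θ ∈ Set.Icc 0 (π / 2)) :
    1 / Real.sin ((mpW n m + θ) / 2) ^ 2 ≤ ((n : ℝ) + 2) ^ 2 * (1 / (m : ℝ) ^ 2) + 1 := by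
  obtain ⟨h0, h1⟩ := hθ
  have hN : (0 : ℝ) < (n : ℝ) + 2 := by positivity
  have hmR : (1 : ℝ) ≤ m := by exact_mod_cast hm
  have hmR' : (m : ℝ) ≤ n + 1 := by exact_mod_cast hm'
  have hpi := Real.pi_pos
  have hw : mpW n m = ((m : ℝ) / (n + 2)) * π := by unfold mpW; ring
  have hq0 : 0 < (m : ℝ) / (n + 2) := by positivity
  have hq1 : (m : ℝ) / (n + 2) ≤ 1 := by
    rw [div_le_one hN]; linarith
  have hinv : ((n : ℝ) + 2) ^ 2 * (1 / (m : ℝ) ^ 2) = 1 / ((m : ℝ) / (n + 2)) ^ 2 := by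
    field_simp
  rw [hinv, hw]
  generalize (m : ℝ) / (n + 2) = q at *
  have hqp : 0 < q * π := by positivity
  have hqp' : q * π ≤ π := by nlinarith
  have hge : 1 ≤ 1 / q ^ 2 := by
    rw [le_div_iff₀ (by positivity)]; nlinarith
  rcases le_total ((q * π + θ) / 2) (π / 2) with hx | hx
  · have hs := Real.mul_le_sin (x := (q * π + θ) / 2) (by linarith) hx
    have hq : q ≤ 2 / π * ((q * π + θ) / 2) := by
      have : 2 / π * ((q * π + θ) / 2) = q + θ / π := by field_simp
      rw [this]
      have : 0 ≤ θ / π := by positivity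
      linarith
    have : 1 / Real.sin ((q * π + θ) / 2) ^ 2 ≤ 1 / q ^ 2 := by
      apply one_div_le_one_div_of_le (by positivity)
      exact pow_le_pow_left₀ hq0.le (hq.trans hs) 2
    linarith
  · have hc : Real.cos (2 * ((q * π + θ) / 2)) ≤ 0 :=
      Real.cos_nonpos_of_pi_div_two_le_of_le (by linarith) (by linarith)
    have hs : 1 / 2 ≤ Real.sin ((q * π + θ) / 2) ^ 2 := by
      rw [Real.sin_sq_eq_half_sub]; linarith
    have := one_div_le_one_div_of_le (by norm_num) hs
    norm_num at this hge ⊢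
    linarith

lemma aux_sum_s18 (k : ℕ) :
    ∑ m ∈ Finset.Icc 1 (k + 1), 1 / (m : ℝ) ^ 2 ≤ 2 - 1 / ((k : ℝ) + 1) := by
  induction k with
  | zero => norm_num
  | succ k ih =>
    rw [Finset.sum_Icc_succ_top (by omega)]
    have : 1 / (((k + 1 + 1 : ℕ) : ℝ)) ^ 2 ≤ 1 / ((k : ℝ) + 1) - 1 / ((k : ℝ) + 1 + 1) := by
      push_cast
      rw [div_sub_div _ _ (by positivity) (by positivity),
        div_le_div_iff₀ (by positivity) (by positivity)]
      have : (0 : ℝ) ≤ k := by positivity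
      nlinarith
    push_cast at this ⊢
    linarith

/-- For an even positive integer `n` and `θ ∈ [0, π/2]`, with `w_m = mπ/(n+2)`,
`Σ_{m=1}^{n+1} 1/sin²((w_m+θ)/2) ≤ 8(n+2)²/π`. -/
theorem sum_inv_sin_sq_le (n : ℕ) (hn : 0 < n) (hne : Even n)
    (θ : ℝ) (hθ : θ ∈ Set.Icc 0 (π / 2)) :
    ∑ m ∈ Finset.Icc 1 (n + 1), 1 / Real.sin ((mpW n m + θ) / 2) ^ 2 ≤
      8 * ((n : ℝ) + 2) ^ 2 / π := by
  have h1 : ∑ m ∈ Finset.Icc 1 (n + 1), 1 / Real.sin ((mpW n m + θ) / 2) ^ 2 ≤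
      ∑ m ∈ Finset.Icc 1 (n + 1), (((n : ℝ) + 2) ^ 2 * (1 / (m : ℝ) ^ 2) + 1) := by
    apply Finset.sum_le_sum
    intro m hm
    rw [Finset.mem_Icc] at hm
    exact aux_term_s18 n m hm.1 hm.2 θ hθ
  rw [Finset.sum_add_distrib, ← Finset.mul_sum] at h1
  simp only [Finset.sum_const, Nat.card_Icc, nsmul_eq_mul, mul_one] at h1
  push_cast [Nat.add_sub_cancel] at h1
  have h2 := mul_le_mul_of_nonneg_left (aux_sum_s18 n) (sq_nonneg ((n : ℝ) + 2))
  have h3 : (n : ℝ) + 1 ≤ ((n : ℝ) + 2) ^ 2 * (1 / ((n : ℝ) + 1)) := by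
    rw [mul_one_div, le_div_iff₀ (by positivity)]
    nlinarith [(Nat.cast_nonneg n : (0 : ℝ) ≤ n)]
  have h4 : 2 * ((n : ℝ) + 2) ^ 2 ≤ 8 * ((n : ℝ) + 2) ^ 2 / π := by
    rw [le_div_iff₀ Real.pi_pos]
    nlinarith [Real.pi_le_four, sq_nonneg ((n : ℝ) + 2)]
  linarith
end
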